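/- arXiv:2411.07761 — 2 statements merged into one kernel-verified Lean document; each statement's English description precedes it below -/
import Mathlib

section
/- (The Bieberbach conjecture / de Branges' theorem.) Let f belong to the class S, with Taylor coefficients a_n = f⁽ⁿ⁾(0)/n!. Then |a_n| ≤ n for every n ≥ 2. -/
open Metric

namespace DeBranges

open Polynomial Finset in
/-- The coefficients of the de Branges weights. -/
noncomputable def lamCoeff (N k m : ℕ) : ℝ :=
  (-1) ^ (m + k) * (N + 1 + m).choose (2 * m + 1) * (2 * m).choose (m + k)

noncomputable def lam (N k : ℕ) (s : ℝ) : ℝ :=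
  ∑ m ∈ Finset.range (N + 1), lamCoeff N k m * s ^ m

/-- The de Branges weights, as functions of `s = exp (-t)`. -/
noncomputable def weight (N k : ℕ) (s : ℝ) : ℝ :=
  ∑ m ∈ Finset.range (N + 1), (k / m : ℝ) * lamCoeff N k m * s ^ m

lemma lamCoeff_succ (N k m : ℕ) :
    (m + k + 1 : ℝ) * lamCoeff N (k + 1) m = -((m : ℝ) - k) * lamCoeff N k m := by
  unfold lamCoeff
  have h := Nat.choose_succ_right_eq (2 * m) (m + k)
  rcases le_or_gt k m with hk | hk
  · have h2 : 2 * m - (m + k) = m - k := by omega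
    rw [h2] at h
    have h' : ((2 * m).choose (m + k + 1) : ℝ) * (m + k + 1) = (2 * m).choose (m + k) * (m - k) := by
      rw [← Nat.cast_sub hk]; exact_mod_cast h
    rw [← add_assoc m k 1, pow_succ]
    linear_combination (-(-1) ^ (m + k) * ((N + 1 + m).choose (2 * m + 1) : ℝ)) * h'
  · rw [Nat.choose_eq_zero_of_lt (by omega : 2 * m < m + k),
      Nat.choose_eq_zero_of_lt (by omega : 2 * m < m + (k + 1))]
    simp

lemma lamCoeff_zero_right (N k : ℕ) (hk : 1 ≤ k) : lamCoeff N k 0 = 0 := by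
  unfold lamCoeff
  rw [Nat.choose_eq_zero_of_lt (by omega : 2 * 0 < 0 + k)]
  simp

lemma weight_sub_weight_succ (N k : ℕ) (hk : 1 ≤ k) (s : ℝ) :
    weight N k s - weight N (k + 1) s = lam N k s + lam N (k + 1) s := by
  unfold weight lam
  rw [← Finset.sum_sub_distrib, ← Finset.sum_add_distrib]
  refine Finset.sum_congr rfl fun m _ => ?_
  rcases Nat.eq_zero_or_pos m with rfl | hm
  · simp [lamCoeff_zero_right N k hk, lamCoeff_zero_right N (k + 1) (by omega)]
  · have hm' : (m : ℝ) ≠ 0 := by positivity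
    have h := lamCoeff_succ N k m
    push_cast
    field_simp
    linear_combination -(s ^ m) * h

lemma lam_eq_zero (N k : ℕ) (hk : N < k) (s : ℝ) : lam N k s = 0 := by
  refine Finset.sum_eq_zero fun m hm => ?_
  rw [Finset.mem_range] at hm
  simp [lamCoeff, Nat.choose_eq_zero_of_lt (by omega : 2 * m < m + k)]

lemma weight_eq_zero (N k : ℕ) (hk : N < k) (s : ℝ) : weight N k s = 0 := by
  refine Finset.sum_eq_zero fun m hm => ?_
  rw [Finset.mem_range] at hm
  simp [lamCoeff, Nat.choose_eq_zero_of_lt (by omega : 2 * m < m + k)]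

/-- A rescaled and shifted Chebyshev polynomial of the second kind. -/
noncomputable def cheb (N : ℕ) (w : ℝ) : ℝ :=
  ∑ m ∈ Finset.range (N + 1), ((N + 1 + m).choose (2 * m + 1) : ℝ) * w ^ m

lemma cheb_eq_sum (N M : ℕ) (h : N ≤ M) (w : ℝ) :
    cheb N w = ∑ m ∈ Finset.range (M + 1), ((N + 1 + m).choose (2 * m + 1) : ℝ) * w ^ m := by
  unfold cheb
  refine Finset.sum_subset (Finset.range_mono (by omega)) fun m _ hm => ?_
  rw [Finset.mem_range] at hm
  rw [Nat.choose_eq_zero_of_lt (by omega)]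
  simp

lemma cheb_add_two (N : ℕ) (w : ℝ) :
    cheb (N + 2) w = (2 + w) * cheb (N + 1) w - cheb N w := by
  rw [add_mul, cheb_eq_sum N (N + 2) (by omega), cheb_eq_sum (N + 2) (N + 2) le_rfl]
  have h1 : w * cheb (N + 1) w =
      ∑ m ∈ Finset.range (N + 2), ((N + 2 + m).choose (2 * m + 1) : ℝ) * w ^ (m + 1) := by
    unfold cheb
    rw [Finset.mul_sum]
    refine Finset.sum_congr (by rfl) fun m _ => ?_
    rw [pow_succ]; ring
  rw [h1, cheb_eq_sum (N + 1) (N + 2) (by omega), Finset.sum_range_succ', Finset.mul_sum,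
    Finset.sum_range_succ' _ (N + 2), Finset.sum_range_succ' _ (N + 2)]
  have h2 : ∀ m : ℕ, (((N + 2 + 1 + (m + 1)).choose (2 * (m + 1) + 1) : ℕ) : ℝ) =
      2 * ((N + 1 + 1 + (m + 1)).choose (2 * (m + 1) + 1) : ℕ)
       + ((N + 2 + m).choose (2 * m + 1) : ℕ) - ((N + 1 + (m + 1)).choose (2 * (m + 1) + 1) : ℕ) := by
    intro m
    have e1 : N + 2 + 1 + (m + 1) = (N + 2 + m) + 1 + 1 := by ring
    have e2 : N + 1 + 1 + (m + 1) = (N + 2 + m) + 1 := by ring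
    have e3 : N + 1 + (m + 1) = N + 2 + m := by ring
    have e4 : 2 * (m + 1) + 1 = (2 * m + 1) + 1 + 1 := by ring
    rw [e1, e2, e3, e4, Nat.choose_succ_succ (N + 2 + m + 1), Nat.choose_succ_succ (N + 2 + m) (2 * m + 1),
      Nat.choose_succ_succ (N + 2 + m) (2 * m + 1 + 1)]
    push_cast; ring
  simp only [h2]
  simp only [add_mul, sub_mul, Finset.sum_add_distrib, Finset.sum_sub_distrib, mul_zero, pow_zero,
    Nat.choose_one_right, zero_add, add_zero, mul_assoc, mul_one]
  push_cast
  ring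

lemma cheb_eq_geom (N : ℕ) (x y : ℝ) (h : x * y = 1) :
    cheb N (x + y - 2) = ∑ j ∈ Finset.range (N + 1), x ^ j * y ^ (N - j) := by
  have hrec : ∀ n, ∑ j ∈ Finset.range (n + 3), x ^ j * y ^ (n + 2 - j) =
      (x + y) * ∑ j ∈ Finset.range (n + 2), x ^ j * y ^ (n + 1 - j)
        - ∑ j ∈ Finset.range (n + 1), x ^ j * y ^ (n - j) := by
    intro n
    have hs : ∀ n, ∑ j ∈ Finset.range (n + 2), x ^ j * y ^ (n + 1 - j) =
        y * ∑ j ∈ Finset.range (n + 1), x ^ j * y ^ (n - j) + x ^ (n + 1) := by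
      intro n
      rw [Finset.sum_range_succ, Finset.mul_sum]
      congr 1
      · refine Finset.sum_congr rfl fun j hj => ?_
        rw [Finset.mem_range] at hj
        rw [show n + 1 - j = (n - j) + 1 by omega, pow_succ]; ring
      · simp
    rw [hs (n + 1), hs n]
    linear_combination (-(∑ j ∈ Finset.range (n + 1), x ^ j * y ^ (n - j))) * h
  induction N using Nat.twoStepInduction with
  | zero => simp [cheb]
  | one => simp [cheb, Finset.sum_range_succ]; ring
  | more n h1 h2 => rw [cheb_add_two, h1, h2, hrec]; ring

open Polynomial in
/-- The generating polynomial of `lam N k s`, centred at degree `N`. -/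
noncomputable def lamPoly (N : ℕ) (s : ℝ) : ℝ[X] :=
  ∑ m ∈ Finset.range (N + 1),
    C (((N + 1 + m).choose (2 * m + 1) : ℝ) * s ^ m) * (X ^ (N - m) * (X - C 1) ^ (2 * m))

open Polynomial in
lemma lamPoly_coeff (N k : ℕ) (s : ℝ) : (lamPoly N s).coeff (N + k) = lam N k s := by
  unfold lamPoly lam
  rw [finsetSum_coeff]
  refine Finset.sum_congr rfl fun m hm => ?_
  rw [Finset.mem_range] at hm
  rw [coeff_C_mul, show N + k = (m + k) + (N - m) by omega, coeff_X_pow_mul,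
    sub_eq_add_neg, ← C_neg, coeff_X_add_C_pow]
  unfold lamCoeff
  rcases le_or_gt k m with hk | hk
  · have : ((-1 : ℝ)) ^ (2 * m - (m + k)) = (-1) ^ (m + k) := by
      rw [show m + k = (2 * m - (m + k)) + 2 * k by omega]
      rw [show 2 * m - (2 * m - (m + k) + 2 * k) = 2 * m - (m + k) by omega, pow_add, pow_mul]
      simp
    rw [this]; ring
  · rw [Nat.choose_eq_zero_of_lt (by omega : 2 * m < m + k)]
    simp

open Polynomial in
lemma lamPoly_eval (N : ℕ) (s y : ℝ) (hy : y ≠ 0) :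
    (lamPoly N s).eval y = y ^ N * cheb N (s * (y - 1) ^ 2 / y) := by
  unfold lamPoly cheb
  rw [eval_finsetSum, Finset.mul_sum]
  refine Finset.sum_congr rfl fun m hm => ?_
  rw [Finset.mem_range] at hm
  simp only [eval_mul, eval_C, eval_pow, eval_X, eval_sub]
  rw [div_pow, mul_pow, ← pow_mul]
  have : y ^ N = y ^ (N - m) * y ^ m := by rw [← pow_add]; congr 1; omega
  rw [this]
  field_simp

open Polynomial in
lemma lam_one (N k : ℕ) (hk : k ≤ N) : lam N k 1 = if Even (N + k) then 1 else 0 := by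
  have h : lamPoly N 1 = ∑ j ∈ Finset.range (N + 1), X ^ (2 * j) := by
    refine Polynomial.eq_of_infinite_eval_eq _ _ ((Set.Ioi_infinite (0 : ℝ)).mono fun y hy => ?_)
    have hy0 : y ≠ 0 := ne_of_gt hy
    have hc := cheb_eq_geom N y y⁻¹ (by field_simp)
    simp only [Set.mem_ofPred_eq]
    rw [lamPoly_eval _ _ _ hy0, show 1 * (y - 1) ^ 2 / y = y + y⁻¹ - 2 by field_simp; ring, hc,
      eval_finsetSum, Finset.mul_sum]
    refine Finset.sum_congr rfl fun j hj => ?_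
    rw [Finset.mem_range] at hj
    rw [eval_pow, eval_X, show y ^ N = y ^ (N - j) * y ^ j by rw [← pow_add]; congr 1; omega,
      inv_pow, pow_mul']
    field_simp
  rw [← lamPoly_coeff, h, finsetSum_coeff]
  simp only [coeff_X_pow]
  split_ifs with he
  · obtain ⟨r, hr⟩ := he
    rw [Finset.sum_eq_single r]
    · rw [if_pos (by omega)]
    · intro b _ hb; rw [if_neg (by omega)]
    · intro h; exact absurd (Finset.mem_range.2 (by omega)) h
  · refine Finset.sum_eq_zero fun j _ => ?_
    rw [if_neg]
    rintro h; exact he ⟨j, by omega⟩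

lemma weight_one (N k : ℕ) (hk : 1 ≤ k) (hkN : k ≤ N + 1) : weight N k 1 = N + 1 - k := by
  induction hkN using Nat.decreasingInduction with
  | self => rw [weight_eq_zero _ _ (by omega)]; push_cast; ring
  | of_succ k hkN ih =>
    have h := weight_sub_weight_succ N k hk 1
    have h1 : lam N k 1 + lam N (k + 1) 1 = 1 := by
      rw [lam_one N k (by omega)]
      rcases Nat.lt_or_ge k N with h | h
      · rw [lam_one N (k + 1) (by omega)]
        rcases Nat.even_or_odd (N + k) with he | ho
        · rw [if_pos he, if_neg (by rw [← add_assoc, Nat.not_even_iff_odd]; exact he.add_one)]; simp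
        · rw [if_neg (by rwa [Nat.not_even_iff_odd]), if_pos (by rw [← add_assoc]; exact ho.add_one)]
          simp
      · have : k = N := by omega
        subst this
        rw [lam_eq_zero _ _ (by omega), if_pos ⟨k, rfl⟩]; simp
    have := ih (by omega)
    push_cast at this ⊢
    linarith

open Polynomial in
/-- The matrix of the `N`-th symmetric power of a `2 × 2` matrix in the monomial basis. -/
noncomputable def symPow (N : ℕ) (A : Matrix (Fin 2) (Fin 2) ℝ) :
    Matrix (Fin (N + 1)) (Fin (N + 1)) ℝ := fun i j =>
  ((C (A 0 0) * X + C (A 0 1)) ^ (i : ℕ) * (C (A 1 0) * X + C (A 1 1)) ^ (N - i : ℕ)).coeff j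

open Polynomial in
lemma sum_coeff_fin (N : ℕ) (p : ℝ[X]) (hp : p.natDegree ≤ N) (x : ℝ) :
    ∑ j : Fin (N + 1), p.coeff j * x ^ (j : ℕ) = p.eval x := by
  rw [Polynomial.eval_eq_sum_range' (Nat.lt_succ_of_le hp),
    Fin.sum_univ_eq_sum_range (fun j => p.coeff j * x ^ j)]

open Polynomial in
lemma natDegree_linear_mul_le (N i : ℕ) (hi : i ≤ N) (a b c d : ℝ) :
    ((C a * X + C b) ^ i * (C c * X + C d) ^ (N - i)).natDegree ≤ N := by
  refine natDegree_mul_le.trans ?_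
  have h1 : ((C a * X + C b) ^ i).natDegree ≤ i * 1 := natDegree_pow_le_of_le i (by compute_degree)
  have h2 : ((C c * X + C d) ^ (N - i)).natDegree ≤ (N - i) * 1 :=
    natDegree_pow_le_of_le _ (by compute_degree)
  omega

lemma symPow_sum (N : ℕ) (A : Matrix (Fin 2) (Fin 2) ℝ) (i : Fin (N + 1)) (x : ℝ) :
    ∑ j : Fin (N + 1), symPow N A i j * x ^ (j : ℕ) =
      (A 0 0 * x + A 0 1) ^ (i : ℕ) * (A 1 0 * x + A 1 1) ^ (N - i : ℕ) := by
  unfold symPow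
  rw [sum_coeff_fin N _ (natDegree_linear_mul_le N i (by omega) _ _ _ _)]
  simp

lemma symPow_sum_hom (N : ℕ) (A : Matrix (Fin 2) (Fin 2) ℝ) (i : Fin (N + 1)) (u v : ℝ)
    (hv : v ≠ 0) :
    ∑ j : Fin (N + 1), symPow N A i j * (u ^ (j : ℕ) * v ^ (N - j : ℕ)) =
      (A 0 0 * u + A 0 1 * v) ^ (i : ℕ) * (A 1 0 * u + A 1 1 * v) ^ (N - i : ℕ) := by
  have h := congrArg (v ^ N * ·) (symPow_sum N A i (u / v))
  simp only [Finset.mul_sum] at h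
  have e1 : A 0 0 * u + A 0 1 * v = v * (A 0 0 * (u / v) + A 0 1) := by field_simp
  have e2 : A 1 0 * u + A 1 1 * v = v * (A 1 0 * (u / v) + A 1 1) := by field_simp
  have pw : ∀ j : Fin (N + 1), v ^ N = v ^ (j : ℕ) * v ^ (N - j : ℕ) := fun j => by
    rw [← pow_add]; congr 1; omega
  rw [e1, e2, mul_pow, mul_pow]
  calc _ = _ := ?_
    _ = _ := h
    _ = _ := by rw [pw i]; ring
  refine Finset.sum_congr rfl fun j _ => ?_
  rw [div_pow, pw j]
  field_simp

lemma eq_of_infinite_sum_eq (N : ℕ) (p q : Fin (N + 1) → ℝ) (S : Set ℝ) (hS : S.Infinite)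
    (h : ∀ x ∈ S, ∑ j : Fin (N + 1), p j * x ^ (j : ℕ) = ∑ j : Fin (N + 1), q j * x ^ (j : ℕ)) :
    p = q := by
  classical
  have key : (∑ j : Fin (N + 1), Polynomial.monomial (j : ℕ) (p j)) =
      ∑ j : Fin (N + 1), Polynomial.monomial (j : ℕ) (q j) := by
    refine Polynomial.eq_of_infinite_eval_eq _ _ (hS.mono fun x hx => ?_)
    simp only [Set.mem_ofPred_eq, Polynomial.eval_finsetSum, Polynomial.eval_monomial]
    exact h x hx
  funext j
  have := congrArg (fun P => Polynomial.coeff P (j : ℕ)) key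
  simpa [Polynomial.finsetSum_coeff, Polynomial.coeff_monomial, Fin.val_inj] using this

lemma infinite_linear_ne_zero (c d : ℝ) (h : c ≠ 0 ∨ d ≠ 0) : {x : ℝ | c * x + d ≠ 0}.Infinite := by
  have hfin : {x : ℝ | c * x + d = 0}.Finite := by
    by_cases hc : c = 0
    · subst hc
      have hd : d ≠ 0 := by simpa using h
      simp [hd]
    · refine (Set.finite_singleton (-d / c)).subset fun x hx => ?_
      simp only [Set.mem_ofPred_eq] at hx
      simp only [Set.mem_singleton_iff]
      field_simp
      linarith
  exact hfin.infinite_compl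

lemma symPow_mul (N : ℕ) (A B : Matrix (Fin 2) (Fin 2) ℝ) (hB : B.det ≠ 0) :
    symPow N (A * B) = symPow N A * symPow N B := by
  ext i l
  have hB' : B 1 0 ≠ 0 ∨ B 1 1 ≠ 0 := by
    by_contra h
    push Not at h
    apply hB
    rw [Matrix.det_fin_two, h.1, h.2]; ring
  refine congrFun (eq_of_infinite_sum_eq N (symPow N (A * B) i) ((symPow N A * symPow N B) i) _
    (infinite_linear_ne_zero _ _ hB') fun x hx => ?_) l
  rw [symPow_sum]
  simp only [Matrix.mul_apply, Finset.sum_mul]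
  rw [Finset.sum_comm]
  simp only [mul_assoc, ← Finset.mul_sum]
  simp only [symPow_sum]
  rw [symPow_sum_hom N A i _ _ hx]
  simp only [Fin.sum_univ_two]
  congr 2 <;> ring

lemma symPow_diagonal (N : ℕ) (x y : ℝ) :
    symPow N !![x, 0; 0, y] =
      Matrix.diagonal fun i : Fin (N + 1) => x ^ (i : ℕ) * y ^ (N - i : ℕ) := by
  ext i j
  simp only [symPow, Matrix.of_apply, Matrix.cons_val', Matrix.cons_val_zero, Matrix.cons_val_one,
    Matrix.cons_val_fin_one, Matrix.diagonal_apply, map_zero, add_zero, zero_mul, zero_add, mul_pow,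
    ← Polynomial.C_pow]
  rw [mul_assoc, Polynomial.coeff_C_mul, Polynomial.coeff_mul_C, Polynomial.coeff_X_pow]
  by_cases h : i = j
  · subst h; simp
  · rw [if_neg h, if_neg (fun h' => h (Fin.ext h'.symm))]; simp

lemma symPow_one (N : ℕ) : symPow N 1 = 1 := by
  rw [show (1 : Matrix (Fin 2) (Fin 2) ℝ) = !![1, 0; 0, 1] from Matrix.one_fin_two,
    symPow_diagonal]
  simp

lemma trace_symPow (N : ℕ) (A : Matrix (Fin 2) (Fin 2) ℝ) (x y : ℝ) (hA : A.det = 1)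
    (htr : A.trace = x + y) (hxy : x * y = 1) (hne : x ≠ y) (hc : A 1 0 ≠ 0) :
    (symPow N A).trace = ∑ j ∈ Finset.range (N + 1), x ^ j * y ^ (N - j) := by
  rw [Matrix.det_fin_two] at hA
  rw [Matrix.trace_fin_two] at htr
  set P : Matrix (Fin 2) (Fin 2) ℝ := !![A 1 0, x - A 0 0; A 1 0, y - A 0 0] with hP
  set D : Matrix (Fin 2) (Fin 2) ℝ := !![x, 0; 0, y] with hD
  have hPdet : P.det ≠ 0 := by
    have : P.det = A 1 0 * (y - x) := by rw [hP, Matrix.det_fin_two]; simp; ring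
    rw [this]
    exact mul_ne_zero hc (sub_ne_zero.2 hne.symm)
  have hPA : P * A = D * P := by
    ext i j
    fin_cases i <;> fin_cases j <;> simp [hP, hD, Matrix.mul_apply, Fin.sum_univ_two]
    · ring
    · linear_combination (-A 0 0 + x) * htr - hA + hxy - x * htr + (A 0 0) * htr + (x)*htr
    · ring
    · linear_combination (-A 0 0 + y) * htr - hA + hxy - y * htr + (A 0 0) * htr + (y)*htr
  have hPinv : symPow N P * symPow N P⁻¹ = 1 := by
    rw [← symPow_mul, Matrix.mul_nonsing_inv _ (Ne.isUnit hPdet), symPow_one]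
    rw [Matrix.det_nonsing_inv]
    simpa using hPdet
  have hmul : symPow N P * symPow N A = symPow N D * symPow N P := by
    rw [← symPow_mul, ← symPow_mul _ _ _ hPdet, hPA]
    rw [Matrix.det_fin_two, hA]; exact one_ne_zero
  have h : (symPow N A).trace = (symPow N D).trace := by
    calc (symPow N A).trace = (symPow N P⁻¹ * symPow N P * symPow N A).trace := by
          rw [mul_eq_one_comm.1 hPinv, one_mul]
      _ = (symPow N P⁻¹ * (symPow N D * symPow N P)).trace := by rw [mul_assoc, hmul]
      _ = (symPow N D).trace := by
          rw [Matrix.trace_mul_comm, mul_assoc, hPinv, mul_one]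
  rw [h, hD, symPow_diagonal, Matrix.trace_diagonal,
    Fin.sum_univ_eq_sum_range (fun j => x ^ j * y ^ (N - j))]

lemma choose_mul_symPow_transpose (N : ℕ) (A : Matrix (Fin 2) (Fin 2) ℝ) (i j : Fin (N + 1)) :
    (N.choose i : ℝ) * symPow N A i j = N.choose j * symPow N A.transpose j i := by
  have key : ∀ x t : ℝ,
      ∑ j : Fin (N + 1), (∑ i : Fin (N + 1), (N.choose i * symPow N A i j) * t ^ (i : ℕ)) * x ^ (j : ℕ)
      = ∑ j : Fin (N + 1), (∑ i : Fin (N + 1), (N.choose j * symPow N A.transpose j i) * t ^ (i : ℕ))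
        * x ^ (j : ℕ) := by
    intro x t
    have h1 : ∀ (A : Matrix (Fin 2) (Fin 2) ℝ) (x t : ℝ),
        ∑ i : Fin (N + 1), (N.choose i * ∑ j : Fin (N + 1), symPow N A i j * x ^ (j : ℕ))
          * t ^ (i : ℕ) = ((A 0 0 * x + A 0 1) * t + (A 1 0 * x + A 1 1)) ^ N := by
      intro A x t
      simp only [symPow_sum]
      rw [add_pow, ← Fin.sum_univ_eq_sum_range (fun i => ((A 0 0 * x + A 0 1) * t) ^ i *
        (A 1 0 * x + A 1 1) ^ (N - i) * (N.choose i : ℝ))]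
      refine Finset.sum_congr rfl fun i _ => ?_
      rw [mul_pow]; ring
    have h2 := h1 A x t
    have h3 := h1 A.transpose t x
    have h4 : ((A 0 0 * x + A 0 1) * t + (A 1 0 * x + A 1 1)) ^ N =
      ((A.transpose 0 0 * t + A.transpose 0 1) * x + (A.transpose 1 0 * t + A.transpose 1 1)) ^ N := by
      simp only [Matrix.transpose_apply]; congr 1; ring
    rw [h4, ← h3] at h2
    simp only [Finset.mul_sum, Finset.sum_mul] at h2 ⊢
    rw [Finset.sum_comm]
    refine (Finset.sum_congr rfl fun _ _ => Finset.sum_congr rfl fun _ _ => by ring).trans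
      (h2.trans (Finset.sum_congr rfl fun _ _ => Finset.sum_congr rfl fun _ _ => by ring))
  have k1 : ∀ t : ℝ, ∑ i : Fin (N + 1), (N.choose i * symPow N A i j) * t ^ (i : ℕ) =
      ∑ i : Fin (N + 1), (N.choose j * symPow N A.transpose j i) * t ^ (i : ℕ) := fun t =>
    congrFun (eq_of_infinite_sum_eq N _ _ Set.univ Set.infinite_univ fun x _ => key x t) j
  exact congrFun (eq_of_infinite_sum_eq N _ _ Set.univ Set.infinite_univ fun t _ => k1 t) i

lemma symPow_mul_transpose_nonneg (N : ℕ) (A : Matrix (Fin 2) (Fin 2) ℝ) (i j : Fin (N + 1)) :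
    0 ≤ symPow N A i j * symPow N A.transpose j i := by
  have h := choose_mul_symPow_transpose N A i j
  have hi : (0 : ℝ) < N.choose i := by exact_mod_cast Nat.choose_pos (by omega)
  have hj : (0 : ℝ) < N.choose j := by exact_mod_cast Nat.choose_pos (by omega)
  have : symPow N A.transpose j i = N.choose i * symPow N A i j / N.choose j := by
    field_simp; linarith
  rw [this]
  have h2 : symPow N A i j * (N.choose i * symPow N A i j / N.choose j) =
    (symPow N A i j) ^ 2 * (N.choose i / N.choose j) := by ring
  rw [h2]; positivity

lemma exists_add_eq_mul_eq_one (τ : ℝ) (h : 2 < τ) : ∃ x y : ℝ, x + y = τ ∧ x * y = 1 ∧ x ≠ y := by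
  have h4 : 0 < τ ^ 2 - 4 := by nlinarith
  have hs := Real.sq_sqrt h4.le
  have hp := Real.sqrt_pos.2 h4
  refine ⟨(τ + √(τ ^ 2 - 4)) / 2, (τ - √(τ ^ 2 - 4)) / 2, by ring, ?_, ?_⟩
  · linear_combination (-1 / 4) * hs
  · intro h; linarith

open Polynomial in
lemma lamPoly_eq_sum_sq (N : ℕ) (a b : ℝ) (ha : a ≠ 0) (hb : b ≠ 0) (hab : a ^ 2 + b ^ 2 = 1) :
    lamPoly N (b ^ 2) = ∑ i : Fin (N + 1), ∑ j : Fin (N + 1),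
      C (symPow N !![a, b; -b, a] i j * symPow N (!![a, b; -b, a]).transpose j i) *
        X ^ (N + i - j : ℕ) := by
  refine Polynomial.eq_of_infinite_eval_eq _ _ ((Set.Ioi_infinite (1 : ℝ)).mono fun y hy => ?_)
  have hy1 : 1 < y := hy
  have hy0 : y ≠ 0 := by linarith
  set M : Matrix (Fin 2) (Fin 2) ℝ := !![a, b; -b, a] with hM
  set D : Matrix (Fin 2) (Fin 2) ℝ := !![y, 0; 0, 1] with hD
  set E : Matrix (Fin 2) (Fin 2) ℝ := !![y⁻¹, 0; 0, 1] with hE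
  have dM : M.det = 1 := by rw [hM, Matrix.det_fin_two]; simp; linarith
  have dE : E.det = y⁻¹ := by rw [hE, Matrix.det_fin_two]; simp
  have dD : D.det = y := by rw [hD, Matrix.det_fin_two]; simp
  have dMT : M.transpose.det = 1 := by rw [Matrix.det_transpose, dM]
  set A := D * M * E * M.transpose with hA
  have hdet : A.det = 1 := by
    rw [hA]; simp only [Matrix.det_mul, dM, dE, dD, dMT]; field_simp
  have htr : A.trace = 2 + b ^ 2 * (y - 1) ^ 2 / y := by
    rw [hA, Matrix.trace_fin_two]
    simp [hD, hM, hE, Matrix.mul_apply, Fin.sum_univ_two]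
    field_simp
    linear_combination (2 * y) * hab
  have hc : A 1 0 ≠ 0 := by
    have : A 1 0 = a * b * (1 - y⁻¹) := by
      rw [hA]
      simp [hD, hM, hE, Matrix.mul_apply, Fin.sum_univ_two]
      ring
    rw [this]
    have : y⁻¹ < 1 := inv_lt_one_of_one_lt₀ hy1
    have : 1 - y⁻¹ ≠ 0 := by linarith
    positivity
  have hpos : 0 < b ^ 2 * (y - 1) ^ 2 / y := by
    have : y - 1 ≠ 0 := by linarith
    have : 0 < y := by linarith
    positivity
  obtain ⟨u, v, huv, huv1, hne⟩ := exists_add_eq_mul_eq_one A.trace (by rw [htr]; linarith)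
  have ht := trace_symPow N A u v hdet huv.symm huv1 hne hc
  rw [← cheb_eq_geom N u v huv1, huv, htr] at ht
  simp only [Set.mem_ofPred_eq]
  rw [lamPoly_eval _ _ _ hy0, show b ^ 2 * (y - 1) ^ 2 / y = 2 + b ^ 2 * (y - 1) ^ 2 / y - 2 by ring,
    ← ht, hA, symPow_mul _ _ _ (by rw [dMT]; exact one_ne_zero),
    symPow_mul _ _ _ (by rw [dE]; exact inv_ne_zero hy0),
    symPow_mul _ _ _ (by rw [dM]; exact one_ne_zero), hD, hE, symPow_diagonal, symPow_diagonal,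
    Matrix.trace, Finset.mul_sum, eval_finsetSum]
  refine Finset.sum_congr rfl fun i _ => ?_
  rw [Matrix.diag_apply, Matrix.mul_apply, Finset.mul_sum, eval_finsetSum]
  refine Finset.sum_congr rfl fun j _ => ?_
  rw [Matrix.mul_diagonal, Matrix.diagonal_mul]
  simp only [one_pow, mul_one, eval_mul, eval_C, eval_pow, eval_X]
  have : y ^ (N + i - j : ℕ) * y ^ (j : ℕ) = y ^ N * y ^ (i : ℕ) := by
    rw [← pow_add, ← pow_add]; congr 1; omega
  rw [inv_pow]
  field_simp
  linear_combination (-symPow N M i j * symPow N M.transpose j i) * this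

lemma lam_nonneg_of_mem_Ioo (N k : ℕ) (s : ℝ) (h0 : 0 < s) (h1 : s < 1) : 0 ≤ lam N k s := by
  have hs : s = (√s) ^ 2 := (Real.sq_sqrt h0.le).symm
  have hs1 : (√(1 - s)) ^ 2 = 1 - s := Real.sq_sqrt (by linarith)
  have ha : √(1 - s) ≠ 0 := (Real.sqrt_pos.2 (by linarith)).ne'
  have hb : √s ≠ 0 := (Real.sqrt_pos.2 h0).ne'
  rw [← lamPoly_coeff, hs, lamPoly_eq_sum_sq N _ _ ha hb (by rw [hs1, ← hs]; ring),
    Polynomial.finsetSum_coeff]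
  refine Finset.sum_nonneg fun i _ => ?_
  rw [Polynomial.finsetSum_coeff]
  refine Finset.sum_nonneg fun j _ => ?_
  rw [Polynomial.coeff_C_mul, Polynomial.coeff_X_pow]
  refine mul_nonneg (symPow_mul_transpose_nonneg N _ i j) ?_
  split_ifs <;> norm_num

lemma lam_nonneg (N k : ℕ) (s : ℝ) (h0 : 0 ≤ s) (h1 : s ≤ 1) : 0 ≤ lam N k s := by
  have hc : Continuous (lam N k) := by unfold lam; fun_prop
  have : IsClosed {s | 0 ≤ lam N k s} := isClosed_le continuous_const hc
  have h2 := this.closure_subset_iff.2 (fun s (hs : s ∈ Set.Ioo (0 : ℝ) 1) =>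
    lam_nonneg_of_mem_Ioo N k s hs.1 hs.2)
  rw [closure_Ioo zero_ne_one] at h2
  exact h2 ⟨h0, h1⟩

lemma hasDerivAt_weight (N k : ℕ) (hk : 1 ≤ k) (s : ℝ) (hs : s ≠ 0) :
    HasDerivAt (weight N k) (k * lam N k s / s) s := by
  unfold weight lam
  rw [Finset.mul_sum, Finset.sum_div]
  refine HasDerivAt.fun_sum fun m _ => ?_
  have := (hasDerivAt_pow m s).const_mul ((k / m : ℝ) * lamCoeff N k m)
  convert! this using 1
  rcases Nat.eq_zero_or_pos m with rfl | hm
  · simp [lamCoeff_zero_right N k hk]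
  · have : s ^ m = s ^ (m - 1) * s := by rw [← pow_succ]; congr 1; omega
    rw [this]
    field_simp

lemma weight_nonneg (N k : ℕ) (hk : 1 ≤ k) (s : ℝ) (h0 : 0 ≤ s) (h1 : s ≤ 1) :
    0 ≤ weight N k s := by
  have hmono : MonotoneOn (weight N k) (Set.Icc 0 1) := by
    refine monotoneOn_of_deriv_nonneg (convex_Icc 0 1) (by unfold weight; fun_prop)
      (by unfold weight; fun_prop) fun x hx => ?_
    rw [interior_Icc] at hx
    rw [(hasDerivAt_weight N k hk x hx.1.ne').deriv]
    exact div_nonneg (mul_nonneg (Nat.cast_nonneg k) (lam_nonneg N k x hx.1.le hx.2.le)) hx.1.le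
  have h := hmono (by simp) (Set.mem_Icc.2 ⟨h0, h1⟩) h0
  refine le_trans (le_of_eq ?_) h
  unfold weight
  refine (Finset.sum_eq_zero fun m _ => ?_).symm
  rcases Nat.eq_zero_or_pos m with rfl | hm
  · simp
  · have h0 := hm.ne'
    simp [h0]

/-- `u α = a - (1 - α) b + O((1 - α) ^ 2)` on `[1/2, 1]`. -/
def Near (u : ℝ → ℝ) (a b : ℝ) : Prop :=
  ∃ K, 0 ≤ K ∧ ∀ α, 1 / 2 ≤ α → α ≤ 1 → |u α - (a - (1 - α) * b)| ≤ K * (1 - α) ^ 2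

lemma Near.of_eq {u : ℝ → ℝ} {a b a' b' : ℝ} (h : Near u a b) (ha : a = a') (hb : b = b') :
    Near u a' b' := ha ▸ hb ▸ h

lemma near_const (a : ℝ) : Near (fun _ => a) a 0 := ⟨0, le_rfl, fun α _ _ => by simp⟩

lemma near_id : Near (fun α => α) 1 1 := ⟨0, le_rfl, fun α _ _ => by simp⟩

lemma near_inv : Near (fun α => α⁻¹) 1 (-1) := by
  refine ⟨2, by norm_num, fun α h h1 => ?_⟩
  have h0 : 0 < α := by linarith
  have : α⁻¹ - (1 - (1 - α) * -1) = α⁻¹ * (1 - α) ^ 2 := by field_simp; ring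
  rw [this, abs_of_nonneg (by positivity)]
  gcongr
  rw [inv_le_comm₀ h0 (by norm_num)]
  linarith

lemma Near.add {u v : ℝ → ℝ} {a b a' b' : ℝ} (h : Near u a b) (h' : Near v a' b') :
    Near (fun α => u α + v α) (a + a') (b + b') := by
  obtain ⟨K, hK, h⟩ := h
  obtain ⟨K', hK', h'⟩ := h'
  refine ⟨K + K', by positivity, fun α h1 h2 => ?_⟩
  calc _ = |(u α - (a - (1 - α) * b)) + (v α - (a' - (1 - α) * b'))| := by congr 1; ring
    _ ≤ _ := abs_add_le _ _
    _ ≤ K * (1 - α) ^ 2 + K' * (1 - α) ^ 2 := add_le_add (h α h1 h2) (h' α h1 h2)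
    _ = _ := by ring

lemma Near.mul {u v : ℝ → ℝ} {a b a' b' : ℝ} (h : Near u a b) (h' : Near v a' b') :
    Near (fun α => u α * v α) (a * a') (a * b' + b * a') := by
  obtain ⟨K, hK, h⟩ := h
  obtain ⟨K', hK', h'⟩ := h'
  refine ⟨K * (|a'| + |b'| + K') + (|a| + |b|) * K' + |b * b'|, by positivity, fun α h1 h2 => ?_⟩
  have hx0 : 0 ≤ 1 - α := by linarith
  have hx1 : 1 - α ≤ 1 := by linarith
  have hx2 : (1 - α) ^ 2 ≤ 1 := pow_le_one₀ hx0 hx1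
  have bd : ∀ p q : ℝ, |p - (1 - α) * q| ≤ |p| + |q| := fun p q => by
    refine (abs_sub _ _).trans ?_
    rw [abs_mul, abs_of_nonneg hx0]
    gcongr
    exact mul_le_of_le_one_left (abs_nonneg _) hx1
  have hv : |v α| ≤ |a'| + |b'| + K' := by
    calc |v α| = |(a' - (1 - α) * b') + (v α - (a' - (1 - α) * b'))| := by congr 1; ring
      _ ≤ _ := abs_add_le _ _
      _ ≤ |a'| + |b'| + K' * (1 - α) ^ 2 := add_le_add (bd _ _) (h' α h1 h2)
      _ ≤ _ := by gcongr; exact mul_le_of_le_one_right hK' hx2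
  calc _ = |(u α - (a - (1 - α) * b)) * v α + (a - (1 - α) * b) * (v α - (a' - (1 - α) * b'))
        + b * b' * (1 - α) ^ 2| := by congr 1; ring
    _ ≤ |(u α - (a - (1 - α) * b)) * v α| + |(a - (1 - α) * b) * (v α - (a' - (1 - α) * b'))|
        + |b * b' * (1 - α) ^ 2| := (abs_add_le _ _).trans (by gcongr; exact abs_add_le _ _)
    _ ≤ (K * (1 - α) ^ 2) * (|a'| + |b'| + K') + (|a| + |b|) * (K' * (1 - α) ^ 2)
        + |b * b'| * (1 - α) ^ 2 := by
      rw [abs_mul, abs_mul (a - _), abs_mul (b * b'), abs_of_nonneg (sq_nonneg (1 - α))]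
      gcongr
      · exact h α h1 h2
      · exact bd _ _
      · exact h' α h1 h2
    _ = _ := by ring

lemma Near.const_mul {u : ℝ → ℝ} {a b : ℝ} (r : ℝ) (h : Near u a b) :
    Near (fun α => r * u α) (r * a) (r * b) := ((near_const r).mul h).of_eq rfl (by ring)

lemma Near.pow {u : ℝ → ℝ} {b : ℝ} (h : Near u 1 b) (n : ℕ) :
    Near (fun α => u α ^ n) 1 (n * b) := by
  induction n with
  | zero => simpa using near_const 1
  | succ n ih =>
    simp only [pow_succ]
    exact (ih.mul h).of_eq (by ring) (by push_cast; ring)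

lemma Near.sum {ι : Type*} (s : Finset ι) {u : ι → ℝ → ℝ} {a b : ι → ℝ}
    (h : ∀ i ∈ s, Near (u i) (a i) (b i)) :
    Near (fun α => ∑ i ∈ s, u i α) (∑ i ∈ s, a i) (∑ i ∈ s, b i) := by
  classical
  induction s using Finset.induction_on with
  | empty => simpa using near_const 0
  | insert i s hi ih =>
    simp only [Finset.sum_insert hi]
    exact (h i (by simp)).add (ih fun j hj => h j (by simp [hj]))

open PowerSeries in
/-- The power series of `(α - z) / (1 - α z)`. -/
noncomputable def psi (α : ℝ) : ℝ⟦X⟧ :=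
  PowerSeries.mk fun i => if i = 0 then α else -(1 - α ^ 2) * α ^ (i - 1)

open PowerSeries in
/-- Coefficientwise `Near`. -/
def NearSeries (u : ℝ → ℝ⟦X⟧) (a b : ℝ⟦X⟧) : Prop :=
  ∀ k, Near (fun α => coeff k (u α)) (coeff k a) (coeff k b)

open PowerSeries in
lemma NearSeries.mul {u v : ℝ → ℝ⟦X⟧} {a b a' b' : ℝ⟦X⟧} (h : NearSeries u a b)
    (h' : NearSeries v a' b') : NearSeries (fun α => u α * v α) (a * a') (a * b' + b * a') := by
  intro k
  simp only [map_add, coeff_mul]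
  rw [← Finset.sum_add_distrib]
  exact Near.sum _ fun i _ => (h i.1).mul (h' i.2)

open PowerSeries in
/-- `1 + 2 X + 2 X ^ 2 + ⋯` -/
noncomputable def poisson : ℝ⟦X⟧ := PowerSeries.mk fun i => if i = 0 then 1 else 2

open PowerSeries in
lemma nearSeries_psi : NearSeries psi 1 poisson := by
  intro k
  simp only [psi, poisson, coeff_mk, coeff_one]
  by_cases hk : k = 0
  · simpa [hk] using near_id
  · simp only [hk, if_false]
    have h := (((near_const 1).add ((near_id.pow 2).const_mul (-1))).const_mul (-1)).mul
      (near_id.pow (k - 1))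
    refine Near.of_eq ?_ (by norm_num : -1 * (1 + -1 * 1) * 1 = (0 : ℝ)) 
      (by norm_num : -1 * (1 + -1 * 1) * (((k - 1 : ℕ) : ℝ) * 1) + -1 * (0 + -1 * (((2 : ℕ) : ℝ) * 1)) * 1 = 2)
    convert! h using 2
    ring

open PowerSeries in
lemma nearSeries_psi_pow (j : ℕ) : NearSeries (fun α => psi α ^ j) 1 ((j : ℝ⟦X⟧) * poisson) := by
  induction j with
  | zero => intro k; simpa using near_const (coeff k (1 : ℝ⟦X⟧))
  | succ j ih =>
    simp only [pow_succ]
    have := ih.mul nearSeries_psi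
    rwa [one_mul, one_mul, mul_one, show poisson + (j : ℝ⟦X⟧) * poisson
      = ((j + 1 : ℕ) : ℝ⟦X⟧) * poisson by push_cast; ring] at this

open PowerSeries in
/-- The coefficient of `z ^ k` in `(z (α - z) / (1 - α z)) ^ j`. -/
noncomputable def betaCoeff (α : ℝ) (j k : ℕ) : ℝ := coeff k ((X * psi α) ^ j)

open PowerSeries in
lemma near_betaCoeff (j k : ℕ) (hjk : j ≤ k) :
    Near (fun α => betaCoeff α j k) (if j = k then 1 else 0) (j * if j = k then 1 else 2) := by
  have h := nearSeries_psi_pow j (k - j)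
  simp only [betaCoeff, mul_pow, coeff_X_pow_mul', hjk, if_true]
  refine h.of_eq ?_ ?_
  · rw [coeff_one]; congr 1; simp only [eq_iff_iff]; omega
  · rw [show (j : ℝ⟦X⟧) = C (j : ℝ) by simp, coeff_C_mul, poisson, coeff_mk]
    congr 2; simp only [eq_iff_iff]; omega

/-- The coefficient of `z ^ k` in `log ((1 - z / α) / (1 - α z))`. -/
noncomputable def ell (α : ℝ) (k : ℕ) : ℝ := (α ^ k - (α⁻¹) ^ k) / k

lemma near_ell (k : ℕ) (hk : 1 ≤ k) : Near (fun α => ell α k) 0 2 := by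
  have h := ((near_id.pow k).add ((near_inv.pow k).const_mul (-1))).const_mul (1 / (k : ℝ))
  have hk' : (k : ℝ) ≠ 0 := by positivity
  refine Near.of_eq ?_ (by ring : 1 / (k : ℝ) * (1 + -1 * 1) = 0)
    (by field_simp; ring : 1 / (k : ℝ) * (k * 1 + -1 * (k * -1)) = 2)
  convert! h using 2
  unfold ell; ring

/-- The effect on logarithmic coefficients of composing with `z (α - z) / (1 - α z)`. -/
noncomputable def trans (α : ℝ) (c : ℕ → ℂ) (k : ℕ) : ℂ :=
  ell α k + ∑ j ∈ Finset.Icc 1 k, c j * betaCoeff α j k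

/-- Partial sums of `j c_j`. -/
noncomputable def psum (c : ℕ → ℂ) (k : ℕ) : ℂ := ∑ j ∈ Finset.range k, (j + 1 : ℂ) * c (j + 1)

lemma psum_succ (c : ℕ → ℂ) (k : ℕ) : psum c (k + 1) = psum c k + (k + 1 : ℂ) * c (k + 1) :=
  Finset.sum_range_succ _ _

lemma trans_near (N : ℕ) : ∃ K, 0 ≤ K ∧ ∀ (c : ℕ → ℂ) (M α : ℝ), 1 / 2 ≤ α → α ≤ 1 →
    (∀ k ∈ Finset.Icc 1 N, 1 + ‖c k‖ ≤ M) → ∀ k, k + 1 ≤ N →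
    ‖trans α c (k + 1) - (c (k + 1) - (1 - α : ℝ) * (2 + psum c (k + 1) + psum c k))‖
      ≤ K * M * (1 - α) ^ 2 := by
  have hb : ∀ j k : ℕ, ∃ K, 0 ≤ K ∧ (j ≤ k → ∀ α, 1 / 2 ≤ α → α ≤ 1 →
      |betaCoeff α j k - ((if j = k then 1 else 0) - (1 - α) * (j * if j = k then 1 else 2))|
        ≤ K * (1 - α) ^ 2) := fun j k => by
    by_cases h : j ≤ k
    · obtain ⟨K, hK, h⟩ := near_betaCoeff j k h
      exact ⟨K, hK, fun _ => h⟩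
    · exact ⟨0, le_rfl, fun h' => absurd h' h⟩
  have hl : ∀ k : ℕ, ∃ K, 0 ≤ K ∧ (∀ α, 1 / 2 ≤ α → α ≤ 1 →
      |ell α (k + 1) - (0 - (1 - α) * 2)| ≤ K * (1 - α) ^ 2) := fun k => near_ell _ (by omega)
  choose Kb hKb hb using hb
  choose Kl hKl hl using hl
  refine ⟨∑ k ∈ Finset.range N, (Kl k + ∑ j ∈ Finset.Icc 1 (k + 1), Kb j (k + 1)), 
    Finset.sum_nonneg fun k _ => add_nonneg (hKl k) (Finset.sum_nonneg fun j _ => hKb _ _), ?_⟩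
  intro c M α h1 h2 hc k hk
  have hM : 1 ≤ M := (le_add_of_nonneg_right (norm_nonneg (c 1))).trans (hc 1 (by simp; omega))
  have hps : (2 + psum c (k + 1) + psum c k : ℂ) =
      2 + ∑ j ∈ Finset.Icc 1 (k + 1), c j * ((j : ℝ) * (if j = k + 1 then (1:ℝ) else 2) : ℝ) := by
    have : ∀ g : ℕ → ℂ, ∑ j ∈ Finset.Icc 1 (k + 1), g j = ∑ j ∈ Finset.range (k + 1), g (j + 1) :=
      fun g => by
        rw [Finset.range_eq_Ico, Finset.sum_Ico_add' g 0 (k + 1) 1]; rfl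
    rw [this, psum_succ, Finset.sum_range_succ]
    have h3 : ∑ j ∈ Finset.range k, c (j + 1) * (((j + 1 : ℕ) : ℝ) *
        (if j + 1 = k + 1 then (1:ℝ) else 2) : ℝ) = 2 * psum c k := by
      unfold psum
      rw [Finset.mul_sum]
      refine Finset.sum_congr rfl fun j hj => ?_
      rw [if_neg (by have := Finset.mem_range.1 hj; omega)]
      push_cast; ring
    rw [h3]
    simp
    ring
  have hck : c (k + 1) = ∑ j ∈ Finset.Icc 1 (k + 1), c j * ((if j = k + 1 then (1:ℝ) else 0 : ℝ) : ℂ) := by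
    rw [Finset.sum_eq_single (k + 1)]
    · simp
    · intro j _ hj; simp [hj]
    · intro h; simp at h
  have main : trans α c (k + 1) - (c (k + 1) - (1 - α : ℝ) * (2 + psum c (k + 1) + psum c k)) =
      ((ell α (k + 1) - (0 - (1 - α) * 2) : ℝ) : ℂ) + ∑ j ∈ Finset.Icc 1 (k + 1), c j *
        ((betaCoeff α j (k + 1) - ((if j = k + 1 then 1 else 0)
          - (1 - α) * (j * if j = k + 1 then 1 else 2)) : ℝ) : ℂ) := by
    rw [hps]
    conv_lhs => rw [hck]
    have : ∀ j, c j * ((betaCoeff α j (k + 1) - ((if j = k + 1 then 1 else 0)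
          - (1 - α) * (j * if j = k + 1 then 1 else 2)) : ℝ) : ℂ) = c j * betaCoeff α j (k + 1)
          - c j * ((if j = k + 1 then (1:ℝ) else 0 : ℝ) : ℂ)
          + (1 - α : ℝ) * (c j * ((j : ℝ) * (if j = k + 1 then (1:ℝ) else 2) : ℝ)) := fun j => by
      push_cast; ring
    simp only [this, Finset.sum_add_distrib, Finset.sum_sub_distrib, ← Finset.mul_sum]
    unfold trans
    push_cast
    ring
  rw [main]
  have hM0 : 0 ≤ M := by linarith
  calc _ ≤ |ell α (k + 1) - (0 - (1 - α) * 2)| + ∑ j ∈ Finset.Icc 1 (k + 1), ‖c j‖ *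
        |betaCoeff α j (k + 1) - ((if j = k + 1 then 1 else 0)
          - (1 - α) * (j * if j = k + 1 then 1 else 2))| := by
        refine (norm_add_le _ _).trans (add_le_add (by rw [Complex.norm_real, Real.norm_eq_abs])
          ((norm_sum_le _ _).trans (Finset.sum_le_sum fun j _ => ?_)))
        rw [norm_mul, Complex.norm_real, Real.norm_eq_abs]
    _ ≤ Kl k * (1 - α) ^ 2 * M + ∑ j ∈ Finset.Icc 1 (k + 1), M * (Kb j (k + 1) * (1 - α) ^ 2) := by
        refine add_le_add ?_ (Finset.sum_le_sum fun j hj => ?_)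
        · exact (hl k α h1 h2).trans (le_mul_of_one_le_right
            (mul_nonneg (hKl k) (sq_nonneg _)) hM)
        · have hj' := Finset.mem_Icc.1 hj
          have := hc j (Finset.mem_Icc.2 ⟨hj'.1, hj'.2.trans hk⟩)
          exact mul_le_mul (by linarith) (hb j (k + 1) hj'.2 α h1 h2) (abs_nonneg _) hM0
    _ = (Kl k + ∑ j ∈ Finset.Icc 1 (k + 1), Kb j (k + 1)) * M * (1 - α) ^ 2 := by
        rw [← Finset.mul_sum, ← Finset.sum_mul]; ring
    _ ≤ _ := by
        gcongr
        exact Finset.single_le_sum (f := fun k => Kl k + ∑ j ∈ Finset.Icc 1 (k + 1), Kb j (k + 1))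
          (fun k _ => add_nonneg (hKl k) (Finset.sum_nonneg fun j _ => hKb _ _))
          (Finset.mem_range.2 hk)

/-- de Branges' weighted Milin functional. -/
noncomputable def milin (N : ℕ) (s : ℝ) (c : ℕ → ℂ) : ℝ :=
  ∑ k ∈ Finset.range N, ((k + 1) * ‖c (k + 1)‖ ^ 2 - 4 / (k + 1)) * weight N (k + 1) s

lemma sum_weight_mul_sub (N : ℕ) (s : ℝ) (g : ℕ → ℝ) (hg : g 0 = 0) :
    ∑ k ∈ Finset.range N, weight N (k + 1) s * (g (k + 1) - g k) =
      ∑ k ∈ Finset.range N, lam N (k + 1) s * (g (k + 1) + g k) := by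
  have h : ∀ n, ∑ k ∈ Finset.range n, (weight N (k + 1) s * (g (k + 1) - g k)
      - lam N (k + 1) s * (g (k + 1) + g k))
      = (weight N (n + 1) s + lam N (n + 1) s) * g n := by
    intro n
    induction n with
    | zero => simp [hg]
    | succ n ih =>
      rw [Finset.sum_range_succ, ih]
      linear_combination g (n + 1) * weight_sub_weight_succ N (n + 1) (by omega) s
  have := h N
  rw [weight_eq_zero N (N + 1) (by omega), lam_eq_zero N (N + 1) (by omega),
    Finset.sum_sub_distrib] at this
  linarith

open ComplexConjugate in
lemma sum_weight_re_eq (N : ℕ) (s : ℝ) (c : ℕ → ℂ) :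
    ∑ k ∈ Finset.range N, (2 * (k + 1) * (conj (c (k + 1)) * (2 + psum c (k + 1) + psum c k)).re
        * weight N (k + 1) s
      - ((k + 1) * ‖c (k + 1)‖ ^ 2 - 4 / (k + 1)) * ((k + 1) * lam N (k + 1) s)) =
    ∑ k ∈ Finset.range N, lam N (k + 1) s * ‖2 + psum c (k + 1) + psum c k‖ ^ 2 := by
  have h := sum_weight_mul_sub N s (fun k => 2 * ‖psum c k‖ ^ 2 + 4 * (psum c k).re)
    (by simp [psum])
  have e1 : ∀ k, 2 * (k + 1) * (conj (c (k + 1)) * (2 + psum c (k + 1) + psum c k)).re =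
      (2 * ‖psum c (k + 1)‖ ^ 2 + 4 * (psum c (k + 1)).re)
        - (2 * ‖psum c k‖ ^ 2 + 4 * (psum c k).re) := fun k => by
    rw [psum_succ]
    simp only [← Complex.normSq_eq_norm_sq, Complex.normSq_apply, Complex.mul_re, Complex.add_re,
      Complex.add_im, Complex.mul_im, Complex.conj_re, Complex.conj_im, Complex.natCast_re,
      Complex.natCast_im, Complex.one_re, Complex.one_im, Complex.re_ofNat, Complex.im_ofNat]
    ring
  have e2 : ∀ k, (2 * ‖psum c (k + 1)‖ ^ 2 + 4 * (psum c (k + 1)).re)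
        + (2 * ‖psum c k‖ ^ 2 + 4 * (psum c k).re) =
      ‖2 + psum c (k + 1) + psum c k‖ ^ 2
        + ((k + 1) * ‖c (k + 1)‖ ^ 2 - 4 / (k + 1)) * (k + 1) := fun k => by
    have : ((k : ℝ) + 1) ≠ 0 := by positivity
    rw [sub_mul, div_mul_cancel₀ _ this, psum_succ]
    simp only [← Complex.normSq_eq_norm_sq, Complex.normSq_apply, Complex.mul_re, Complex.add_re,
      Complex.add_im, Complex.mul_im, Complex.natCast_re,
      Complex.natCast_im, Complex.one_re, Complex.one_im, Complex.re_ofNat, Complex.im_ofNat]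
    ring
  simp only [e2] at h
  simp only [e1]
  rw [Finset.sum_sub_distrib, Finset.sum_congr rfl fun k _ => mul_comm _ (weight N (k + 1) s), h,
    ← Finset.sum_sub_distrib]
  exact Finset.sum_congr rfl fun k _ => by ring

lemma weight_sub_near (N k : ℕ) (hk : 1 ≤ k) : ∃ K, 0 ≤ K ∧ ∀ α s : ℝ, 1 / 2 ≤ α → α ≤ 1 → 0 ≤ s →
    s ≤ 1 → |weight N k s - weight N k (α * s) - (1 - α) * (k * lam N k s)| ≤ K * (1 - α) ^ 2 := by
  have hp : ∀ m : ℕ, Near (fun α => α ^ m) 1 m := fun m => (near_id.pow m).of_eq rfl (mul_one _)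
  choose K hK hp using hp
  refine ⟨∑ m ∈ Finset.range (N + 1), |(k / m : ℝ) * lamCoeff N k m| * K m,
    Finset.sum_nonneg fun m _ => mul_nonneg (abs_nonneg _) (hK m), ?_⟩
  intro α s h1 h2 h3 h4
  have e : weight N k s - weight N k (α * s) - (1 - α) * (k * lam N k s) =
      ∑ m ∈ Finset.range (N + 1), ((k / m : ℝ) * lamCoeff N k m) * s ^ m *
        -(α ^ m - (1 - (1 - α) * m)) := by
    unfold weight lam
    rw [Finset.mul_sum, Finset.mul_sum, ← Finset.sum_sub_distrib, ← Finset.sum_sub_distrib]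
    refine Finset.sum_congr rfl fun m _ => ?_
    rcases Nat.eq_zero_or_pos m with rfl | hm
    · simp [lamCoeff_zero_right N k hk]
    · rw [mul_pow]; field_simp; ring
  rw [e, Finset.sum_mul]
  refine (Finset.abs_sum_le_sum_abs _ _).trans (Finset.sum_le_sum fun m _ => ?_)
  rw [abs_mul, abs_mul _ (s ^ m), abs_neg, abs_of_nonneg (pow_nonneg h3 m), mul_assoc _ (K m)]
  exact mul_le_mul (mul_le_of_le_one_right (abs_nonneg _) (pow_le_one₀ h3 h4)) (hp m α h1 h2)
    (abs_nonneg _) (abs_nonneg _)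

lemma weight_le (N k : ℕ) (s : ℝ) (h0 : 0 ≤ s) (h1 : s ≤ 1) :
    weight N k s ≤ ∑ m ∈ Finset.range (N + 1), |(k / m : ℝ) * lamCoeff N k m| :=
  Finset.sum_le_sum fun m _ =>
    (mul_le_mul_of_nonneg_right (le_abs_self _) (pow_nonneg h0 m)).trans
      (mul_le_of_le_one_right (abs_nonneg _) (pow_le_one₀ h0 h1))

open ComplexConjugate in
lemma norm_sq_step (c q e : ℂ) (x M Q E : ℝ) (hx0 : 0 ≤ x) (hx1 : x ≤ 1) (hc : ‖c‖ ≤ M)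
    (hq : ‖q‖ ≤ Q) (he : ‖e‖ ≤ E * x ^ 2) :
    ‖c - x * q + e‖ ^ 2 ≤ ‖c‖ ^ 2 - 2 * x * (conj c * q).re
      + (Q ^ 2 + 2 * (M + Q) * E + E ^ 2) * x ^ 2 := by
  have hx2 : x ^ 2 ≤ 1 := pow_le_one₀ hx0 hx1
  have e1 : ‖c - x * q‖ ^ 2 = ‖c‖ ^ 2 - 2 * x * (conj c * q).re + x ^ 2 * ‖q‖ ^ 2 := by
    simp only [← Complex.normSq_eq_norm_sq, Complex.normSq_apply, Complex.mul_re, Complex.sub_re,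
      Complex.sub_im, Complex.mul_im, Complex.conj_re, Complex.conj_im, Complex.ofReal_re,
      Complex.ofReal_im]
    ring
  have hE : 0 ≤ E * x ^ 2 := (norm_nonneg e).trans he
  have hQ : 0 ≤ Q := (norm_nonneg q).trans hq
  have hM : 0 ≤ M := (norm_nonneg c).trans hc
  have h1 : ‖c - x * q + e‖ ≤ ‖c - x * q‖ + E * x ^ 2 := (norm_add_le _ _).trans (by gcongr)
  have h2 : ‖c - x * q‖ ≤ M + Q := (norm_sub_le _ _).trans (by
    rw [norm_mul, Complex.norm_real, Real.norm_of_nonneg hx0]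
    nlinarith [norm_nonneg q])
  have h3 : ‖c - x * q + e‖ ^ 2 ≤ (‖c - x * q‖ + E * x ^ 2) ^ 2 := by gcongr
  have h4 : ‖q‖ ^ 2 ≤ Q ^ 2 := by gcongr
  have h5 : ‖c - x * q‖ * (E * x ^ 2) ≤ (M + Q) * (E * x ^ 2) := by gcongr
  have h6 : (E * x ^ 2) ^ 2 ≤ E ^ 2 * x ^ 2 := by
    nlinarith [mul_nonneg (mul_nonneg (sq_nonneg E) (sq_nonneg x)) (sub_nonneg.2 hx2)]
  have h7 : x ^ 2 * ‖q‖ ^ 2 ≤ x ^ 2 * Q ^ 2 := by gcongr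
  nlinarith

lemma norm_psum_le (N : ℕ) (c : ℕ → ℂ) (M : ℝ) (hc : ∀ k ∈ Finset.Icc 1 N, ‖c k‖ ≤ M) (k : ℕ)
    (hk : k ≤ N) (hM : 0 ≤ M) : ‖psum c k‖ ≤ N * (N * M) := by
  refine (norm_sum_le _ _).trans ?_
  calc _ ≤ ∑ j ∈ Finset.range k, N * M := by
        refine Finset.sum_le_sum fun j hj => ?_
        have hj' := Finset.mem_range.1 hj
        rw [norm_mul]
        refine mul_le_mul ?_ (hc _ (by simp; omega)) (norm_nonneg _) (by positivity)
        rw [show ((j : ℂ) + 1) = ((j + 1 : ℕ) : ℂ) by push_cast; rfl, Complex.norm_natCast]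
        exact_mod_cast (by omega : j + 1 ≤ N)
    _ = k * (N * M) := by simp
    _ ≤ _ := by gcongr

lemma norm_trans_le (N : ℕ) : ∃ K, 0 ≤ K ∧ ∀ (c : ℕ → ℂ) (M α : ℝ), 1 / 2 ≤ α → α ≤ 1 →
    (∀ k ∈ Finset.Icc 1 N, 1 + ‖c k‖ ≤ M) → ∀ k ∈ Finset.Icc 1 N,
      1 + ‖trans α c k‖ ≤ (1 + K * (1 - α)) * M := by
  obtain ⟨K, hK, h⟩ := trans_near N
  refine ⟨2 + 2 * (N * N) + K, by positivity, fun c M α h1 h2 hc k hk => ?_⟩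
  obtain ⟨hk1, hk2⟩ := Finset.mem_Icc.1 hk
  obtain ⟨k, rfl⟩ : ∃ l, k = l + 1 := ⟨k - 1, by omega⟩
  have hM : 1 ≤ M := (le_add_of_nonneg_right (norm_nonneg _)).trans (hc _ hk)
  have hc' : ∀ k ∈ Finset.Icc 1 N, ‖c k‖ ≤ M := fun k hk => by linarith [hc k hk]
  have hx0 : 0 ≤ 1 - α := by linarith
  have hx2 : (1 - α) ^ 2 ≤ 1 - α := by nlinarith
  have hq : ‖2 + psum c (k + 1) + psum c k‖ ≤ 2 * M + 2 * (N * (N * M)) := by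
    have a1 := norm_psum_le N c M hc' (k + 1) hk2 (by linarith)
    have a2 := norm_psum_le N c M hc' k (by omega) (by linarith)
    have a3 := norm_add₃_le (a := (2 : ℂ)) (b := psum c (k + 1)) (c := psum c k)
    have : ‖(2 : ℂ)‖ = 2 := by simp
    linarith
  have h3 := h c M α h1 h2 hc k hk2
  have h4 : ‖trans α c (k + 1)‖ ≤ ‖c (k + 1)‖ + (1 - α) * ‖2 + psum c (k + 1) + psum c k‖
      + K * M * (1 - α) ^ 2 := by
    have := norm_sub_norm_le (trans α c (k + 1))
      (c (k + 1) - (1 - α : ℝ) * (2 + psum c (k + 1) + psum c k))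
    have h5 := norm_sub_le (c (k + 1)) ((1 - α : ℝ) * (2 + psum c (k + 1) + psum c k))
    rw [norm_mul, Complex.norm_real, Real.norm_of_nonneg hx0] at h5
    linarith
  have h6 := hc _ hk
  have h7 : (1 - α) * ‖2 + psum c (k + 1) + psum c k‖ ≤
      (1 - α) * (2 * M + 2 * (N * (N * M))) := by gcongr
  have h8 : K * M * (1 - α) ^ 2 ≤ K * M * (1 - α) := by gcongr
  linarith

lemma milin_trans_le (N : ℕ) (M : ℝ) : ∃ K, 0 ≤ K ∧ ∀ (c : ℕ → ℂ) (α s : ℝ), 1 / 2 ≤ α → α ≤ 1 →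
    0 ≤ s → s ≤ 1 → (∀ k ∈ Finset.Icc 1 N, 1 + ‖c k‖ ≤ M) →
      milin N s (trans α c) ≤ milin N (α * s) c + K * (1 - α) ^ 2 := by
  by_cases hM : 0 ≤ M
  swap
  · refine ⟨0, le_rfl, fun c α s h1 h2 h3 h4 hc => ?_⟩
    rcases Nat.eq_zero_or_pos N with rfl | hN
    · simp [milin]
    · have := hc 1 (by simp; omega)
      linarith [norm_nonneg (c 1)]
  obtain ⟨E, hE, hstep⟩ := trans_near N
  choose Kw hKw hw using fun k : ℕ => weight_sub_near N (k + 1) (by omega)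
  set Q : ℝ := 2 + 2 * (N * (N * M))
  have hQ : 0 ≤ Q := by positivity
  set D : ℝ := Q ^ 2 + 2 * (M + Q) * (E * M) + (E * M) ^ 2
  have hD : 0 ≤ D := by positivity
  set A : ℝ := N * M ^ 2 + 4
  have hA : 0 ≤ A := by positivity
  refine ⟨∑ k ∈ Finset.range N, ((k + 1) * D * (∑ m ∈ Finset.range (N + 1),
    |(((k + 1 : ℕ) : ℝ) / m : ℝ) * lamCoeff N (k + 1) m|) + A * Kw k),
    Finset.sum_nonneg fun k _ => add_nonneg (by positivity) (mul_nonneg hA (hKw k)), ?_⟩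
  intro c α s h1 h2 h3 h4 hc
  have hc' : ∀ k ∈ Finset.Icc 1 N, ‖c k‖ ≤ M := fun k hk => by linarith [hc k hk]
  have hx0 : 0 ≤ 1 - α := by linarith
  have hx1 : 1 - α ≤ 1 := by linarith
  have hsq := sum_weight_re_eq N s c
  have hnn : 0 ≤ ∑ k ∈ Finset.range N, lam N (k + 1) s * ‖2 + psum c (k + 1) + psum c k‖ ^ 2 :=
    Finset.sum_nonneg fun k _ => mul_nonneg (lam_nonneg N _ s h3 h4) (sq_nonneg _)
  rw [← hsq] at hnn
  have hnn2 := mul_nonneg hx0 hnn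
  rw [Finset.mul_sum] at hnn2
  refine le_trans (le_add_of_nonneg_right hnn2) ?_
  unfold milin
  rw [Finset.sum_mul, ← Finset.sum_add_distrib, ← Finset.sum_add_distrib]
  refine Finset.sum_le_sum fun k hk => ?_
  have hk := Finset.mem_range.1 hk
  have hkm : k + 1 ∈ Finset.Icc 1 N := by simp; omega
  set q := 2 + psum c (k + 1) + psum c k with hqdef
  have hq : ‖q‖ ≤ Q := by
    have a1 := norm_psum_le N c M hc' (k + 1) hk hM
    have a2 := norm_psum_le N c M hc' k (by omega) hM
    have a3 := norm_add₃_le (a := (2 : ℂ)) (b := psum c (k + 1)) (c := psum c k)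
    have : ‖(2 : ℂ)‖ = 2 := by simp
    linarith
  have hn := norm_sq_step (c (k + 1)) q _ (1 - α) M Q (E * M) hx0 hx1 (hc' _ hkm) hq
    (hstep c M α h1 h2 hc k hk)
  rw [add_sub_cancel] at hn
  have hW0 := weight_nonneg N (k + 1) (by omega) s h3 h4
  have hW1 := weight_le N (k + 1) s h3 h4
  have hwk := hw k α s h1 h2 h3 h4
  have hk0 : (0 : ℝ) < k + 1 := by positivity
  set B := ∑ m ∈ Finset.range (N + 1), |(((k + 1 : ℕ) : ℝ) / m : ℝ) * lamCoeff N (k + 1) m|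
  set a := (k + 1 : ℝ) * ‖c (k + 1)‖ ^ 2 - 4 / (k + 1) with hadef
  have ha : |a| ≤ A := by
    have i1 : (k + 1 : ℝ) * ‖c (k + 1)‖ ^ 2 ≤ N * M ^ 2 := by
      have : (k + 1 : ℝ) ≤ N := by exact_mod_cast hk
      have := hc' _ hkm
      gcongr
    have i2 : 4 / (k + 1 : ℝ) ≤ 4 := div_le_self (by norm_num) (by linarith [(Nat.cast_nonneg k : (0 : ℝ) ≤ k)])
    have i3 : 0 ≤ 4 / (k + 1 : ℝ) := by positivity
    have i4 : 0 ≤ (k + 1 : ℝ) * ‖c (k + 1)‖ ^ 2 := by positivity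
    rw [abs_le]; constructor <;> simp only [A] <;> nlinarith
  have hdiff : a * (weight N (k + 1) s - weight N (k + 1) (α * s)
      - (1 - α) * (((k + 1 : ℕ) : ℝ) * lam N (k + 1) s)) ≤ A * (Kw k * (1 - α) ^ 2) :=
    (le_abs_self _).trans (by rw [abs_mul]; exact mul_le_mul ha hwk (abs_nonneg _) hA)
  have hfirst : ((k + 1) * ‖trans α c (k + 1)‖ ^ 2 - 4 / (k + 1)) * weight N (k + 1) s ≤
      (a - 2 * (1 - α) * (k + 1) * ((starRingEnd ℂ) (c (k + 1)) * q).re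
        + (k + 1) * D * (1 - α) ^ 2) * weight N (k + 1) s := by
    refine mul_le_mul_of_nonneg_right ?_ hW0
    have := mul_le_mul_of_nonneg_left hn hk0.le
    rw [hadef]
    linarith
  have hlast : (k + 1) * D * (1 - α) ^ 2 * weight N (k + 1) s ≤ (k + 1) * D * (1 - α) ^ 2 * B := by
    gcongr
  push_cast at hdiff
  linarith

/-- Rotation of logarithmic coefficients. -/
noncomputable def rot (κ : ℂ) (c : ℕ → ℂ) (k : ℕ) : ℂ := κ ^ k * c k

lemma norm_rot (κ : ℂ) (hκ : ‖κ‖ = 1) (c : ℕ → ℂ) (k : ℕ) : ‖rot κ c k‖ = ‖c k‖ := by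
  simp [rot, hκ]

lemma milin_rot (N : ℕ) (s : ℝ) (κ : ℂ) (hκ : ‖κ‖ = 1) (c : ℕ → ℂ) :
    milin N s (rot κ c) = milin N s c := by
  simp [milin, norm_rot κ hκ]

/-- Logarithmic coefficients reachable by `n` elementary compositions of parameter `α`. -/
inductive Reach (α : ℝ) : ℕ → (ℕ → ℂ) → Prop
  | zero : Reach α 0 0
  | step {n : ℕ} {c : ℕ → ℂ} {κ : ℂ} (hκ : ‖κ‖ = 1) (h : Reach α n c) :
      Reach α (n + 1) (rot κ (trans α (rot κ⁻¹ c)))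

lemma Reach.norm_le (N : ℕ) : ∃ K, 0 ≤ K ∧ ∀ α : ℝ, 1 / 2 ≤ α → α ≤ 1 → ∀ n c, Reach α n c →
    ∀ k ∈ Finset.Icc 1 N, 1 + ‖c k‖ ≤ (1 + K * (1 - α)) ^ n := by
  obtain ⟨K, hK, h⟩ := norm_trans_le N
  refine ⟨K, hK, fun α h1 h2 n c hr => ?_⟩
  induction hr with
  | zero => simp
  | step hκ _ ih =>
    intro k hk
    rw [norm_rot _ hκ, pow_succ']
    refine h _ _ α h1 h2 (fun k hk => ?_) k hk
    rw [norm_rot _ (by rw [norm_inv, hκ, inv_one])]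
    exact ih k hk

lemma milin_zero_le (N : ℕ) (s : ℝ) (h0 : 0 ≤ s) (h1 : s ≤ 1) : milin N s 0 ≤ 0 := by
  refine Finset.sum_nonpos fun k _ => ?_
  have := weight_nonneg N (k + 1) (by omega) s h0 h1
  have h4 : 0 < 4 / ((k : ℝ) + 1) := by positivity
  simp only [Pi.zero_apply, norm_zero]
  nlinarith

lemma Reach.milin_le (N : ℕ) (m : ℝ) (hm : 0 < m) : ∃ K R : ℝ, ∀ α : ℝ, 1 / 2 ≤ α → α ≤ 1 →
    ∀ n c, Reach α n c → m ≤ α ^ n →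
      (∀ k ∈ Finset.Icc 1 N, ‖c k‖ ≤ R) ∧ milin N 1 c ≤ K * (1 - α) := by
  obtain ⟨K₀, hK₀, hnorm⟩ := Reach.norm_le N
  set T := Real.log (1 / m)
  set M := Real.exp (K₀ * T)
  obtain ⟨K, hK, hV⟩ := milin_trans_le N M
  have hnx : ∀ (α : ℝ) (n : ℕ), 0 < α → m ≤ α ^ n → n * (1 - α) ≤ T := fun α n h1 h => by
    have i1 := Real.log_le_log hm h
    rw [Real.log_pow] at i1
    have i2 := Real.log_le_sub_one_of_pos h1
    have i3 : T = - Real.log m := by simp [T]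
    have i4 : (n : ℝ) * Real.log α ≤ n * (α - 1) := by gcongr
    rw [i3]; linarith
  have hbd : ∀ α : ℝ, 1 / 2 ≤ α → α ≤ 1 → ∀ n c, Reach α n c → m ≤ α ^ n →
      ∀ k ∈ Finset.Icc 1 N, 1 + ‖c k‖ ≤ M := fun α h1 h2 n c hr h k hk => by
    refine (hnorm α h1 h2 n c hr k hk).trans ?_
    calc (1 + K₀ * (1 - α)) ^ n ≤ (Real.exp (K₀ * (1 - α))) ^ n := by
          have : 0 ≤ K₀ * (1 - α) := mul_nonneg hK₀ (by linarith)
          gcongr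
          rw [add_comm]; exact Real.add_one_le_exp _
      _ = Real.exp (K₀ * (n * (1 - α))) := by rw [← Real.exp_nat_mul]; ring_nf
      _ ≤ _ := Real.exp_le_exp.2 (mul_le_mul_of_nonneg_left (hnx α n (by linarith) h) hK₀)
  refine ⟨K * T, M, fun α h1 h2 n c hr hα => ⟨fun k hk => by
    linarith [hbd α h1 h2 n c hr hα k hk], ?_⟩⟩
  have key : ∀ n c, Reach α n c → m ≤ α ^ n → ∀ s, 0 ≤ s → s ≤ 1 →
      milin N s c ≤ n * (K * (1 - α) ^ 2) := by
    intro n c hr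
    induction hr with
    | zero => intro _ s h0 h1; simpa using milin_zero_le N s h0 h1
    | @step n c κ hκ hr ih =>
      intro hα s hs0 hs1
      have hα' : m ≤ α ^ n := hα.trans (pow_le_pow_of_le_one (by linarith) h2 (by omega))
      have hκ' : ‖κ⁻¹‖ = 1 := by rw [norm_inv, hκ, inv_one]
      rw [milin_rot _ _ _ hκ]
      have := hV (rot κ⁻¹ c) α s h1 h2 hs0 hs1 fun k hk => by
        rw [norm_rot _ hκ']
        exact hbd α h1 h2 n c hr hα' k hk
      rw [milin_rot _ _ _ hκ'] at this
      have i := ih hα' (α * s) (mul_nonneg (by linarith) hs0) (mul_le_one₀ h2 hs0 hs1)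
      push_cast
      linarith
  refine (key n c hr hα 1 zero_le_one le_rfl).trans ?_
  have := mul_le_mul_of_nonneg_left (hnx α n (by linarith) hα) (mul_nonneg hK (by linarith : 0 ≤ 1 - α))
  nlinarith

open Filter Topology Asymptotics

open PowerSeries in
/-- `f` agrees with the power series `P` up to order `N`. -/
def Approx (N : ℕ) (f : ℂ → ℂ) (P : ℂ⟦X⟧) : Prop :=
  (fun z => f z - (trunc (N + 1) P).eval z) =O[𝓝 0] fun z => z ^ (N + 1)

lemma isBigO_of_dvd (n : ℕ) (p : Polynomial ℂ) (h : Polynomial.X ^ n ∣ p) :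
    (fun z => p.eval z) =O[𝓝 0] fun z : ℂ => z ^ n := by
  obtain ⟨q, rfl⟩ := h
  simp only [Polynomial.eval_mul, Polynomial.eval_pow, Polynomial.eval_X]
  have : (fun z => q.eval z) =O[𝓝 0] fun _ : ℂ => (1 : ℂ) :=
    (q.continuous.tendsto 0).isBigO_one ℂ
  simpa using (isBigO_refl (fun z : ℂ => z ^ n) _).mul this

open PowerSeries in
lemma Approx.mul {N : ℕ} {f g : ℂ → ℂ} {P Q : ℂ⟦X⟧} (hf : Approx N f P) (hg : Approx N g Q)
    (hg0 : ContinuousAt g 0) : Approx N (fun z => f z * g z) (P * Q) := by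
  have h1 : (fun z => (f z - (trunc (N + 1) P).eval z) * g z) =O[𝓝 0]
      fun z => z ^ (N + 1) := by
    simpa using IsBigO.mul hf (hg0.tendsto.isBigO_one ℂ)
  have h2 : (fun z => (trunc (N + 1) P).eval z * (g z - (trunc (N + 1) Q).eval z)) =O[𝓝 0]
      fun z => z ^ (N + 1) := by
    simpa using (((trunc (N + 1) P).continuous.tendsto 0).isBigO_one ℂ).mul (show IsBigO _ _ _ from hg)
  have h3 := isBigO_of_dvd (N + 1)
    (trunc (N + 1) P * trunc (N + 1) Q - trunc (N + 1) (P * Q)) (by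
      rw [Polynomial.X_pow_dvd_iff]
      intro d hd
      rw [Polynomial.coeff_sub, coeff_trunc, if_pos hd, coeff_mul_eq_coeff_trunc_mul_trunc _ _ hd,
        ← Polynomial.coe_mul, Polynomial.coeff_coe, sub_self])
  refine ((h1.add h2).add h3).congr_left fun z => ?_
  simp only [Polynomial.eval_sub, Polynomial.eval_mul]
  ring

open PowerSeries in
lemma Approx.pow {N : ℕ} {f : ℂ → ℂ} {P : ℂ⟦X⟧} (hf : Approx N f P) (hf0 : ContinuousAt f 0)
    (j : ℕ) : Approx N (fun z => f z ^ j) (P ^ j) := by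
  induction j with
  | zero =>
    simp only [pow_zero]
    refine (isBigO_zero _ _).congr_left fun z => ?_
    simp
  | succ j ih =>
    simp only [pow_succ]
    exact ih.mul hf hf0

/-- The Blaschke factor `(α - z) / (1 - α z)`. -/
noncomputable def mob (α : ℝ) (z : ℂ) : ℂ := (α - z) / (1 - α * z)

lemma analyticAt_mob (α : ℝ) : AnalyticAt ℂ (mob α) 0 := by
  unfold mob
  exact AnalyticAt.div (by fun_prop) (by fun_prop) (by simp)

open PowerSeries in
lemma approx_mob (N : ℕ) (α : ℝ) :
    Approx N (fun z => z * mob α z) (map Complex.ofRealHom (X * psi α)) := by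
  have h1 : Approx N (mob α) (map Complex.ofRealHom (psi α)) := by
    have key : ∀ᶠ z in 𝓝 (0 : ℂ), mob α z -
        (trunc (N + 1) (map Complex.ofRealHom (psi α))).eval z =
        z ^ (N + 1) * (-(1 - α ^ 2) * α ^ N / (1 - α * z)) := by
      have : ∀ᶠ z in 𝓝 (0 : ℂ), 1 - (α : ℂ) * z ≠ 0 := by
        refine ContinuousAt.eventually_ne (by fun_prop) (by simp)
      filter_upwards [this] with z hz
      rw [Polynomial.eval, eval₂_trunc_eq_sum_range, Finset.sum_range_succ']
      simp only [psi, coeff_map, coeff_mk, RingHom.id_apply, if_true, if_false,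
        Nat.succ_ne_zero, Nat.add_sub_cancel, Complex.ofRealHom_eq_coe, pow_zero, mul_one]
      have hs : ∑ i ∈ Finset.range N, ((-(1 - α ^ 2) * α ^ i : ℝ) : ℂ) * z ^ (i + 1) =
          -(1 - α ^ 2) * z * ((1 - (α * z) ^ N) / (1 - α * z)) := by
        rw [← mul_neg_geom_sum ((α : ℂ) * z) N, mul_div_cancel_left₀ _ hz, Finset.mul_sum]
        refine Finset.sum_congr rfl fun i _ => ?_
        push_cast; rw [mul_pow]; ring
      rw [hs]
      unfold mob
      rw [mul_pow]
      field_simp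
      ring
    refine IsBigO.congr' ?_ (key.mono fun z hz => hz.symm) EventuallyEq.rfl
    have hc : ContinuousAt (fun z : ℂ => -(1 - (α : ℂ) ^ 2) * α ^ N / (1 - α * z)) 0 :=
      ContinuousAt.div (by fun_prop) (by fun_prop) (by simp)
    simpa using (isBigO_refl (fun z : ℂ => z ^ (N + 1)) (𝓝 0)).mul (hc.tendsto.isBigO_one ℂ)
  have h2 : Approx N (fun z => z) X := by
    have : (fun z : ℂ => z - (trunc (N + 1) (X : ℂ⟦X⟧)).eval z) = fun z =>
      (Polynomial.X - trunc (N + 1) (X : ℂ⟦X⟧)).eval z := by ext; simp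
    unfold Approx
    rw [this]
    refine isBigO_of_dvd _ _ ?_
    rw [Polynomial.X_pow_dvd_iff]
    intro d hd
    rw [Polynomial.coeff_sub, coeff_trunc, if_pos hd, ← Polynomial.coe_X, Polynomial.coeff_coe,
      sub_self]
  rw [map_mul, map_X]
  exact h2.mul h1 (analyticAt_mob α).continuousAt

lemma approx_mob_pow (N : ℕ) (α : ℝ) (j : ℕ) (hj : 1 ≤ j) :
    (fun z => (z * mob α z) ^ j - ∑ k ∈ Finset.Icc 1 N, (betaCoeff α j k : ℂ) * z ^ k) =O[𝓝 0]
      fun z => z ^ (N + 1) := by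
  have h := (approx_mob N α).pow (continuousAt_id.mul (analyticAt_mob α).continuousAt) j
  refine h.congr_left fun z => ?_
  congr 1
  rw [Polynomial.eval, PowerSeries.eval₂_trunc_eq_sum_range, Finset.sum_range_succ',
    Finset.range_eq_Ico, Finset.sum_Ico_add' (fun i => RingHom.id ℂ (PowerSeries.coeff i
      (PowerSeries.map Complex.ofRealHom (PowerSeries.X * psi α) ^ j)) * z ^ i) 0 N 1,
    ← map_pow, PowerSeries.coeff_map, mul_pow]
  simp only [PowerSeries.coeff_map, betaCoeff, mul_pow]
  rw [PowerSeries.coeff_X_pow_mul', if_neg (by omega)]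
  simp
  rfl

lemma betaCoeff_eq_zero (α : ℝ) (j k : ℕ) (h : k < j) : betaCoeff α j k = 0 := by
  unfold betaCoeff
  rw [mul_pow, PowerSeries.coeff_X_pow_mul', if_neg (by omega)]

lemma log_one_sub_isBigO (N : ℕ) (a : ℂ) :
    (fun z => Complex.log (1 - a * z) + ∑ k ∈ Finset.Icc 1 N, a ^ k / k * z ^ k) =O[𝓝 0]
      fun z => z ^ (N + 1) := by
  have hsm : ∀ᶠ z in 𝓝 (0 : ℂ), ‖-(a * z)‖ < 1 / 2 := by
    refine ContinuousAt.eventually_lt (f := fun z => ‖-(a * z)‖) (g := fun _ => (1 / 2 : ℝ))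
      (by fun_prop) (by fun_prop) (by simp)
  refine IsBigO.of_bound (‖a‖ ^ (N + 1) * 2) ?_
  filter_upwards [hsm] with z hz
  have h := Complex.norm_log_sub_logTaylor_le N (hz.trans (by norm_num))
  have e : Complex.logTaylor (N + 1) (-(a * z)) = -∑ k ∈ Finset.Icc 1 N, a ^ k / k * z ^ k := by
    unfold Complex.logTaylor
    rw [Finset.sum_range_succ', Finset.range_eq_Ico, Finset.sum_Ico_add' (fun j : ℕ =>
      (-1) ^ (j + 1) * (-(a * z)) ^ j / (j : ℂ)) 0 N 1, ← Finset.sum_neg_distrib]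
    simp only [Nat.cast_zero, div_zero, add_zero]
    refine Finset.sum_congr rfl fun k _ => ?_
    have : ((-1 : ℂ) ^ k) * (-1) ^ k = 1 := by rw [← mul_pow]; simp
    rw [neg_pow (a * z), mul_pow, pow_succ]
    linear_combination (-(a ^ k * z ^ k / k)) * this
  rw [e, sub_neg_eq_add, ← sub_eq_add_neg] at h
  refine h.trans ?_
  have h1 : (1 - ‖-(a * z)‖)⁻¹ ≤ 2 := by
    rw [inv_le_comm₀ (by linarith) (by norm_num)]; linarith
  have h2 : (1 - ‖-(a * z)‖)⁻¹ / ((N : ℝ) + 1) ≤ 2 :=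
    (div_le_self (inv_nonneg.2 (by linarith)) (by linarith [(Nat.cast_nonneg N : (0:ℝ) ≤ N)])).trans h1
  rw [norm_neg, norm_mul, norm_pow] at *
  rw [mul_pow, mul_div_assoc]
  calc _ ≤ ‖a‖ ^ (N + 1) * ‖z‖ ^ (N + 1) * 2 := by gcongr
    _ = _ := by ring

/-- The germ of `F` at `0` is `u z exp (c₁ z + ⋯ + c_N z ^ N + O(z ^ (N + 1)))` with `u ≠ 0`. -/
def HasLogCoeff (N : ℕ) (F : ℂ → ℂ) (c : ℕ → ℂ) : Prop :=
  ∃ (u : ℂ) (C : ℂ → ℂ), u ≠ 0 ∧ AnalyticAt ℂ C 0 ∧ C 0 = 0 ∧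
    (∀ᶠ z in 𝓝 0, F z = u * z * Complex.exp (C z)) ∧
    (fun z => C z - ∑ k ∈ Finset.Icc 1 N, c k * z ^ k) =O[𝓝 0] fun z => z ^ (N + 1)

lemma hasLogCoeff_id (N : ℕ) : HasLogCoeff N (fun z => z) 0 :=
  ⟨1, fun _ => 0, one_ne_zero, analyticAt_const, rfl, by simp, by
    simpa using isBigO_zero _ _⟩

lemma HasLogCoeff.rot {N : ℕ} {F : ℂ → ℂ} {c : ℕ → ℂ} (h : HasLogCoeff N F c) (κ : ℂ)
    (hκ : κ ≠ 0) : HasLogCoeff N (fun z => F (κ * z)) (rot κ c) := by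
  obtain ⟨u, C, hu, hC, hC0, hF, hO⟩ := h
  have ht : Tendsto (fun z : ℂ => κ * z) (𝓝 0) (𝓝 0) := by
    have : Continuous fun z : ℂ => κ * z := by fun_prop
    simpa using this.tendsto 0
  refine ⟨u * κ, fun z => C (κ * z), mul_ne_zero hu hκ, ?_, by simpa using hC0, ?_, ?_⟩
  · exact AnalyticAt.comp (g := C) (f := fun z => κ * z) (by simpa using hC) (by fun_prop)
  · filter_upwards [ht.eventually hF] with z hz
    rw [hz]; ring
  · have h1 := hO.comp_tendsto ht
    have h2 : (fun z : ℂ => (κ * z) ^ (N + 1)) =O[𝓝 0] fun z => z ^ (N + 1) := by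
      simp only [mul_pow]
      exact isBigO_const_mul_self _ _ _
    refine (h1.trans h2).congr_left fun z => ?_
    simp only [Function.comp_apply, DeBranges.rot]
    congr 1
    refine Finset.sum_congr rfl fun k _ => ?_
    rw [mul_pow]; ring

lemma HasLogCoeff.trans {N : ℕ} {F : ℂ → ℂ} {c : ℕ → ℂ} (h : HasLogCoeff N F c) (α : ℝ)
    (hα : 0 < α) : HasLogCoeff N (fun z => F (z * mob α z)) (trans α c) := by
  obtain ⟨u, C, hu, hC, hC0, hF, hO⟩ := h
  have hα' : (α : ℂ) ≠ 0 := by exact_mod_cast hα.ne'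
  have hB : AnalyticAt ℂ (fun z => z * mob α z) 0 := analyticAt_id.mul (analyticAt_mob α)
  have ht : Tendsto (fun z : ℂ => z * mob α z) (𝓝 0) (𝓝 0) := by
    simpa using hB.continuousAt.tendsto
  refine ⟨u * α, fun z => Complex.log (1 - (α : ℂ)⁻¹ * z) - Complex.log (1 - α * z)
    + C (z * mob α z), mul_ne_zero hu hα', ?_, by simpa using hC0, ?_, ?_⟩
  · refine AnalyticAt.add (AnalyticAt.sub ?_ ?_) ?_
    · exact AnalyticAt.clog (by fun_prop) (by simp)
    · exact AnalyticAt.clog (by fun_prop) (by simp)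
    · exact AnalyticAt.comp (g := C) (f := fun z => z * mob α z) (by simpa using hC) hB
  · have h1 : ∀ᶠ z in 𝓝 (0 : ℂ), 1 - (α : ℂ)⁻¹ * z ≠ 0 :=
      ContinuousAt.eventually_ne (by fun_prop) (by simp)
    have h2 : ∀ᶠ z in 𝓝 (0 : ℂ), 1 - (α : ℂ) * z ≠ 0 :=
      ContinuousAt.eventually_ne (by fun_prop) (by simp)
    filter_upwards [ht.eventually hF, h1, h2] with z hz h1 h2
    rw [hz, Complex.exp_add, Complex.exp_sub, Complex.exp_log h1, Complex.exp_log h2]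
    unfold mob
    field_simp
  · have h1 := log_one_sub_isBigO N (α : ℂ)⁻¹
    have h2 := log_one_sub_isBigO N (α : ℂ)
    have h3 := hO.comp_tendsto ht
    have h4 : (fun z : ℂ => (z * mob α z) ^ (N + 1)) =O[𝓝 0] fun z => z ^ (N + 1) := by
      simp only [mul_pow]
      have := ((analyticAt_mob α).continuousAt.pow (N + 1)).tendsto.isBigO_one ℂ
      simpa using (isBigO_refl (fun z : ℂ => z ^ (N + 1)) (𝓝 0)).mul this
    have h5 : (fun z => ∑ j ∈ Finset.Icc 1 N, c j * ((z * mob α z) ^ j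
        - ∑ k ∈ Finset.Icc 1 N, (betaCoeff α j k : ℂ) * z ^ k)) =O[𝓝 0] fun z => z ^ (N + 1) :=
      IsBigO.fun_sum fun j hj => (approx_mob_pow N α j (Finset.mem_Icc.1 hj).1).const_mul_left _
    refine (((h1.sub h2).add (h3.trans h4)).add h5).congr_left fun z => ?_
    have e1 : ∑ k ∈ Finset.Icc 1 N, DeBranges.trans α c k * z ^ k =
        ∑ k ∈ Finset.Icc 1 N, (α : ℂ) ^ k / k * z ^ k
        - ∑ k ∈ Finset.Icc 1 N, (α : ℂ)⁻¹ ^ k / k * z ^ k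
        + ∑ j ∈ Finset.Icc 1 N, c j * ∑ k ∈ Finset.Icc 1 N, (betaCoeff α j k : ℂ) * z ^ k := by
      simp only [Finset.mul_sum]
      rw [Finset.sum_comm, ← Finset.sum_sub_distrib, ← Finset.sum_add_distrib]
      refine Finset.sum_congr rfl fun k hk => ?_
      have hk' := Finset.mem_Icc.1 hk
      have : ∑ j ∈ Finset.Icc 1 k, c j * (betaCoeff α j k : ℂ) =
          ∑ j ∈ Finset.Icc 1 N, c j * (betaCoeff α j k : ℂ) := by
        refine Finset.sum_subset (Finset.Icc_subset_Icc_right hk'.2) fun j hj hj' => ?_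
        rw [betaCoeff_eq_zero α j k, Complex.ofReal_zero, mul_zero]
        simp only [Finset.mem_Icc] at hj hj'
        omega
      unfold DeBranges.trans ell
      rw [this, add_mul, Finset.sum_mul]
      push_cast
      congr 1
      · ring
      · exact Finset.sum_congr rfl fun j _ => by ring
    rw [e1]
    simp only [Function.comp_apply, mul_sub, Finset.sum_sub_distrib]
    ring

/-- The self-map `z ↦ z (α - κ z) / (1 - α κ z)` of the disc. -/
noncomputable def blaschke (α : ℝ) (κ z : ℂ) : ℂ := z * mob α (κ * z)

lemma HasLogCoeff.blaschke {N : ℕ} {F : ℂ → ℂ} {c : ℕ → ℂ} (h : HasLogCoeff N F c) (α : ℝ)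
    (hα : 0 < α) (κ : ℂ) (hκ : κ ≠ 0) :
    HasLogCoeff N (fun z => F (blaschke α κ z)) (DeBranges.rot κ (DeBranges.trans α (DeBranges.rot κ⁻¹ c))) := by
  have := ((h.rot κ⁻¹ (inv_ne_zero hκ)).trans α hα).rot κ hκ
  convert! this using 3 with z
  unfold DeBranges.blaschke
  field_simp

lemma iteratedDeriv_eq_zero_of_isBigO {W : ℂ → ℂ} (hW : AnalyticAt ℂ W 0) (n : ℕ)
    (h : W =O[𝓝 0] fun z => z ^ n) (k : ℕ) (hk : k < n) : iteratedDeriv k W 0 = 0 := by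
  refine (natCast_le_analyticOrderAt_iff_iteratedDeriv_eq_zero hW).1 ?_ k hk
  by_contra hlt
  push Not at hlt
  obtain ⟨m, hm⟩ := ENat.ne_top_iff_exists.1 (ne_top_of_lt hlt)
  obtain ⟨g, hg, hg0, hgW⟩ := (hW.analyticOrderAt_eq_natCast).1 hm.symm
  have hmn : m < n := by rw [← hm] at hlt; exact_mod_cast hlt
  have h1 : (fun z : ℂ => z ^ m * g z) =O[𝓝[≠] 0] fun z => z ^ m * z ^ (n - m) := by
    refine IsBigO.mono (h.congr' ?_ (Eventually.of_forall fun z => ?_)) nhdsWithin_le_nhds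
    · filter_upwards [hgW] with z hz
      rw [hz]; simp
    · change z ^ n = z ^ m * z ^ (n - m)
      rw [← pow_add]; congr 1; omega
  have h2 : g =O[𝓝[≠] 0] fun z => z ^ (n - m) := by
    have h3 := (isBigO_refl (fun z : ℂ => (z ^ m)⁻¹) (𝓝[≠] 0)).mul h1
    refine h3.congr' ?_ ?_ <;>
    · filter_upwards [self_mem_nhdsWithin] with z hz
      have : z ≠ 0 := hz
      field_simp
  have h4 : Tendsto g (𝓝[≠] 0) (𝓝 0) := by
    refine h2.trans_tendsto ?_
    have : ContinuousAt (fun z : ℂ => z ^ (n - m)) 0 := by fun_prop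
    have h5 := this.tendsto
    simp only [zero_pow (by omega : n - m ≠ 0)] at h5
    exact h5.mono_left nhdsWithin_le_nhds
  exact hg0 (tendsto_nhds_unique (hg.continuousAt.tendsto.mono_left nhdsWithin_le_nhds) h4)

lemma exists_log_ball {G : ℂ → ℂ} {R : ℝ} (hR : 0 < R) (hG : DifferentiableOn ℂ G (ball 0 R))
    (h0 : ∀ z ∈ ball (0 : ℂ) R, G z ≠ 0) (y : ℂ) (hy : Complex.exp y = G 0) :
    ∃ L : ℂ → ℂ, DifferentiableOn ℂ L (ball 0 R) ∧ L 0 = y ∧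
      ∀ z ∈ ball (0 : ℂ) R, Complex.exp (L z) = G z := by
  have hd : DifferentiableOn ℂ (fun z => deriv G z / G z) (ball 0 R) :=
    (hG.deriv isOpen_ball).div hG h0
  obtain ⟨L, hL0, hL⟩ := hd.isExactOn_ball.with_val_at 0 y
  have hLd : DifferentiableOn ℂ L (ball 0 R) := fun z hz =>
    (hL z hz).differentiableAt.differentiableWithinAt
  refine ⟨L, hLd, hL0, fun z hz => ?_⟩
  have hderiv : ∀ z ∈ ball (0 : ℂ) R, HasDerivAt (fun z => G z * Complex.exp (-L z)) 0 z := by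
    intro z hz
    have h1 := (hG.differentiableAt (isOpen_ball.mem_nhds hz)).hasDerivAt
    have h2 := h1.mul (hL z hz).neg.cexp
    have h3 := h0 z hz
    convert! h2 using 1
    field_simp
    ring
  have hconst := isOpen_ball.is_const_of_deriv_eq_zero (convex_ball (0 : ℂ) R).isPreconnected
    (fun z hz => (hderiv z hz).differentiableAt.differentiableWithinAt)
    (fun z hz => (hderiv z hz).deriv) hz (mem_ball_self hR)
  have h1 : G 0 * Complex.exp (-L 0) = 1 := by
    rw [hL0, ← hy, ← Complex.exp_add, add_neg_cancel, Complex.exp_zero]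
  rw [h1] at hconst
  calc Complex.exp (L z) = G z * Complex.exp (-L z) * Complex.exp (L z) := by rw [hconst, one_mul]
    _ = G z := by rw [mul_assoc, ← Complex.exp_add, neg_add_cancel, Complex.exp_zero, mul_one]

lemma exists_inverse_of_injOn {g : ℂ → ℂ} (hg : DifferentiableOn ℂ g (ball 0 1))
    (hi : Set.InjOn g (ball 0 1)) : ∃ h : ℂ → ℂ, IsOpen (g '' ball 0 1) ∧
      DifferentiableOn ℂ h (g '' ball 0 1) ∧ ∀ z ∈ ball (0 : ℂ) 1, h (g z) = z := by
  have han : AnalyticOnNhd ℂ g (ball 0 1) := hg.analyticOnNhd isOpen_ball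
  have hopen : ∀ s ⊆ ball (0 : ℂ) 1, IsOpen s → IsOpen (g '' s) := by
    rcases han.is_constant_or_isOpen (convex_ball (0 : ℂ) 1).isPreconnected with ⟨w, hw⟩ | h
    · have h0 : (0 : ℂ) ∈ ball (0 : ℂ) 1 := by simp
      have h1 : (1 / 2 : ℂ) ∈ ball (0 : ℂ) 1 := by simp; norm_num
      have := hi h0 h1 ((hw _ h0).trans (hw _ h1).symm)
      norm_num at this
    · exact h
  set h := Function.invFunOn g (ball 0 1) with hh
  have hleft : ∀ z ∈ ball (0 : ℂ) 1, h (g z) = z := fun z hz => hi.leftInvOn_invFunOn hz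
  have hO := hopen _ subset_rfl isOpen_ball
  have hcont : ∀ z ∈ ball (0 : ℂ) 1, ContinuousAt h (g z) := by
    intro z hz
    rw [ContinuousAt, hleft z hz]
    intro V hV
    have h2 := hopen (interior V ∩ ball 0 1) Set.inter_subset_right
      (isOpen_interior.inter isOpen_ball)
    refine Filter.mem_map.2 ?_
    filter_upwards [h2.mem_nhds (Set.mem_image_of_mem g ⟨mem_interior_iff_mem_nhds.2 hV, hz⟩)]
    rintro _ ⟨y, hy, rfl⟩
    rw [Set.mem_preimage, hleft y hy.2]
    exact interior_subset hy.1
  have hright : ∀ w ∈ g '' ball 0 1, g (h w) = w := by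
    rintro _ ⟨z, hz, rfl⟩
    rw [hleft z hz]
  have hdiff : ∀ z ∈ ball (0 : ℂ) 1, deriv g z ≠ 0 → DifferentiableAt ℂ h (g z) := by
    intro z hz hz'
    have hd := (hg.differentiableAt (isOpen_ball.mem_nhds hz)).hasDerivAt
    rw [← hleft z hz] at hd hz'
    exact (HasDerivAt.of_local_left_inverse (hcont z hz) hd hz' (by
      filter_upwards [hO.mem_nhds (Set.mem_image_of_mem g hz)] with w hw
      exact hright w hw)).differentiableAt
  refine ⟨h, hO, ?_, hleft⟩
  rintro _ ⟨z, hz, rfl⟩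
  refine DifferentiableAt.differentiableWithinAt (AnalyticAt.differentiableAt
    (Complex.analyticAt_of_differentiable_on_punctured_nhds_of_continuousAt ?_ (hcont z hz)))
  rcases (han.deriv z hz).eventually_eq_zero_or_eventually_ne_zero with h0 | h0
  · exfalso
    obtain ⟨ε, hε, hball⟩ := Metric.eventually_nhds_iff_ball.1
      (h0.and (isOpen_ball.mem_nhds hz : ball (0 : ℂ) 1 ∈ 𝓝 z))
    have hy : z + (ε / 2 : ℝ) ∈ ball z ε := by
      rw [mem_ball_iff_norm, add_sub_cancel_left, Complex.norm_real, Real.norm_of_nonneg (by positivity)]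
      linarith
    have := isOpen_ball.is_const_of_deriv_eq_zero (convex_ball z ε).isPreconnected
      (fun y hy => (hg y (hball y hy).2).mono fun x hx => (hball x hx).2)
      (fun y hy => (hball y hy).1) hy (mem_ball_self hε)
    have h3 := hi (hball _ hy).2 hz this
    have h4 : ((ε / 2 : ℝ) : ℂ) = 0 := by linear_combination h3
    have h5 : ε / 2 = 0 := by exact_mod_cast h4
    linarith
  · have ht : Tendsto h (𝓝[≠] (g z)) (𝓝[≠] z) := by
      refine tendsto_nhdsWithin_iff.2 ⟨?_, ?_⟩
      · have := (hcont z hz).tendsto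
        rw [hleft z hz] at this
        exact this.mono_left nhdsWithin_le_nhds
      · have h1 : g '' ball 0 1 ∈ 𝓝[≠] (g z) :=
          mem_nhdsWithin_of_mem_nhds (hO.mem_nhds (Set.mem_image_of_mem g hz))
        filter_upwards [h1, self_mem_nhdsWithin] with w hw hne heq
        have heq : h w = z := heq
        exact hne (by rw [← heq, hright w hw]; rfl)
    have h1 : g '' ball 0 1 ∈ 𝓝[≠] (g z) :=
      mem_nhdsWithin_of_mem_nhds (hO.mem_nhds (Set.mem_image_of_mem g hz))
    filter_upwards [ht.eventually h0, h1] with w hw hw1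
    obtain ⟨y, hy, rfl⟩ := hw1
    rw [hleft y hy] at hw
    exact hdiff y hy hw

/-- Injective holomorphic self-maps of the disc fixing `0` with derivative `m > 0` there. -/
structure Good (g : ℂ → ℂ) (m : ℝ) : Prop where
  diff : DifferentiableOn ℂ g (ball 0 1)
  inj : Set.InjOn g (ball 0 1)
  maps : Set.MapsTo g (ball 0 1) (ball 0 1)
  zero : g 0 = 0
  pos : 0 < m
  deriv : HasDerivAt g m 0

lemma Good.le_of_sphere_subset {g : ℂ → ℂ} {m r : ℝ} (hg : Good g m) (hr : 0 < r)
    (hs : sphere 0 r ⊆ g '' ball 0 1) : r ≤ m := by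
  obtain ⟨h, hO, hd, hl⟩ := exists_inverse_of_injOn hg.diff hg.inj
  have hright : ∀ w ∈ g '' ball 0 1, g (h w) = w := by
    rintro _ ⟨z, hz, rfl⟩
    rw [hl z hz]
  have hball : ball 0 r ⊆ g '' ball 0 1 := by
    intro w hw
    by_contra hw'
    have hne : ∀ z ∈ ball (0 : ℂ) 1, g z - w ≠ 0 := fun z hz h0 =>
      hw' ⟨z, hz, sub_eq_zero.1 h0⟩
    have h0 : (0 : ℂ) ∈ ball (0 : ℂ) 1 := by simp
    obtain ⟨L, hLd, -, hL⟩ := exists_log_ball one_pos (hg.diff.sub_const w) hne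
      (Complex.log (g 0 - w)) (Complex.exp_log (hne 0 h0))
    have hmaps : Set.MapsTo h (g '' ball 0 1) (ball 0 1) := by
      rintro _ ⟨z, hz, rfl⟩
      rwa [hl z hz]
    have hder : ∀ z ∈ sphere (0 : ℂ) r, HasDerivWithinAt (fun z => L (h z)) ((z - w)⁻¹)
        (sphere 0 r) z := by
      intro z hz
      have hzU := hs hz
      have hdL : DifferentiableAt ℂ (fun z => L (h z)) z :=
        (hLd.comp hd hmaps).differentiableAt (hO.mem_nhds hzU)
      have h1 := hdL.hasDerivAt.cexp
      have h2 : HasDerivAt (fun z => Complex.exp (L (h z))) 1 z := by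
        refine ((hasDerivAt_id z).sub_const w).congr_of_eventuallyEq ?_
        filter_upwards [hO.mem_nhds hzU] with y hy
        rw [hL _ (hmaps hy), hright y hy]; rfl
      have h3 := h1.unique h2
      rw [hL _ (hmaps hzU), hright z hzU] at h3
      have h4 : _root_.deriv (fun z => L (h z)) z = (z - w)⁻¹ :=
        (inv_eq_of_mul_eq_one_right h3).symm
      rw [← h4]
      exact hdL.hasDerivAt.hasDerivWithinAt
    have i1 := circleIntegral.integral_eq_zero_of_hasDerivWithinAt hr.le hder
    rw [circleIntegral.integral_sub_inv_of_mem_ball hw] at i1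
    exact Complex.two_pi_I_ne_zero i1
  have h00 : h 0 = 0 := by simpa [hg.zero] using hl 0 (by simp)
  have h1 := Complex.norm_deriv_le_div_of_mapsTo_ball (R₂ := 1) (hd.mono hball) (by
    intro w hw
    obtain ⟨z, hz, rfl⟩ := hball hw
    rw [hl z hz, h00]
    exact ball_subset_closedBall hz) hr
  have h2 : HasDerivAt (fun z => h (g z)) (_root_.deriv h 0 * m) 0 := by
    have : HasDerivAt h (_root_.deriv h 0) (g 0) := by
      rw [hg.zero]
      exact (hd.differentiableAt (hO.mem_nhds (hball (mem_ball_self hr)))).hasDerivAt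
    exact this.comp 0 hg.deriv
  have h3 : HasDerivAt (fun z => h (g z)) 1 0 := by
    refine (hasDerivAt_id (0 : ℂ)).congr_of_eventuallyEq ?_
    filter_upwards [isOpen_ball.mem_nhds (mem_ball_self one_pos : (0 : ℂ) ∈ ball 0 1)] with z hz
    exact hl z hz
  have h4 := congrArg norm (h2.unique h3)
  rw [norm_mul, Complex.norm_real, Real.norm_of_nonneg hg.pos.le, norm_one] at h4
  rw [le_div_iff₀ hr] at h1
  have := hg.pos
  by_contra hlt
  push Not at hlt
  nlinarith [norm_nonneg (_root_.deriv h 0)]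

lemma one_sub_mul_ne_zero {ρ : ℝ} (h0 : 0 ≤ ρ) (h1 : ρ ≤ 1) {z : ℂ} (hz : z ∈ ball (0 : ℂ) 1) :
    1 - (ρ : ℂ) * z ≠ 0 := by
  intro h
  have h2 : (ρ : ℂ) * z = 1 := by linear_combination -h
  have h3 := congrArg norm h2
  rw [norm_mul, Complex.norm_real, Real.norm_of_nonneg h0, norm_one] at h3
  rw [mem_ball_zero_iff] at hz
  nlinarith [norm_nonneg z]

lemma mob_mem_ball {ρ : ℝ} (h0 : 0 ≤ ρ) (h1 : ρ < 1) {z : ℂ} (hz : z ∈ ball (0 : ℂ) 1) :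
    mob ρ z ∈ ball (0 : ℂ) 1 := by
  have hne := one_sub_mul_ne_zero h0 h1.le hz
  rw [mem_ball_zero_iff] at hz ⊢
  unfold mob
  rw [norm_div, div_lt_one (norm_pos_iff.2 hne)]
  refine lt_of_pow_lt_pow_left₀ 2 (norm_nonneg _) ?_
  have h2 : ‖z‖ ^ 2 < 1 := by nlinarith [norm_nonneg z]
  have h3 : ‖1 - (ρ : ℂ) * z‖ ^ 2 - ‖(ρ : ℂ) - z‖ ^ 2 = (1 - ρ ^ 2) * (1 - ‖z‖ ^ 2) := by
    simp only [← Complex.normSq_eq_norm_sq, Complex.normSq_apply, Complex.mul_re, Complex.sub_re,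
      Complex.sub_im, Complex.mul_im, Complex.ofReal_re, Complex.ofReal_im, Complex.one_re,
      Complex.one_im]
    ring
  have : 0 < (1 - ρ ^ 2) * (1 - ‖z‖ ^ 2) := mul_pos (by nlinarith) (by linarith)
  linarith

lemma mob_mob {ρ : ℝ} (h0 : 0 ≤ ρ) (h1 : ρ < 1) {z : ℂ} (hz : z ∈ ball (0 : ℂ) 1) :
    mob ρ (mob ρ z) = z := by
  have hne := one_sub_mul_ne_zero h0 h1.le hz
  have hne2 := one_sub_mul_ne_zero h0 h1.le (mob_mem_ball h0 h1 hz)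
  unfold mob at *
  have h3 : (1 : ℂ) - ρ ^ 2 ≠ 0 := by
    have : (1 : ℝ) - ρ ^ 2 ≠ 0 := by nlinarith
    exact_mod_cast this
  rw [div_eq_iff hne2]
  field_simp
  ring

lemma differentiableOn_mob {ρ : ℝ} (h0 : 0 ≤ ρ) (h1 : ρ ≤ 1) :
    DifferentiableOn ℂ (mob ρ) (ball 0 1) := by
  unfold mob
  exact DifferentiableOn.div (by fun_prop) (by fun_prop)
    fun z hz => one_sub_mul_ne_zero h0 h1 hz

lemma mob_sq_mob_sq {ρ : ℝ} (h0 : 0 ≤ ρ) (h1 : ρ < 1) {u : ℂ} (hu : u ∈ ball (0 : ℂ) 1) :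
    mob (ρ ^ 2) (mob ρ u ^ 2) = u * mob (2 * ρ / (1 + ρ ^ 2)) u := by
  have hρ2 : ρ ^ 2 < 1 := by nlinarith
  have hα0 : 0 ≤ 2 * ρ / (1 + ρ ^ 2) := by positivity
  have hα1 : 2 * ρ / (1 + ρ ^ 2) ≤ 1 := by
    rw [div_le_one (by positivity)]; nlinarith [sq_nonneg (1 - ρ)]
  have hm := mob_mem_ball h0 h1 hu
  have hm2 : mob ρ u ^ 2 ∈ ball (0 : ℂ) 1 := by
    rw [mem_ball_zero_iff] at hm ⊢
    rw [norm_pow]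
    exact pow_lt_one₀ (norm_nonneg _) hm (by norm_num)
  have hne := one_sub_mul_ne_zero h0 h1.le hu
  have hne2 := one_sub_mul_ne_zero (sq_nonneg ρ) hρ2.le hm2
  have hne3 := one_sub_mul_ne_zero hα0 hα1 hu
  have hp : (1 : ℂ) + ρ ^ 2 ≠ 0 := by
    have : (1 : ℝ) + ρ ^ 2 ≠ 0 := by positivity
    exact_mod_cast this
  unfold mob at *
  push_cast at *
  have hne4 : 1 + (ρ : ℂ) ^ 2 - 2 * ρ * u ≠ 0 := by
    intro h
    apply hne3
    field_simp
    linear_combination h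
  have hne5 : (1 - (ρ : ℂ) * u) ^ 2 - ρ ^ 2 * (ρ - u) ^ 2 ≠ 0 := by
    intro h
    apply hne2
    field_simp
    linear_combination h
  rw [div_eq_iff hne2, ← mul_div_assoc, div_mul_eq_mul_div, eq_div_iff hne3]
  field_simp
  ring

lemma hasDerivAt_blaschke (α : ℝ) (κ : ℂ) : HasDerivAt (blaschke α κ) α 0 := by
  have h1 : AnalyticAt ℂ (fun z => mob α (κ * z)) 0 := by
    unfold mob
    exact AnalyticAt.div (by fun_prop) (by fun_prop) (by simp)
  have h2 : HasDerivAt (blaschke α κ) _ 0 :=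
    (hasDerivAt_id (0 : ℂ)).mul h1.differentiableAt.hasDerivAt
  convert! h2 using 1
  simp [mob]

/-- The Koebe transform: a good map omitting a point of the disc factors through a degree two
Blaschke product, with larger derivative at the origin. -/
lemma Good.exists_koebe {g : ℂ → ℂ} {m ρ : ℝ} (hg : Good g m) (hρ : 0 < ρ) (hρ1 : ρ < 1)
    {a : ℂ} (ha : ‖a‖ = ρ ^ 2) (hag : a ∉ g '' ball 0 1) :
    ∃ (κ : ℂ) (g₁ : ℂ → ℂ), ‖κ‖ = 1 ∧ Good g₁ (m / (2 * ρ / (1 + ρ ^ 2))) ∧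
      ∀ z ∈ ball (0 : ℂ) 1, g z = blaschke (2 * ρ / (1 + ρ ^ 2)) κ (g₁ z) := by
  set α : ℝ := 2 * ρ / (1 + ρ ^ 2) with hα
  have hα0 : 0 < α := by positivity
  have hρ2 : ρ ^ 2 < 1 := by nlinarith
  have ha0 : a ≠ 0 := by
    rw [← norm_pos_iff, ha]; positivity
  have hρc : (ρ : ℂ) ≠ 0 := by exact_mod_cast hρ.ne'
  set κ : ℂ := (ρ : ℂ) ^ 2 / a with hκ
  have hκ1 : ‖κ‖ = 1 := by
    rw [hκ, norm_div, ha, norm_pow, Complex.norm_real, Real.norm_of_nonneg hρ.le]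
    exact div_self (by positivity)
  have hκ0 : κ ≠ 0 := by rw [← norm_pos_iff, hκ1]; exact one_pos
  have hGm : ∀ z ∈ ball (0 : ℂ) 1, κ * g z ∈ ball (0 : ℂ) 1 := by
    intro z hz
    rw [mem_ball_zero_iff, norm_mul, hκ1, one_mul]
    exact mem_ball_zero_iff.1 (hg.maps hz)
  have hGd : DifferentiableOn ℂ (fun z => κ * g z) (ball 0 1) := hg.diff.const_mul κ
  have hhd : DifferentiableOn ℂ (fun z => mob (ρ ^ 2) (κ * g z)) (ball 0 1) :=
    (differentiableOn_mob (sq_nonneg ρ) hρ2.le).comp hGd hGm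
  have hh0 : ∀ z ∈ ball (0 : ℂ) 1, mob (ρ ^ 2) (κ * g z) ≠ 0 := by
    intro z hz h
    have hne := one_sub_mul_ne_zero (sq_nonneg ρ) hρ2.le (hGm z hz)
    rw [mob, div_eq_zero_iff, or_iff_left hne, sub_eq_zero, hκ] at h
    push_cast at h
    refine hag ⟨z, hz, ?_⟩
    field_simp at h
    exact h.symm
  have hlog : Complex.exp ((Real.log (ρ ^ 2) : ℝ) : ℂ) = mob (ρ ^ 2) (κ * g 0) := by
    rw [← Complex.ofReal_exp, Real.exp_log (by positivity), hg.zero]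
    simp [mob]
  obtain ⟨L, hLd, hL0, hL⟩ := exists_log_ball one_pos hhd hh0 _ hlog
  set k : ℂ → ℂ := fun z => Complex.exp (L z / 2) with hk
  have hksq : ∀ z ∈ ball (0 : ℂ) 1, k z ^ 2 = mob (ρ ^ 2) (κ * g z) := by
    intro z hz
    rw [← hL z hz, hk, ← Complex.exp_nat_mul]
    congr 1; push_cast; ring
  have hkd : DifferentiableOn ℂ k (ball 0 1) := (hLd.div_const 2).cexp
  have hk0 : k 0 = ρ := by
    rw [hk]
    simp only [hL0]
    rw [Real.log_pow]
    push_cast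
    rw [mul_div_cancel_left₀ _ two_ne_zero, ← Complex.ofReal_exp, Real.exp_log hρ]
  have hkm : ∀ z ∈ ball (0 : ℂ) 1, k z ∈ ball (0 : ℂ) 1 := by
    intro z hz
    have h1 := mob_mem_ball (sq_nonneg ρ) hρ2 (hGm z hz)
    rw [← hksq z hz] at h1
    rw [mem_ball_zero_iff] at h1 ⊢
    rw [norm_pow] at h1
    by_contra h2
    push Not at h2
    nlinarith
  have hfac : ∀ z ∈ ball (0 : ℂ) 1, κ * g z = mob ρ (k z) * mob α (mob ρ (k z)) := by
    intro z hz
    have hu := mob_mem_ball hρ.le hρ1 (hkm z hz)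
    rw [← mob_sq_mob_sq hρ.le hρ1 hu, mob_mob hρ.le hρ1 (hkm z hz), hksq z hz,
      mob_mob (sq_nonneg ρ) hρ2 (hGm z hz)]
  have hg1d : DifferentiableOn ℂ (fun z => κ⁻¹ * mob ρ (k z)) (ball 0 1) :=
    ((differentiableOn_mob hρ.le hρ1.le).comp hkd hkm).const_mul _
  have hgB : ∀ z ∈ ball (0 : ℂ) 1, g z = blaschke α κ (κ⁻¹ * mob ρ (k z)) := by
    intro z hz
    rw [blaschke, mul_inv_cancel_left₀ hκ0, mul_assoc, ← hfac z hz, inv_mul_cancel_left₀ hκ0]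
  have hz0 : κ⁻¹ * mob ρ (k 0) = 0 := by rw [hk0]; simp [mob]
  refine ⟨κ, fun z => κ⁻¹ * mob ρ (k z), hκ1, ⟨hg1d, ?_, ?_, hz0, ?_, ?_⟩, hgB⟩
  · intro z hz w hw hzw
    have h1 := hgB z hz
    have hzw : κ⁻¹ * mob ρ (k z) = κ⁻¹ * mob ρ (k w) := hzw
    rw [hzw, ← hgB w hw] at h1
    exact hg.inj hz hw h1
  · intro z hz
    rw [mem_ball_zero_iff, norm_mul, norm_inv, hκ1, inv_one, one_mul]
    exact mem_ball_zero_iff.1 (mob_mem_ball hρ.le hρ1 (hkm z hz))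
  · exact div_pos (hg.pos) hα0
  · have h0 : (0 : ℂ) ∈ ball (0 : ℂ) 1 := by simp
    have h1 := (hg1d.differentiableAt (isOpen_ball.mem_nhds h0)).hasDerivAt
    have h2 : HasDerivAt (blaschke α κ) α (κ⁻¹ * mob ρ (k 0)) := by
      rw [hz0]; exact hasDerivAt_blaschke α κ
    have h3 := (h2.comp 0 h1).congr_of_eventuallyEq (f₁ := g) (by
      filter_upwards [isOpen_ball.mem_nhds h0] with z hz
      exact hgB z hz)
    have h4 := h3.unique (hg.deriv)
    convert! h1 using 1
    push_cast
    rw [div_eq_iff (by exact_mod_cast hα0.ne'), ← h4, mul_comm]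

lemma Good.le_one {g : ℂ → ℂ} {m : ℝ} (hg : Good g m) : m ≤ 1 := by
  have := Complex.norm_deriv_le_div_of_mapsTo_ball (c := 0) (R₁ := 1) (R₂ := 1) (f := g)
    hg.diff (by rw [hg.zero]; exact hg.maps.mono_right ball_subset_closedBall) one_pos
  rw [hg.deriv.deriv, Complex.norm_real, Real.norm_of_nonneg hg.pos.le] at this
  simpa using this

lemma Good.exists_chain {f : ℂ → ℂ} {m ρ : ℝ} (hf : Good f m) (hρ : 0 < ρ) (hρ1 : ρ < 1)
    (N : ℕ) : ∃ (n : ℕ) (c : ℕ → ℂ) (F g : ℂ → ℂ) (m' : ℝ), Good g m' ∧ ρ ^ 2 ≤ m' ∧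
      m ≤ (2 * ρ / (1 + ρ ^ 2)) ^ n ∧ Reach (2 * ρ / (1 + ρ ^ 2)) n c ∧ HasLogCoeff N F c ∧
      ∀ z ∈ ball (0 : ℂ) 1, f z = F (g z) := by
  by_contra hcon
  set α : ℝ := 2 * ρ / (1 + ρ ^ 2) with hα
  have hα0 : 0 < α := by positivity
  have hα1 : α < 1 := by
    rw [hα, div_lt_one (by positivity)]
    nlinarith [mul_pos (sub_pos.2 hρ1) (sub_pos.2 hρ1)]
  have key : ∀ n : ℕ, ∃ (c : ℕ → ℂ) (F g : ℂ → ℂ), Good g (m / α ^ n) ∧ Reach α n c ∧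
      HasLogCoeff N F c ∧ ∀ z ∈ ball (0 : ℂ) 1, f z = F (g z) := by
    intro n
    induction n with
    | zero =>
      exact ⟨0, fun z => z, f, by simpa using hf, .zero, hasLogCoeff_id N, fun z _ => rfl⟩
    | succ n ih =>
      obtain ⟨c, F, g, hg, hr, hc, hfg⟩ := ih
      have hm := hg.le_one
      rw [div_le_one (by positivity)] at hm
      have hlt : ¬ ρ ^ 2 ≤ m / α ^ n := fun h => hcon ⟨n, c, F, g, _, hg, h, hm, hr, hc, hfg⟩
      have hns : ¬ sphere 0 (ρ ^ 2) ⊆ g '' ball 0 1 := fun h =>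
        hlt (hg.le_of_sphere_subset (by positivity) h)
      obtain ⟨a, ha, hag⟩ := Set.not_subset.1 hns
      obtain ⟨κ, g₁, hκ, hg₁, hgg⟩ := hg.exists_koebe hρ hρ1 (mem_sphere_zero_iff_norm.1 ha) hag
      refine ⟨_, _, g₁, ?_, .step hκ hr, hc.blaschke α hα0 κ ?_, ?_⟩
      · rwa [pow_succ, ← div_div]
      · rw [← norm_pos_iff, hκ]; exact one_pos
      · intro z hz
        rw [hfg z hz, hgg z hz]
  obtain ⟨n, hn⟩ := exists_pow_lt_of_lt_one hf.pos hα1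
  obtain ⟨c, F, g, hg, -⟩ := key n
  have hm := hg.le_one
  rw [div_le_one (by positivity)] at hm
  linarith

lemma Good.exists_log {g : ℂ → ℂ} {m δ : ℝ} (hg : Good g m) (hδ : 0 < δ) (hδ1 : δ ≤ 1 / 8)
    (hm : 1 - m ≤ δ) : ∃ l : ℂ → ℂ, DifferentiableOn ℂ l (ball 0 (1 / 2)) ∧ l 0 = 0 ∧
      ∀ z ∈ ball (0 : ℂ) (1 / 2), ‖l z‖ ≤ 6 * δ ∧ ‖g z - z‖ ≤ 3 * δ ∧
        g z = z * (m * Complex.exp (l z)) := by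
  set ψ : ℂ → ℂ := dslope g 0 with hψ
  have h0 : (0 : ℂ) ∈ ball (0 : ℂ) 1 := by simp
  have hψd : DifferentiableOn ℂ ψ (ball 0 1) :=
    (Complex.differentiableOn_dslope (isOpen_ball.mem_nhds h0)).2 hg.diff
  have hψ0 : ψ 0 = m := by rw [hψ, dslope_same, hg.deriv.deriv]
  have hgψ : ∀ z, g z = z * ψ z := by
    intro z
    have := sub_smul_dslope g 0 z
    rw [hg.zero, sub_zero, sub_zero, smul_eq_mul] at this
    exact this.symm
  have hψ1 : ∀ z ∈ ball (0 : ℂ) 1, ‖ψ z‖ ≤ 1 := by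
    intro z hz
    have := Complex.norm_dslope_le_div_of_mapsTo_ball (c := 0) (R₁ := 1) (R₂ := 1) (f := g)
      hg.diff (by rw [hg.zero]; exact hg.maps.mono_right ball_subset_closedBall) hz
    simpa using this
  have hsub : ball (0 : ℂ) (1 / 2) ⊆ ball 0 1 := ball_subset_ball (by norm_num)
  have hmpos : 7 / 8 ≤ m := by linarith
  have hm1 := hg.le_one
  have hdist : ∀ z ∈ ball (0 : ℂ) (1 / 2), ‖ψ z - m‖ ≤ 2 * δ := by
    intro z hz
    have h1 := Complex.borelCaratheodory_zero (f := fun z => ψ z - m) (M := δ) (R := 1) hδ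
      (hψd.sub_const _) (by
        intro w hw
        have h2 := (Complex.re_le_norm (ψ w)).trans (hψ1 w hw)
        simp only [Set.mem_ofPred_eq, Complex.sub_re, Complex.ofReal_re]
        linarith) one_pos (hsub hz) (by simp [hψ0])
    refine h1.trans ?_
    rw [mem_ball_zero_iff] at hz
    rw [div_le_iff₀ (by linarith)]
    nlinarith
  have hmc : (m : ℂ) ≠ 0 := by
    have : m ≠ 0 := by linarith
    exact_mod_cast this
  have hq : ∀ z ∈ ball (0 : ℂ) (1 / 2), ‖ψ z / m - 1‖ ≤ 4 * δ := by
    intro z hz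
    rw [div_sub_one hmc, norm_div, Complex.norm_real, Real.norm_of_nonneg hg.pos.le,
      div_le_iff₀ hg.pos]
    nlinarith [hdist z hz]
  have hslit : ∀ z ∈ ball (0 : ℂ) (1 / 2), ψ z / m ∈ Complex.slitPlane := by
    intro z hz
    have h1 := Complex.mem_slitPlane_of_norm_lt_one (z := ψ z / m - 1)
      ((hq z hz).trans_lt (by linarith))
    simpa using h1
  refine ⟨fun z => Complex.log (ψ z / m), ((hψd.mono hsub).div_const _).clog hslit, ?_, ?_⟩
  · simp only [hψ0, div_self hmc, Complex.log_one]
  · intro z hz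
    refine ⟨?_, ?_, ?_⟩
    · have h1 := Complex.norm_log_one_add_half_le_self (z := ψ z / m - 1)
        ((hq z hz).trans (by linarith))
      rw [add_sub_cancel] at h1
      linarith [hq z hz]
    · have h1 : g z - z = z * ((ψ z - m) - (1 - m : ℝ)) := by rw [hgψ]; push_cast; ring
      rw [h1, norm_mul]
      have h2 := norm_sub_le (ψ z - m) ((1 - m : ℝ) : ℂ)
      rw [Complex.norm_real, Real.norm_of_nonneg (by linarith)] at h2
      have h3 := hdist z hz
      have h4 := mem_ball_zero_iff.1 hz
      nlinarith [norm_nonneg z, norm_nonneg ((ψ z - m) - ((1 - m : ℝ) : ℂ))]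
    · rw [Complex.exp_log (Complex.slitPlane_ne_zero (hslit z hz)), mul_div_cancel₀ _ hmc]
      exact hgψ z

lemma eventually_eq_of_exp_eq {A B : ℂ → ℂ} (hA : ContinuousAt A 0) (hB : ContinuousAt B 0)
    (h0 : A 0 = B 0) (h : ∀ᶠ z in 𝓝[≠] 0, Complex.exp (A z) = Complex.exp (B z)) :
    ∀ᶠ z in 𝓝 0, A z = B z := by
  have h1 : Tendsto (fun z => A z - B z) (𝓝 0) (𝓝 0) := by
    have := hA.tendsto.sub hB.tendsto
    rwa [h0, sub_self] at this
  have h2 : ∀ᶠ z in 𝓝 (0 : ℂ), ‖A z - B z‖ < 1 := by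
    simpa using h1.eventually (ball_mem_nhds (0 : ℂ) one_pos)
  rw [eventually_nhdsWithin_iff] at h
  filter_upwards [h, h2] with z hz hz2
  by_cases hz0 : z = 0
  · rw [hz0, h0]
  have h3 : Complex.exp (A z - B z) = 1 := by
    rw [Complex.exp_sub, hz hz0, div_self (Complex.exp_ne_zero _)]
  have him : |(A z - B z).im| < 1 := (Complex.abs_im_le_norm _).trans_lt hz2
  rw [abs_lt] at him
  have h4 := Complex.log_exp (x := A z - B z) (by linarith [Real.pi_gt_three])
    (by linarith [Real.pi_gt_three])
  rw [h3, Complex.log_one] at h4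
  exact sub_eq_zero.1 h4.symm

lemma norm_pow_sub_pow_le {z w : ℂ} (hz : ‖z‖ ≤ 1) (hw : ‖w‖ ≤ 1) (k : ℕ) :
    ‖z ^ k - w ^ k‖ ≤ k * ‖z - w‖ := by
  induction k with
  | zero => simp
  | succ k ih =>
    have h1 : z ^ (k + 1) - w ^ (k + 1) = z * (z ^ k - w ^ k) + (z - w) * w ^ k := by ring
    rw [h1]
    refine (norm_add_le _ _).trans ?_
    rw [norm_mul, norm_mul, norm_pow]
    have h2 := pow_le_one₀ (n := k) (norm_nonneg w) hw
    push_cast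
    nlinarith [norm_nonneg (z ^ k - w ^ k), norm_nonneg (z - w), norm_nonneg z]

lemma iteratedDeriv_sum_pow (N : ℕ) (c : ℕ → ℂ) {k : ℕ} (hk : k ∈ Finset.Icc 1 N) :
    iteratedDeriv k (fun z => ∑ j ∈ Finset.Icc 1 N, c j * z ^ j) 0 = k.factorial * c k := by
  rw [iteratedDeriv_fun_sum fun i _ => by fun_prop]
  simp (disch := fun_prop) only [iteratedDeriv_const_mul_field, iteratedDeriv_fun_pow_zero]
  rw [Finset.sum_eq_single k]
  · simp [mul_comm]
  · intro j _ hj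
    simp [hj.symm]
  · exact fun h => (h hk).elim

lemma HasLogCoeff.norm_sub_le {N : ℕ} {f F g l D : ℂ → ℂ} {c : ℕ → ℂ} {m m' δ : ℝ}
    (hc : HasLogCoeff N F c) (hg : Good g m') (hm : m ≠ 0)
    (hld : DifferentiableOn ℂ l (ball 0 (1 / 2))) (hl0 : l 0 = 0)
    (hl : ∀ z ∈ ball (0 : ℂ) (1 / 2), ‖l z‖ ≤ 6 * δ ∧ ‖g z - z‖ ≤ 3 * δ ∧
        g z = z * (m' * Complex.exp (l z)))
    (hD : AnalyticAt ℂ D 0) (hD0 : D 0 = 0)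
    (hfD : ∀ᶠ z in 𝓝 0, f z = m * z * Complex.exp (D z))
    (hfF : ∀ᶠ z in 𝓝 0, f z = F (g z)) {k : ℕ} (hk : k ∈ Finset.Icc 1 N) :
    ‖iteratedDeriv k D 0 / k.factorial - c k‖ ≤
      3 ^ k * (6 * δ + ∑ j ∈ Finset.Icc 1 N, ‖c j‖ * (j * (3 * δ))) := by
  obtain ⟨u, C, hu, hC, hC0, hF, hO⟩ := hc
  have hsub : ball (0 : ℂ) (1 / 2) ⊆ ball 0 1 := ball_subset_ball (by norm_num)
  have hB : ball (0 : ℂ) (1 / 2) ∈ 𝓝 (0 : ℂ) := ball_mem_nhds _ (by norm_num)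
  have hga : AnalyticAt ℂ g 0 := (hg.diff.analyticOnNhd isOpen_ball) 0 (by simp)
  have hla : AnalyticAt ℂ l 0 := (hld.analyticOnNhd isOpen_ball) 0 (by simp)
  have hgt : Tendsto g (𝓝 0) (𝓝 0) := by
    have := hga.continuousAt.tendsto
    rwa [hg.zero] at this
  have hCg : AnalyticAt ℂ (fun z => C (g z)) 0 :=
    AnalyticAt.comp (g := C) (by rw [hg.zero]; exact hC) hga
  have hcore : ∀ᶠ z in 𝓝[≠] (0 : ℂ), (m : ℂ) * Complex.exp (D z)
      = u * m' * Complex.exp (l z + C (g z)) := by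
    rw [eventually_nhdsWithin_iff]
    filter_upwards [hfD, hfF, hgt.eventually hF, hB] with z h1 h2 h3 h4 h5
    have h5 : z ≠ 0 := h5
    rw [h1, h3] at h2
    have h6 := (hl z h4).2.2
    rw [Complex.exp_add]
    have h7 : z * (m * Complex.exp (D z)) = z * (u * m' * (Complex.exp (l z) *
        Complex.exp (C (g z)))) := by
      calc _ = m * z * Complex.exp (D z) := by ring
        _ = u * g z * Complex.exp (C (g z)) := h2
        _ = u * (z * (m' * Complex.exp (l z))) * Complex.exp (C (g z)) := by rw [← h6]
        _ = _ := by ring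
    exact mul_left_cancel₀ h5 h7
  have hmu : (m : ℂ) = u * m' := by
    have t1 : Tendsto (fun z => (m : ℂ) * Complex.exp (D z)) (𝓝[≠] 0) (𝓝 (m * Complex.exp (D 0))) :=
      ((hD.continuousAt.cexp.const_mul _).tendsto).mono_left nhdsWithin_le_nhds
    have t2 : Tendsto (fun z => u * m' * Complex.exp (l z + C (g z))) (𝓝[≠] 0)
        (𝓝 (u * m' * Complex.exp (l 0 + C (g 0)))) :=
      (((hla.add hCg).continuousAt.cexp.const_mul _).tendsto).mono_left nhdsWithin_le_nhds
    have := tendsto_nhds_unique (t1.congr' hcore) t2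
    simpa [hD0, hl0, hg.zero, hC0] using this
  have hDE : ∀ᶠ z in 𝓝 0, D z = l z + C (g z) := by
    refine eventually_eq_of_exp_eq hD.continuousAt (hla.add hCg).continuousAt
      (by simp [hD0, hl0, hg.zero, hC0]) ?_
    filter_upwards [hcore] with z hz
    rw [← hmu] at hz
    exact mul_left_cancel₀ (by exact_mod_cast hm) hz
  set P : ℂ → ℂ := fun z => ∑ j ∈ Finset.Icc 1 N, c j * z ^ j with hP
  have hPa : ∀ w, AnalyticAt ℂ P w := fun w => by rw [hP]; fun_prop
  have hPg : AnalyticAt ℂ (fun z => P (g z)) 0 :=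
    AnalyticAt.comp (g := P) (hPa _) hga
  set W : ℂ → ℂ := fun z => D z - (l z + P (g z)) with hW
  have hWa : AnalyticAt ℂ W 0 := hD.sub (hla.add hPg)
  have hgO : g =O[𝓝 0] fun z => z := by
    have := hg.deriv.differentiableAt.isBigO_sub
    simpa [hg.zero] using this
  have hWO : W =O[𝓝 0] fun z => z ^ (N + 1) := by
    have h1 : (fun z => C (g z) - P (g z)) =O[𝓝 0] fun z => z ^ (N + 1) :=
      (hO.comp_tendsto hgt).trans (hgO.pow (N + 1))
    refine h1.congr' ?_ EventuallyEq.rfl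
    filter_upwards [hDE] with z hz
    simp only [hW, hz]
    ring
  have hWk := iteratedDeriv_eq_zero_of_isBigO hWa (N + 1) hWO k
    (Nat.lt_succ_of_le (Finset.mem_Icc.1 hk).2)
  set H : ℂ → ℂ := fun z => l z + (P (g z) - P z) with hH
  have hHa : AnalyticAt ℂ H 0 := hla.add (hPg.sub (hPa 0))
  have hHd : DifferentiableOn ℂ H (ball 0 (1 / 2)) := by
    have h1 : Differentiable ℂ P := fun w => (hPa w).differentiableAt
    exact hld.add ((h1.comp_differentiableOn (hg.diff.mono hsub)).sub h1.differentiableOn)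
  have hsum : iteratedDeriv k D 0 - k.factorial * c k = iteratedDeriv k H 0 := by
    have h1 : (fun z => D z - P z) = fun z => W z + H z := by
      funext z; simp only [hW, hH]; ring
    have h2 := congrArg (fun G => iteratedDeriv k G 0) h1
    beta_reduce at h2
    rw [iteratedDeriv_fun_sub hD.contDiffAt (hPa 0).contDiffAt,
      iteratedDeriv_fun_add hWa.contDiffAt hHa.contDiffAt, hWk, zero_add,
      iteratedDeriv_sum_pow N c hk] at h2
    exact h2
  have hsub2 : closedBall (0 : ℂ) (1 / 3) ⊆ ball 0 (1 / 2) :=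
    closedBall_subset_ball (by norm_num)
  have hHn : ∀ z ∈ sphere (0 : ℂ) (1 / 3), ‖H z‖ ≤
      6 * δ + ∑ j ∈ Finset.Icc 1 N, ‖c j‖ * (j * (3 * δ)) := by
    intro z hz
    have hz' := hsub2 (sphere_subset_closedBall hz)
    obtain ⟨h1, h2, -⟩ := hl z hz'
    refine (norm_add_le _ _).trans (add_le_add h1 ?_)
    simp only [hP, ← Finset.sum_sub_distrib, ← mul_sub]
    refine (norm_sum_le _ _).trans (Finset.sum_le_sum fun j _ => ?_)
    rw [norm_mul]
    gcongr
    refine (norm_pow_sub_pow_le (mem_ball_zero_iff.1 (hg.maps (hsub hz'))).le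
      (mem_ball_zero_iff.1 (hsub hz')).le j).trans ?_
    gcongr
  have hfin := Complex.norm_iteratedDeriv_le_of_forall_mem_sphere_norm_le k
    (by norm_num : (0 : ℝ) < 1 / 3) ((hHd.mono hsub2).diffContOnCl_ball subset_rfl) hHn
  have hfac : (0 : ℝ) < k.factorial := by exact_mod_cast k.factorial_pos
  have hfacc : (k.factorial : ℂ) ≠ 0 := by exact_mod_cast k.factorial_ne_zero
  have : iteratedDeriv k D 0 / k.factorial - c k = iteratedDeriv k H 0 / k.factorial := by
    rw [← hsum]; field_simp
  rw [this, norm_div, Complex.norm_natCast, div_le_iff₀ hfac]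
  refine hfin.trans (le_of_eq ?_)
  rw [one_div, inv_pow, div_inv_eq_mul]
  ring

lemma Good.milin_nonpos {f D : ℂ → ℂ} {m : ℝ} (hf : Good f m) (hD : AnalyticAt ℂ D 0)
    (hD0 : D 0 = 0) (hfD : ∀ᶠ z in 𝓝 0, f z = m * z * Complex.exp (D z)) (N : ℕ) :
    milin N 1 (fun k => iteratedDeriv k D 0 / k.factorial) ≤ 0 := by
  set d : ℕ → ℂ := fun k => iteratedDeriv k D 0 / k.factorial with hd
  obtain ⟨K, R, hKR⟩ := Reach.milin_le N m hf.pos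
  set A : ℝ := 3 ^ N * (12 + ∑ j ∈ Finset.Icc 1 N, R * (j * 6)) with hA
  have key : ∀ t : ℝ, 0 < t → t ≤ 1 / 16 → ∃ c : ℕ → ℂ,
      (∀ k ∈ Finset.Icc 1 N, ‖d k - c k‖ ≤ A * t) ∧ milin N 1 c ≤ |K| * t := by
    intro t ht ht1
    obtain ⟨n, c, F, g, m', hg, hm', hn, hr, hc, hfg⟩ := hf.exists_chain
      (ρ := 1 - t) (by linarith) (by linarith) N
    set ρ := 1 - t with hρ
    have hαge : ρ ≤ 2 * ρ / (1 + ρ ^ 2) := by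
      rw [le_div_iff₀ (by positivity)]; nlinarith
    have hαle : 2 * ρ / (1 + ρ ^ 2) ≤ 1 := by
      rw [div_le_one (by positivity)]; nlinarith
    obtain ⟨hR, hK⟩ := hKR _ (by linarith) hαle n c hr hn
    refine ⟨c, fun k hk => ?_, ?_⟩
    · obtain ⟨l, hld, hl0, hl⟩ := hg.exists_log (δ := 2 * t) (by linarith) (by linarith)
        (by nlinarith)
      have h1 := hc.norm_sub_le hg hf.pos.ne' hld hl0 hl hD hD0 hfD
        (eventually_of_mem (ball_mem_nhds _ one_pos) hfg) hk
      refine h1.trans ?_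
      have hk' := Finset.mem_Icc.1 hk
      have hR0 : 0 ≤ R := (norm_nonneg _).trans (hR k hk)
      have h2 : 6 * (2 * t) + ∑ j ∈ Finset.Icc 1 N, ‖c j‖ * (j * (3 * (2 * t))) ≤
          (12 + ∑ j ∈ Finset.Icc 1 N, R * (j * 6)) * t := by
        rw [add_mul, Finset.sum_mul]
        refine add_le_add (by linarith) (Finset.sum_le_sum fun j hj => ?_)
        calc ‖c j‖ * (j * (3 * (2 * t))) ≤ R * (j * (3 * (2 * t))) := by
              gcongr; exact hR j hj
          _ = R * (j * 6) * t := by ring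
      rw [hA, mul_assoc]
      gcongr
      · norm_num
      · exact hk'.2
    · refine hK.trans ?_
      have := le_abs_self K
      nlinarith [abs_nonneg K]
  have hpos : ∀ j : ℕ, (0 : ℝ) < (1 / 16) ^ (j + 1) := fun j => by positivity
  have hle : ∀ j : ℕ, ((1 : ℝ) / 16) ^ (j + 1) ≤ 1 / 16 := fun j =>
    pow_le_of_le_one (by norm_num) (by norm_num) (by simp)
  choose c hc1 hc2 using fun j : ℕ => key _ (hpos j) (hle j)
  have ht : Tendsto (fun j : ℕ => ((1 : ℝ) / 16) ^ (j + 1)) atTop (𝓝 0) :=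
    (tendsto_pow_atTop_nhds_zero_of_lt_one (by norm_num) (by norm_num)).comp
      (tendsto_add_atTop_nat 1)
  have htc : ∀ k ∈ Finset.Icc 1 N, Tendsto (fun j => c j k) atTop (𝓝 (d k)) := by
    intro k hk
    rw [tendsto_iff_norm_sub_tendsto_zero]
    refine squeeze_zero (fun _ => norm_nonneg _) (fun j => ?_)
      (by have := ht.const_mul A; rwa [mul_zero] at this)
    rw [norm_sub_rev]
    exact hc1 j k hk
  have hlim : Tendsto (fun j => milin N 1 (c j)) atTop (𝓝 (milin N 1 d)) := by
    unfold milin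
    refine tendsto_finsetSum _ fun k hk => ?_
    have := htc (k + 1) (by simp at hk ⊢; omega)
    exact (((this.norm.pow 2).const_mul _).sub_const _).mul_const _
  refine le_of_tendsto_of_tendsto' hlim (by simpa using ht.const_mul |K|) hc2

lemma iteratedDeriv_scale (k : ℕ) (c : ℂ) (f : ℂ → ℂ) :
    iteratedDeriv k (fun z => f (c * z)) = fun z => c ^ k * iteratedDeriv k f (c * z) := by
  induction k generalizing f with
  | zero => simp
  | succ k ih =>
    have h1 : deriv (fun z => f (c * z)) = fun z => c * deriv f (c * z) := by
      funext z
      simpa using deriv_comp_mul_left c f z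
    rw [iteratedDeriv_succ', iteratedDeriv_succ', h1]
    funext z
    rw [iteratedDeriv_const_mul_field, ih]
    ring

/-- The Milin inequality for the logarithmic coefficients of a normalized univalent function. -/
theorem milin_nonpos {f C : ℂ → ℂ} (hf : DifferentiableOn ℂ f (ball (0 : ℂ) 1))
    (hinj : Set.InjOn f (ball (0 : ℂ) 1)) (hf0 : f 0 = 0) (hf1 : deriv f 0 = 1)
    (hC : AnalyticAt ℂ C 0) (hC0 : C 0 = 0)
    (hfC : ∀ᶠ z in 𝓝 0, f z = z * Complex.exp (C z)) (N : ℕ) :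
    milin N 1 (fun k => iteratedDeriv k C 0 / k.factorial) ≤ 0 := by
  have key : ∀ R : ℝ, R ∈ Set.Ioo (0 : ℝ) 1 →
      milin N 1 (fun k => (R : ℂ) ^ k * iteratedDeriv k C 0 / k.factorial) ≤ 0 := by
    rintro R ⟨hR0, hR1⟩
    have hsub : closedBall (0 : ℂ) R ⊆ ball 0 1 := closedBall_subset_ball hR1
    obtain ⟨M, hM⟩ := (isCompact_closedBall (0 : ℂ) R).exists_bound_of_continuousOn
      (hf.continuousOn.mono hsub)
    have hM0 : 0 ≤ M := (norm_nonneg _).trans (hM 0 (by simp [hR0.le]))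
    have hMc : ((M + 1 : ℝ) : ℂ) ≠ 0 := by
      have : M + 1 ≠ 0 := by positivity
      exact_mod_cast this
    have hRc : (R : ℂ) ≠ 0 := by exact_mod_cast hR0.ne'
    have hmaps : Set.MapsTo (fun z : ℂ => R * z) (ball 0 1) (closedBall 0 R) := by
      intro z hz
      rw [mem_ball_zero_iff] at hz
      rw [mem_closedBall_zero_iff, norm_mul, Complex.norm_real, Real.norm_of_nonneg hR0.le]
      nlinarith
    have ht : Tendsto (fun z : ℂ => (R : ℂ) * z) (𝓝 0) (𝓝 0) := by
      have : Continuous fun z : ℂ => (R : ℂ) * z := by fun_prop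
      simpa using this.tendsto 0
    have hgood : Good (fun z => f (R * z) / ((M + 1 : ℝ) : ℂ)) (R / (M + 1)) := by
      refine ⟨?_, ?_, ?_, by simp [hf0], by positivity, ?_⟩
      · exact (hf.comp (by fun_prop) (hmaps.mono_right hsub)).div_const _
      · intro z hz w hw h
        have h1 := hinj (hsub (hmaps hz)) (hsub (hmaps hw)) ((div_left_inj' hMc).1 h)
        exact mul_left_cancel₀ hRc h1
      · intro z hz
        rw [mem_ball_zero_iff, norm_div, Complex.norm_real, Real.norm_of_nonneg (by positivity),
          div_lt_one (by positivity)]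
        linarith [hM _ (hmaps hz)]
      · have h1 : HasDerivAt f 1 ((R : ℂ) * 0) := by
          rw [mul_zero, ← hf1]
          exact (hf.differentiableAt (ball_mem_nhds _ one_pos)).hasDerivAt
        have h2 : HasDerivAt (fun z : ℂ => (R : ℂ) * z) R 0 := by
          simpa using (hasDerivAt_id (0 : ℂ)).const_mul (R : ℂ)
        have h3 := (h1.comp 0 h2).div_const ((M + 1 : ℝ) : ℂ)
        rw [one_mul] at h3
        rw [Complex.ofReal_div]
        exact h3
    have h := hgood.milin_nonpos (D := fun z => C (R * z))
      (AnalyticAt.comp (g := C) (f := fun z => R * z) (by simpa using hC) (by fun_prop))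
      (by simpa using hC0) (by
        filter_upwards [ht.eventually hfC] with z hz
        rw [hz]; push_cast; ring) N
    simpa only [iteratedDeriv_scale, mul_zero] using h
  have hlim : Tendsto (fun R : ℝ => milin N 1
      (fun k => (R : ℂ) ^ k * iteratedDeriv k C 0 / k.factorial)) (𝓝[<] 1)
      (𝓝 (milin N 1 (fun k => ((1 : ℝ) : ℂ) ^ k * iteratedDeriv k C 0 / k.factorial))) := by
    refine Tendsto.mono_left (Continuous.tendsto ?_ 1) nhdsWithin_le_nhds
    unfold milin
    fun_prop
  have h := le_of_tendsto hlim (by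
    filter_upwards [Ioo_mem_nhdsLT (zero_lt_one (α := ℝ))] with R hR
    exact key R hR)
  simpa using h

/-- The second Lebedev–Milin inequality for exponentiated power series. -/
lemma lebedev_milin {β γ : ℕ → ℂ} (h0 : β 0 = 1)
    (h : ∀ k : ℕ, ((k : ℂ) + 1) * β (k + 1) =
      ∑ i ∈ Finset.range (k + 1), ((i : ℂ) + 1) * γ (i + 1) * β (k - i)) (N : ℕ) :
    ∑ i ∈ Finset.range (N + 1), ‖β i‖ ^ 2 ≤ (N + 1) * Real.exp ((∑ k ∈ Finset.range N,
      (((k : ℝ) + 1) * ‖γ (k + 1)‖ ^ 2 - 1 / (k + 1)) * ((N : ℝ) - k)) / (N + 1)) := by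
  set x : ℕ → ℝ := fun k => ((k : ℝ) + 1) * ‖γ (k + 1)‖ ^ 2 - 1 / (k + 1) with hx
  induction N with
  | zero => simp [h0]
  | succ N ih =>
    set T : ℝ := ∑ k ∈ Finset.range N, x k * ((N : ℝ) - k) with hT
    set T' : ℝ := ∑ k ∈ Finset.range (N + 1), x k * (((N + 1 : ℕ) : ℝ) - k) with hT'
    set U : ℝ := ∑ k ∈ Finset.range (N + 1), x k with hU
    set A : ℝ := ∑ k ∈ Finset.range (N + 1), (((k : ℝ) + 1) * ‖γ (k + 1)‖) ^ 2 with hA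
    set B : ℝ := ∑ i ∈ Finset.range (N + 1), ‖β i‖ ^ 2 with hB
    have hTU : T' = T + U := by
      have : T = ∑ k ∈ Finset.range (N + 1), x k * ((N : ℝ) - k) := by
        rw [Finset.sum_range_succ, sub_self, mul_zero, add_zero]
      rw [this, hT', hU, ← Finset.sum_add_distrib]
      refine Finset.sum_congr rfl fun k _ => ?_
      push_cast; ring
    have hAU : A - (N + 1) = (N + 2) * U - T' := by
      have h1 : ((N : ℝ) + 1) = ∑ k ∈ Finset.range (N + 1), (1 : ℝ) := by simp
      rw [hA, hU, hT', h1, ← Finset.sum_sub_distrib, Finset.mul_sum, ← Finset.sum_sub_distrib]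
      refine Finset.sum_congr rfl fun k _ => ?_
      have : (k : ℝ) + 1 ≠ 0 := by positivity
      simp only [hx]
      push_cast
      field_simp
      ring
    have hB0 : 0 ≤ B := Finset.sum_nonneg fun _ _ => by positivity
    have hCS : (((N : ℝ) + 1) * ‖β (N + 1)‖) ^ 2 ≤ A * B := by
      have h1 : ((N : ℝ) + 1) * ‖β (N + 1)‖ ≤
          ∑ i ∈ Finset.range (N + 1), (((i : ℝ) + 1) * ‖γ (i + 1)‖) * ‖β (N - i)‖ := by
        have h2 := congrArg norm (h N)
        have h3 : ∀ n : ℕ, ‖(n : ℂ) + 1‖ = n + 1 := fun n => by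
          exact_mod_cast Complex.norm_natCast (n + 1)
        rw [norm_mul, h3] at h2
        rw [h2]
        refine (norm_sum_le _ _).trans (le_of_eq (Finset.sum_congr rfl fun i _ => ?_))
        rw [norm_mul, norm_mul, h3]
      refine (pow_le_pow_left₀ (by positivity) h1 2).trans
        ((Finset.sum_mul_sq_le_sq_mul_sq _ _ _).trans (le_of_eq ?_))
      have h4 := Finset.sum_range_reflect (fun i => ‖β i‖ ^ 2) (N + 1)
      simp only [Nat.add_sub_cancel] at h4
      rw [h4]
    rw [Finset.sum_range_succ]
    have hn : (0 : ℝ) < (N : ℝ) + 1 := by positivity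
    have hn2 : (0 : ℝ) < (N : ℝ) + 2 := by positivity
    have hβ : ‖β (N + 1)‖ ^ 2 ≤ A * B / (N + 1) ^ 2 := by
      rw [le_div_iff₀ (by positivity)]
      linarith [hCS, mul_pow ((N : ℝ) + 1) ‖β (N + 1)‖ 2]
    have hA0 : 0 ≤ A := Finset.sum_nonneg fun _ _ => by positivity
    calc B + ‖β (N + 1)‖ ^ 2 ≤ B + A * B / (N + 1) ^ 2 := by gcongr
      _ = B * (((N + 2) / (N + 1)) * ((A - (N + 1)) / ((N + 1) * (N + 2)) + 1)) := by
          field_simp; ring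
      _ ≤ ((N + 1) * Real.exp (T / (N + 1))) * (((N + 2) / (N + 1)) *
            Real.exp ((A - (N + 1)) / ((N + 1) * (N + 2)))) := by
          have h5 : 0 ≤ (A - (N + 1)) / ((N + 1) * (N + 2)) + 1 := by
            have : (A - (N + 1)) / ((N + 1) * (N + 2)) + 1
                = (A + (N + 1) ^ 2) / (((N : ℝ) + 1) * (N + 2)) := by
              field_simp; ring
            rw [this]; positivity
          gcongr
          exact Real.add_one_le_exp _
      _ = (N + 2) * Real.exp (T / (N + 1) + (A - (N + 1)) / ((N + 1) * (N + 2))) := by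
          rw [Real.exp_add]; field_simp
      _ = _ := by
          have h6 : T / (N + 1) + (A - (N + 1)) / ((N + 1) * (N + 2)) = T' / (N + 1 + 1) := by
            rw [hAU, show T = T' - U by linarith, show (N : ℝ) + 1 + 1 = N + 2 by ring]
            field_simp
            ring
          rw [h6]
          push_cast
          ring

/-- The `n`-th Taylor coefficient at the origin. -/
noncomputable def coef (n : ℕ) (F : ℂ → ℂ) : ℂ := iteratedDeriv n F 0 / n.factorial

lemma coef_mul {F G : ℂ → ℂ} (hF : AnalyticAt ℂ F 0) (hG : AnalyticAt ℂ G 0) (n : ℕ) :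
    coef n (fun z => F z * G z) =
      ∑ i ∈ Finset.range (n + 1), coef i F * coef (n - i) G := by
  unfold coef
  rw [iteratedDeriv_fun_mul hF.contDiffAt hG.contDiffAt, Finset.sum_div]
  refine Finset.sum_congr rfl fun i hi => ?_
  have hi' : i ≤ n := Nat.lt_succ_iff.1 (Finset.mem_range.1 hi)
  rw [Nat.cast_choose ℂ hi']
  have h1 : (n.factorial : ℂ) ≠ 0 := by exact_mod_cast n.factorial_ne_zero
  have h2 : (i.factorial : ℂ) ≠ 0 := by exact_mod_cast i.factorial_ne_zero
  have h3 : ((n - i).factorial : ℂ) ≠ 0 := by exact_mod_cast (n - i).factorial_ne_zero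
  field_simp

lemma coef_congr {F G : ℂ → ℂ} (h : F =ᶠ[𝓝 0] G) (n : ℕ) : coef n F = coef n G := by
  unfold coef
  rw [h.iteratedDeriv_eq]

lemma coef_deriv (F : ℂ → ℂ) (n : ℕ) : coef n (deriv F) = (n + 1) * coef (n + 1) F := by
  unfold coef
  rw [iteratedDeriv_succ', Nat.factorial_succ]
  have h1 : (n.factorial : ℂ) ≠ 0 := by exact_mod_cast n.factorial_ne_zero
  have h2 : (n : ℂ) + 1 ≠ 0 := by exact_mod_cast n.succ_ne_zero
  push_cast
  field_simp

lemma coef_id_mul {F : ℂ → ℂ} (hF : AnalyticAt ℂ F 0) (n : ℕ) :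
    coef (n + 1) (fun z => z * F z) = coef n F := by
  rw [coef_mul (F := fun z => z) analyticAt_id hF, Finset.sum_eq_single 1]
  · simp [coef]
  · intro i _ hi
    have : iteratedDeriv i (fun z : ℂ => z) 0 = 0 := by
      have := iteratedDeriv_fun_pow_zero (𝕜 := ℂ) (n := i) (m := 1)
      simpa [hi, hi.symm] using this
    simp [coef, this]
  · simp

theorem norm_coef_le {f L : ℂ → ℂ} (hL : AnalyticAt ℂ L 0) (hL0 : L 0 = 0)
    (hfL : ∀ᶠ z in 𝓝 0, f z = z * Complex.exp (L z)) (N : ℕ)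
    (hmilin : milin N 1 (fun k => coef k L) ≤ 0) : ‖coef (N + 1) f‖ ≤ N + 1 := by
  set b : ℂ → ℂ := fun z => Complex.exp (L z / 2) with hb
  have hba : AnalyticAt ℂ b 0 := (hL.div_const).cexp
  have hfb : f =ᶠ[𝓝 0] fun z => z * (b z * b z) := by
    filter_upwards [hfL] with z hz
    rw [hz, hb]
    simp only
    rw [← Complex.exp_add, add_halves]
  have hrec : deriv b =ᶠ[𝓝 0] fun z => (1 / 2 * deriv L z) * b z := by
    filter_upwards [hL.eventually_analyticAt] with z hz
    have := (hz.differentiableAt.hasDerivAt.div_const 2).cexp.deriv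
    rw [this]
    ring
  have h1 : coef (N + 1) f = ∑ i ∈ Finset.range (N + 1), coef i b * coef (N - i) b := by
    rw [coef_congr hfb, coef_id_mul (F := fun z => b z * b z) (hba.mul hba), coef_mul hba hba]
  have h2 : ‖coef (N + 1) f‖ ≤ ∑ i ∈ Finset.range (N + 1), ‖coef i b‖ ^ 2 := by
    rw [h1]
    have h3 := Finset.sum_range_reflect (fun i => ‖coef i b‖ ^ 2) (N + 1)
    simp only [Nat.add_sub_cancel] at h3
    have h4 : ∑ i ∈ Finset.range (N + 1), ‖coef i b * coef (N - i) b‖ ≤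
        ∑ i ∈ Finset.range (N + 1), (‖coef i b‖ ^ 2 + ‖coef (N - i) b‖ ^ 2) / 2 := by
      refine Finset.sum_le_sum fun i _ => ?_
      rw [norm_mul]
      nlinarith [sq_nonneg (‖coef i b‖ - ‖coef (N - i) b‖)]
    rw [← Finset.sum_div, Finset.sum_add_distrib, h3] at h4
    linarith [norm_sum_le (Finset.range (N + 1)) fun i => coef i b * coef (N - i) b]
  have h3 := lebedev_milin (β := fun k => coef k b) (γ := fun k => 1 / 2 * coef k L)
    (by simp [coef, hb, hL0]) (fun k => by
      rw [← coef_deriv, coef_congr hrec, coef_mul (F := fun z => 1 / 2 * deriv L z)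
        (analyticAt_const.mul hL.deriv) hba]
      refine Finset.sum_congr rfl fun i _ => ?_
      have h4 : coef i (fun z => 1 / 2 * deriv L z) = 1 / 2 * coef i (deriv L) := by
        simp only [coef, iteratedDeriv_const_mul_field, mul_div_assoc]
      rw [h4, coef_deriv]
      ring) N
  have h4 : (∑ k ∈ Finset.range N, (((k : ℝ) + 1) * ‖1 / 2 * coef (k + 1) L‖ ^ 2
      - 1 / (k + 1)) * ((N : ℝ) - k)) = milin N 1 (fun k => coef k L) / 4 := by
    rw [milin, Finset.sum_div]
    refine Finset.sum_congr rfl fun k hk => ?_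
    rw [weight_one N (k + 1) (by omega) (by simp at hk; omega), norm_mul]
    norm_num
    ring
  rw [h4] at h3
  have h5 : Real.exp (milin N 1 (fun k => coef k L) / 4 / (N + 1)) ≤ 1 := by
    rw [Real.exp_le_one_iff]
    exact div_nonpos_of_nonpos_of_nonneg (by linarith) (by positivity)
  have h6 : (0 : ℝ) ≤ (N : ℝ) + 1 := by positivity
  nlinarith

lemma exists_log_quotient {f : ℂ → ℂ} (hf : DifferentiableOn ℂ f (ball (0 : ℂ) 1))
    (hinj : Set.InjOn f (ball (0 : ℂ) 1)) (hf0 : f 0 = 0) (hf1 : deriv f 0 = 1) :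
    ∃ L : ℂ → ℂ, AnalyticAt ℂ L 0 ∧ L 0 = 0 ∧ ∀ᶠ z in 𝓝 0, f z = z * Complex.exp (L z) := by
  have h0 : (0 : ℂ) ∈ ball (0 : ℂ) 1 := by simp
  have hfz : ∀ z, f z = z * dslope f 0 z := by
    intro z
    have := sub_smul_dslope f 0 z
    rw [hf0, sub_zero, sub_zero, smul_eq_mul] at this
    exact this.symm
  have hφ0 : dslope f 0 0 = 1 := by rw [dslope_same, hf1]
  obtain ⟨L, hLd, hL0, hL⟩ := exists_log_ball one_pos
    ((Complex.differentiableOn_dslope (isOpen_ball.mem_nhds h0)).2 hf) (fun z hz hφ => by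
      have h1 : f z = f 0 := by rw [hfz z, hφ, mul_zero, hf0]
      rw [hinj hz h0 h1, hφ0] at hφ
      exact one_ne_zero hφ) 0 (by rw [Complex.exp_zero, hφ0])
  refine ⟨L, (hLd.analyticOnNhd isOpen_ball) 0 h0, hL0, ?_⟩
  filter_upwards [isOpen_ball.mem_nhds h0] with z hz
  rw [hL z hz, ← hfz]

end DeBranges

/-- **The Bieberbach conjecture / de Branges' theorem.** For `f` in the class `S` with
Taylor coefficients `a n = f⁽ⁿ⁾(0)/n!`, we have `|a n| ≤ n` for all `n ≥ 2`. -/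
theorem bieberbach_conjecture (f : ℂ → ℂ)
    (hf : DifferentiableOn ℂ f (ball (0 : ℂ) 1))
    (hinj : Set.InjOn f (ball (0 : ℂ) 1))
    (hf0 : f 0 = 0) (hf1 : deriv f 0 = 1)
    (a : ℕ → ℂ) (ha : ∀ n, a n = iteratedDeriv n f 0 / (n.factorial : ℂ)) :
    ∀ n : ℕ, 2 ≤ n → ‖a n‖ ≤ (n : ℝ) := by
  intro n hn
  obtain ⟨N, rfl⟩ : ∃ N, n = N + 1 := ⟨n - 1, by omega⟩
  obtain ⟨L, hL, hL0, hfL⟩ := DeBranges.exists_log_quotient hf hinj hf0 hf1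
  rw [ha]
  exact_mod_cast DeBranges.norm_coef_le hL hL0 hfL N
    (DeBranges.milin_nonpos hf hinj hf0 hf1 hL hL0 hfL N)
end

section
/- Let 0 ≤ s ≤ t be real numbers. Let F be analytic and injective on the open unit disc 𝔻 with F(0) = 0 and F'(0) = e^t (so e^{−t}F belongs to the class S), and let φ be analytic on 𝔻 with φ(0) = 0, |φ(z)| ≤ |z| for all z ∈ 𝔻, and φ'(0) = e^{s−t}. Then for every z ∈ 𝔻, |F(z) − F(φ(z))| ≤ 8|z| · (e^t − e^s)/(1−|z|)⁴. -/
open Metric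
open MeasureTheory Set Filter Topology

/-- The open annulus centred at the origin with the given inner and outer radii. -/
def annulus (a b : ℝ) : Set ℂ := {z | a < ‖z‖ ∧ ‖z‖ < b}

lemma isOpen_annulus (a b : ℝ) : IsOpen (annulus a b) :=
  (isOpen_lt continuous_const continuous_norm).inter (isOpen_lt continuous_norm continuous_const)

lemma isCompact_closedAnnulus (a b : ℝ) : IsCompact {z : ℂ | a ≤ ‖z‖ ∧ ‖z‖ ≤ b} := by
  refine (isCompact_closedBall (0 : ℂ) b).of_isClosed_subset ?_ fun z hz ↦ by simpa using hz.2
  exact (isClosed_le continuous_const continuous_norm).inter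
    (isClosed_le continuous_norm continuous_const)

lemma annulus_subset (a b : ℝ) : annulus a b ⊆ {z : ℂ | a ≤ ‖z‖ ∧ ‖z‖ ≤ b} :=
  fun _ hz ↦ ⟨hz.1.le, hz.2.le⟩

lemma det_restrictScalars_toSpanSingleton (c : ℂ) :
    ((ContinuousLinearMap.toSpanSingleton ℂ c).restrictScalars ℝ).det = ‖c‖ ^ 2 := by
  rw [ContinuousLinearMap.det, ← Complex.normSq_eq_norm_sq,
    ← LinearMap.det_toMatrix Complex.basisOneI, Matrix.det_fin_two]
  simp [LinearMap.toMatrix_apply, Complex.normSq_apply]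

/-- The area of the image of an injective holomorphic map. -/
lemma lintegral_norm_deriv_sq_eq_volume_image {A : Set ℂ} (hA : IsOpen A) {G G' : ℂ → ℂ}
    (hG : ∀ z ∈ A, HasDerivAt G (G' z) z) (hinj : InjOn G A) :
    ∫⁻ z in A, ENNReal.ofReal (‖G' z‖ ^ 2) = volume (G '' A) := by
  rw [← lintegral_abs_det_fderiv_eq_addHaar_image volume hA.measurableSet
    (f' := fun z ↦ (ContinuousLinearMap.toSpanSingleton ℂ (G' z)).restrictScalars ℝ)
    (fun z hz ↦ ((hG z hz).hasFDerivAt.restrictScalars ℝ).hasFDerivWithinAt) hinj]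
  simp [det_restrictScalars_toSpanSingleton]

/-- The real-linear map `w ↦ w - c * conj w`. -/
def antilinearPerturbation (c : ℂ) : ℂ →ₗ[ℝ] ℂ where
  toFun w := w - c * (starRingEnd ℂ) w
  map_add' x y := by simp; ring
  map_smul' r x := by simp; ring

lemma det_antilinearPerturbation (c : ℂ) :
    LinearMap.det (antilinearPerturbation c) = 1 - ‖c‖ ^ 2 := by
  rw [← Complex.normSq_eq_norm_sq, ← LinearMap.det_toMatrix Complex.basisOneI, Matrix.det_fin_two]
  simp [LinearMap.toMatrix_apply, Complex.normSq_apply, antilinearPerturbation]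
  ring

/-- The area of the filled ellipse `{w | ‖w - c * conj w‖ ≤ R}`. -/
lemma volume_preimage_antilinearPerturbation {c : ℂ} (hc : ‖c‖ < 1) {R : ℝ} (hR : 0 ≤ R) :
    volume (antilinearPerturbation c ⁻¹' closedBall 0 R)
      = ENNReal.ofReal (Real.pi * R ^ 2 / (1 - ‖c‖ ^ 2)) := by
  have h : 0 < 1 - ‖c‖ ^ 2 := by nlinarith [norm_nonneg c]
  rw [Measure.addHaar_preimage_linearMap volume (by rw [det_antilinearPerturbation]; exact h.ne'),
    det_antilinearPerturbation, abs_of_pos (inv_pos.2 h), Complex.volume_closedBall,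
    ← ENNReal.ofReal_pow hR, show (NNReal.pi : ENNReal) = ENNReal.ofReal Real.pi from
      (ENNReal.ofReal_coe_nnreal (p := NNReal.pi)).symm,
    ← ENNReal.ofReal_mul (by positivity), ← ENNReal.ofReal_mul (by positivity)]
  congr 1
  field_simp

lemma setIntegral_annulus {a b : ℝ} (ha : 0 < a) {ψ : ℂ → ℝ}
    (hψ : ContinuousOn ψ {z : ℂ | a ≤ ‖z‖ ∧ ‖z‖ ≤ b}) :
    ∫ z in annulus a b, ψ z
      = ∫ r in Ioo a b, r * (2 * Real.pi * Real.circleAverage ψ 0 r) := by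
  have hcirc : ∀ p : ℝ × ℝ, (Complex.polarCoord.symm p : ℂ) = circleMap 0 p.1 p.2 := fun p ↦ by
    simp [Complex.polarCoord_symm_apply, circleMap, Complex.exp_mul_I]
  rw [← integral_indicator (isOpen_annulus a b).measurableSet,
    ← Complex.integral_comp_polarCoord_symm]
  have htar : polarCoord.target = Ioi 0 ×ˢ Ioo (-Real.pi) Real.pi := rfl
  have hsub : Ioo a b ×ˢ Ioo (-Real.pi) Real.pi ⊆ polarCoord.target := by
    rw [htar]; exact prod_mono (fun r hr ↦ ha.trans hr.1) subset_rfl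
  have hmeas : MeasurableSet (Ioo a b ×ˢ Ioo (-Real.pi) Real.pi) :=
    measurableSet_Ioo.prod measurableSet_Ioo
  have key : ∀ p ∈ polarCoord.target,
      p.1 • (annulus a b).indicator ψ (Complex.polarCoord.symm p)
        = (Ioo a b ×ˢ Ioo (-Real.pi) Real.pi).indicator
          (fun p ↦ p.1 * ψ (circleMap 0 p.1 p.2)) p := by
    intro p hp
    rw [htar] at hp
    have h1 : (circleMap 0 p.1 p.2 ∈ annulus a b) ↔
        p ∈ Ioo a b ×ˢ Ioo (-Real.pi) Real.pi := by
      simp only [annulus, mem_ofPred_eq, mem_prod, hp.2, and_true, mem_Ioo]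
      simp [abs_of_pos (show 0 < p.1 from hp.1)]
    rw [hcirc]
    by_cases h : p ∈ Ioo a b ×ˢ Ioo (-Real.pi) Real.pi
    · rw [indicator_of_mem h, indicator_of_mem (h1.2 h), smul_eq_mul]
    · rw [indicator_of_notMem h, indicator_of_notMem (fun h' ↦ h (h1.1 h')), smul_zero]
  rw [setIntegral_congr_fun (polarCoord.open_target.measurableSet) key,
    setIntegral_indicator hmeas, inter_eq_self_of_subset_right hsub]
  have hcont : ContinuousOn (fun p : ℝ × ℝ ↦ p.1 * ψ (circleMap 0 p.1 p.2))
      (Icc a b ×ˢ Icc (-Real.pi) Real.pi) := by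
    refine continuousOn_fst.mul (hψ.comp ?_ ?_)
    · simp only [circleMap]; fun_prop
    · intro p hp
      have : 0 < p.1 := ha.trans_le hp.1.1
      simpa [abs_of_pos this] using hp.1
  have hint : IntegrableOn (fun p : ℝ × ℝ ↦ p.1 * ψ (circleMap 0 p.1 p.2))
      (Ioo a b ×ˢ Ioo (-Real.pi) Real.pi) (volume.prod volume) :=
    (hcont.integrableOn_compact (isCompact_Icc.prod isCompact_Icc)).mono_set
      (prod_mono Ioo_subset_Icc_self Ioo_subset_Icc_self)
  rw [Measure.volume_eq_prod, setIntegral_prod _ hint]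
  refine setIntegral_congr_fun measurableSet_Ioo fun r hr ↦ ?_
  simp only
  rw [integral_const_mul, Real.circleAverage_eq_integral_add (-Real.pi), smul_eq_mul,
    mul_inv_cancel_left₀ Real.two_pi_pos.ne', ← integral_Ioc_eq_integral_Ioo,
    ← intervalIntegral.integral_of_le (by linarith [Real.pi_pos])]
  congr 1
  rw [intervalIntegral.integral_comp_add_right (fun θ ↦ ψ (circleMap 0 r θ))]
  congr 1 <;> ring

/-- A lower bound for `‖-(z ^ 2)⁻¹ + k z‖ ^ 2` which is linear in the holomorphic function `k`. -/
noncomputable def annulusMinorant (k : ℂ → ℂ) (z : ℂ) : ℝ :=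
  (‖z‖ ^ 4)⁻¹ - ‖k 0‖ ^ 2
    + ((2 * (starRingEnd ℂ) (k 0) - 2 * z ^ 2 * ((‖z‖ ^ 4)⁻¹ : ℝ)) * k z).re

lemma annulusMinorant_le (k : ℂ → ℂ) {z : ℂ} (hz : z ≠ 0) :
    annulusMinorant k z ≤ ‖-(z ^ 2)⁻¹ + k z‖ ^ 2 := by
  have hconj : z ^ 2 * ((‖z‖ ^ 4)⁻¹ : ℝ) = (starRingEnd ℂ) ((z ^ 2)⁻¹) := by
    have h0 : (‖z‖ : ℂ) ≠ 0 := by simpa using hz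
    have h1 : (starRingEnd ℂ) z ≠ 0 := by simpa using hz
    have h2 : (‖z‖ : ℂ) ^ 4 = z ^ 2 * (starRingEnd ℂ) z ^ 2 := by
      rw [← mul_pow, Complex.mul_conj']; ring
    push_cast
    rw [h2, map_inv₀, map_pow]
    field_simp
  have hn : (‖z‖ ^ 4)⁻¹ = ‖(z ^ 2)⁻¹‖ ^ 2 := by
    rw [norm_inv, norm_pow, inv_pow, ← pow_mul]
  rw [annulusMinorant, mul_assoc 2, hconj, hn]
  generalize (z ^ 2)⁻¹ = u
  generalize k z = v
  generalize k 0 = b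
  have := sq_nonneg (v.re - b.re)
  have := sq_nonneg (v.im - b.im)
  simp only [← Complex.normSq_eq_norm_sq, Complex.normSq_apply, Complex.add_re, Complex.add_im,
    Complex.neg_re, Complex.neg_im, Complex.mul_re, Complex.sub_re, Complex.sub_im, Complex.mul_im,
    Complex.conj_re, Complex.conj_im, Complex.re_ofNat, Complex.im_ofNat]
  linarith

lemma circleAverage_annulusMinorant {k : ℂ → ℂ} (hk : DifferentiableOn ℂ k (ball 0 1)) {r : ℝ}
    (hr0 : 0 < r) (hr1 : r < 1) :
    Real.circleAverage (annulusMinorant k) 0 r = (r ^ 4)⁻¹ + ‖k 0‖ ^ 2 := by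
  set H : ℂ → ℂ := fun z ↦ (((r ^ 4)⁻¹ - ‖k 0‖ ^ 2 : ℝ) : ℂ)
    + (2 * (starRingEnd ℂ) (k 0) - 2 * z ^ 2 * ((r ^ 4)⁻¹ : ℝ)) * k z with hH
  have hHd : DifferentiableOn ℂ H (closedBall 0 |r|) := by
    have : DifferentiableOn ℂ k (closedBall 0 |r|) :=
      hk.mono (closedBall_subset_ball (by rwa [abs_of_pos hr0]))
    fun_prop
  have h1 : Real.circleAverage (annulusMinorant k) 0 r
      = Real.circleAverage (Complex.reCLM ∘ H) 0 r := by
    refine Real.circleAverage_congr_sphere fun z hz ↦ ?_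
    have : ‖z‖ = r := by simpa [abs_of_pos hr0] using hz
    simp only [annulusMinorant, hH, this, Function.comp_apply, Complex.reCLM_apply, Complex.add_re,
      Complex.ofReal_re]
  rw [h1, ContinuousLinearMap.circleAverage_comp_comm _
    ((hHd.continuousOn.mono sphere_subset_closedBall).circleIntegrable'),
    DiffContOnCl.circleAverage (hHd.diffContOnCl_ball subset_rfl)]
  simp only [hH, Complex.reCLM_apply]
  have : 2 * (starRingEnd ℂ) (k 0) * k 0 = ((2 * ‖k 0‖ ^ 2 : ℝ) : ℂ) := by
    rw [mul_assoc, mul_comm _ (k 0), Complex.mul_conj']; push_cast; ring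
  rw [show (2 * (starRingEnd ℂ) (k 0) - 2 * (0 : ℂ) ^ 2 * ((r ^ 4)⁻¹ : ℝ)) * k 0
    = ((2 * ‖k 0‖ ^ 2 : ℝ) : ℂ) by rw [← this]; ring, Complex.add_re, Complex.ofReal_re,
    Complex.ofReal_re]
  ring

lemma le_lintegral_annulus {k : ℂ → ℂ} (hk : DifferentiableOn ℂ k (ball 0 1)) {a b : ℝ}
    (ha : 0 < a) (hab : a < b) (hb : b < 1) :
    ENNReal.ofReal (Real.pi * ((a ^ 2)⁻¹ - (b ^ 2)⁻¹ + ‖k 0‖ ^ 2 * (b ^ 2 - a ^ 2)))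
      ≤ ∫⁻ z in annulus a b, ENNReal.ofReal (‖-(z ^ 2)⁻¹ + k z‖ ^ 2) := by
  set K : Set ℂ := {z : ℂ | a ≤ ‖z‖ ∧ ‖z‖ ≤ b} with hK
  have hne : ∀ z ∈ K, ‖z‖ ≠ 0 := fun z hz ↦ (ha.trans_le hz.1).ne'
  have hkK : ContinuousOn k K := hk.continuousOn.mono fun z hz ↦ by
    simpa using hz.2.trans_lt hb
  have hcont : ContinuousOn (annulusMinorant k) K := by
    unfold annulusMinorant
    have h4 : ContinuousOn (fun z : ℂ ↦ (‖z‖ ^ 4)⁻¹) K :=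
      ContinuousOn.inv₀ (by fun_prop) fun z hz ↦ pow_ne_zero _ (hne z hz)
    have h5 : ContinuousOn (fun z : ℂ ↦ (((‖z‖ ^ 4)⁻¹ : ℝ) : ℂ)) K :=
      Complex.continuous_ofReal.comp_continuousOn h4
    refine (h4.sub continuousOn_const).add (Complex.continuous_re.comp_continuousOn ?_)
    fun_prop
  have hcont' : ContinuousOn (fun z ↦ ‖-(z ^ 2)⁻¹ + k z‖ ^ 2) K := by
    have h4 : ContinuousOn (fun z : ℂ ↦ (z ^ 2)⁻¹) K :=
      ContinuousOn.inv₀ (by fun_prop) fun z hz ↦ pow_ne_zero _ (norm_ne_zero_iff.1 (hne z hz))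
    fun_prop
  have hint := (hcont.integrableOn_compact (μ := volume) (isCompact_closedAnnulus a b)).mono_set
    (annulus_subset a b)
  have hint' := (hcont'.integrableOn_compact (μ := volume) (isCompact_closedAnnulus a b)).mono_set
    (annulus_subset a b)
  rw [← ofReal_integral_eq_lintegral_ofReal hint' (ae_of_all _ fun z ↦ by positivity)]
  refine ENNReal.ofReal_le_ofReal ?_
  refine le_trans (le_of_eq ?_) (setIntegral_mono_on hint hint' (isOpen_annulus a b).measurableSet
    fun z hz ↦ annulusMinorant_le k (norm_ne_zero_iff.1 (hne z (annulus_subset a b hz))))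
  rw [setIntegral_annulus ha hcont]
  have h1 : ∫ r in Ioo a b, r * (2 * Real.pi * Real.circleAverage (annulusMinorant k) 0 r)
      = ∫ r in a..b, 2 * Real.pi * ((r ^ 3)⁻¹ + r * ‖k 0‖ ^ 2) := by
    rw [intervalIntegral.integral_of_le hab.le, integral_Ioc_eq_integral_Ioo]
    refine setIntegral_congr_fun measurableSet_Ioo fun r hr ↦ ?_
    have hr0 : 0 < r := ha.trans hr.1
    rw [circleAverage_annulusMinorant hk hr0 (hr.2.trans hb)]
    field_simp
  rw [h1, intervalIntegral.integral_eq_sub_of_hasDerivAt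
    (f := fun r ↦ Real.pi * (‖k 0‖ ^ 2 * r ^ 2 - (r ^ 2)⁻¹))]
  · ring
  · intro r hr
    rw [uIcc_of_le hab.le] at hr
    have hr0 : r ≠ 0 := (ha.trans_le hr.1).ne'
    convert! (((hasDerivAt_pow 2 r).const_mul (‖k 0‖ ^ 2)).sub
      ((hasDerivAt_pow 2 r).inv (pow_ne_zero 2 hr0))).const_mul Real.pi using 1
    field_simp
    ring
  · refine ContinuousOn.intervalIntegrable fun r hr ↦ ?_
    rw [uIcc_of_le hab.le] at hr
    have hr0 : r ≠ 0 := (ha.trans_le hr.1).ne'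
    have : ContinuousAt (fun r : ℝ ↦ (r ^ 3)⁻¹) r :=
      ContinuousAt.inv₀ (by fun_prop) (pow_ne_zero 3 hr0)
    exact ContinuousAt.continuousWithinAt (by fun_prop)

/-- A maximum principle for `w ↦ w - c * conj w` composed with a holomorphic map. -/
lemma norm_sub_mul_conj_le_of_forall_mem_frontier {U : Set ℂ} (hU : Bornology.IsBounded U)
    {G : ℂ → ℂ} (hG : DiffContOnCl ℂ G U) {c : ℂ} {R : ℝ} (hR : 0 ≤ R)
    (h : ∀ z ∈ frontier U, ‖G z - c * (starRingEnd ℂ) (G z)‖ ≤ R) {z : ℂ} (hz : z ∈ closure U) :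
    ‖G z - c * (starRingEnd ℂ) (G z)‖ ≤ R := by
  set w := G z - c * (starRingEnd ℂ) (G z) with hw
  rcases eq_or_ne w 0 with h0 | h0
  · simpa [h0] using hR
  set κ := (starRingEnd ℂ) w - w * (starRingEnd ℂ) c with hκ
  have hre : ∀ x, (κ * G x).re = ((starRingEnd ℂ) w * (G x - c * (starRingEnd ℂ) (G x))).re := by
    intro x
    simp [hκ, Complex.mul_re, Complex.mul_im, -Complex.sub_re]
    simp only [Complex.sub_re, Complex.mul_re, Complex.conj_re, Complex.conj_im]
    ring
  have hd : DiffContOnCl ℂ (fun x ↦ Complex.exp (κ * G x)) U :=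
    Complex.differentiable_exp.comp_diffContOnCl (hG.const_smul κ)
  have := Complex.norm_le_of_forall_mem_frontier_norm_le hU hd (C := Real.exp (‖w‖ * R))
    (fun x hx ↦ by
      rw [Complex.norm_exp, Real.exp_le_exp, hre]
      refine (Complex.re_le_norm _).trans ?_
      rw [norm_mul, Complex.norm_conj]
      exact mul_le_mul_of_nonneg_left (h x hx) (norm_nonneg _)) hz
  rw [Complex.norm_exp, Real.exp_le_exp, hre, ← hw, mul_comm, Complex.mul_conj',
    ← Complex.ofReal_pow, Complex.ofReal_re, sq] at this
  exact le_of_mul_le_mul_left this (norm_pos_iff.2 h0)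

lemma closure_annulus_subset (a b : ℝ) : closure (annulus a b) ⊆ {z : ℂ | a ≤ ‖z‖ ∧ ‖z‖ ≤ b} :=
  (isCompact_closedAnnulus a b).isClosed.closure_subset_iff.2 (annulus_subset a b)

lemma norm_eq_or_of_mem_frontier_annulus {a b : ℝ} {z : ℂ} (hz : z ∈ frontier (annulus a b)) :
    ‖z‖ = a ∨ ‖z‖ = b := by
  rw [(isOpen_annulus a b).frontier_eq] at hz
  obtain ⟨h1, h2⟩ := closure_annulus_subset a b hz.1
  by_contra! h
  exact hz.2 ⟨lt_of_le_of_ne h1 (Ne.symm h.1), lt_of_le_of_ne h2 h.2⟩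

/-- The area inequality on a single annulus, for `G z = z⁻¹ + z * m z`. -/
lemma annulus_area_inequality {m : ℂ → ℂ} (hm : DifferentiableOn ℂ m (ball 0 1))
    (hinj : InjOn (fun z ↦ z⁻¹ + z * m z) (ball 0 1 \ {0})) {ρ M K ε : ℝ} (hρ0 : 0 < ρ)
    (hρ1 : ρ < 1) (hM : ∀ z ∈ closedBall (0 : ℂ) ρ, ‖m z‖ ≤ M)
    (hK : ∀ z ∈ closedBall (0 : ℂ) ρ, ‖m z - m 0‖ ≤ K * ‖z‖) (hK0 : 0 ≤ K) (hε : 0 < ε)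
    (hεQ : ε * ((1 + ‖m 0‖) * (ρ⁻¹ + M)) < 1) :
    (ε ^ 2)⁻¹ - (ρ ^ 2)⁻¹ + ‖m 0‖ ^ 2 * (ρ ^ 2 - ε ^ 2)
      ≤ (ε⁻¹ + (K + ‖m 0‖ * M) * ε ^ 2) ^ 2 / (1 - (‖m 0‖ * ε ^ 2) ^ 2) := by
  have hb0 := norm_nonneg (m 0)
  have hM0 : 0 ≤ M := (norm_nonneg _).trans (hM 0 (by simp [hρ0.le]))
  have hρi : 1 < ρ⁻¹ := (one_lt_inv₀ hρ0).2 hρ1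
  have hε1 : ε * (1 + ‖m 0‖) < 1 := by
    refine lt_of_le_of_lt (mul_le_mul_of_nonneg_left ?_ hε.le) hεQ
    nlinarith
  have hερ : ε < ρ := by
    have : ε * ρ⁻¹ < 1 := by
      refine lt_of_le_of_lt (mul_le_mul_of_nonneg_left ?_ hε.le) hεQ
      nlinarith [mul_nonneg hb0 hM0, mul_nonneg hb0 (by positivity : 0 ≤ ρ⁻¹)]
    rwa [← div_eq_mul_inv, div_lt_one hρ0] at this
  have hc : ‖m 0 * (ε : ℂ) ^ 2‖ = ‖m 0‖ * ε ^ 2 := by simp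
  have hc1 : ‖m 0‖ * ε ^ 2 < 1 := by nlinarith [mul_nonneg hε.le hb0]
  set R := ε⁻¹ + (K + ‖m 0‖ * M) * ε ^ 2 with hR
  have hR0 : 0 ≤ R := by positivity
  set G : ℂ → ℂ := fun z ↦ z⁻¹ + z * m z with hG
  have hpos : ∀ z : ℂ, ε ≤ ‖z‖ → z ≠ 0 := fun z hz ↦ norm_pos_iff.1 (hε.trans_le hz)
  have hder : ∀ z : ℂ, ε ≤ ‖z‖ → ‖z‖ ≤ ρ →
      HasDerivAt G (-(z ^ 2)⁻¹ + (m z + z * deriv m z)) z := by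
    intro z h1 h2
    have hmz : HasDerivAt m (deriv m z) z :=
      (hm.differentiableAt (isOpen_ball.mem_nhds (by simpa using h2.trans_lt hρ1))).hasDerivAt
    convert! (hasDerivAt_inv (hpos z h1)).add ((hasDerivAt_id z).mul hmz) using 1
    simp
  have hdiff : DiffContOnCl ℂ G (annulus ε ρ) := by
    refine DifferentiableOn.diffContOnCl fun z hz ↦ ?_
    obtain ⟨h1, h2⟩ := closure_annulus_subset _ _ hz
    exact (hder z h1 h2).differentiableAt.differentiableWithinAt
  have hbd : Bornology.IsBounded (annulus ε ρ) :=
    (isCompact_closedAnnulus ε ρ).isBounded.subset (annulus_subset _ _)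
  have hfront : ∀ z ∈ frontier (annulus ε ρ),
      ‖G z - (m 0 * (ε : ℂ) ^ 2) * (starRingEnd ℂ) (G z)‖ ≤ R := by
    intro z hz
    rcases norm_eq_or_of_mem_frontier_annulus hz with h | h
    · have hz0 : z ≠ 0 := hpos z h.ge
      have hmem : z ∈ closedBall (0 : ℂ) ρ := by simpa [h] using hερ.le
      have hcz : (ε : ℂ) ^ 2 * (starRingEnd ℂ) z⁻¹ = z := by
        have : (starRingEnd ℂ) z ≠ 0 := by simpa using hz0
        rw [← h, ← Complex.mul_conj', map_inv₀]
        field_simp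
      have : G z - (m 0 * (ε : ℂ) ^ 2) * (starRingEnd ℂ) (G z)
          = z⁻¹ + z * (m z - m 0) - m 0 * (ε : ℂ) ^ 2 * (starRingEnd ℂ) (z * m z) := by
        simp only [hG, map_add]
        linear_combination (-m 0) * hcz
      rw [this]
      refine (norm_sub_le _ _).trans ((add_le_add_left (norm_add_le _ _) _).trans ?_)
      rw [norm_mul (m 0 * _), hc, Complex.norm_conj, norm_mul, norm_mul, norm_inv, h, hR]
      have e1 : ε * ‖m z - m 0‖ ≤ ε * (K * ε) :=
        mul_le_mul_of_nonneg_left (by simpa [h] using hK z hmem) hε.le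
      have e2 : ‖m 0‖ * ε ^ 2 * (ε * ‖m z‖) ≤ ‖m 0‖ * ε ^ 2 * (1 * M) := by
        refine mul_le_mul_of_nonneg_left ?_ (by positivity)
        exact mul_le_mul (by linarith) (hM z hmem) (norm_nonneg _) zero_le_one
      nlinarith
    · have hmem : z ∈ closedBall (0 : ℂ) ρ := by simp [h]
      have hGz : ‖G z‖ ≤ ρ⁻¹ + M := by
        refine (norm_add_le _ _).trans ?_
        rw [norm_mul, norm_inv, h]
        have := mul_le_mul hρ1.le (hM z hmem) (norm_nonneg _) zero_le_one
        linarith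
      calc ‖G z - (m 0 * (ε : ℂ) ^ 2) * (starRingEnd ℂ) (G z)‖
          ≤ ‖G z‖ + ‖m 0‖ * ε ^ 2 * ‖G z‖ := by
            refine (norm_sub_le _ _).trans ?_
            rw [norm_mul (m 0 * _), hc, Complex.norm_conj]
        _ = (1 + ‖m 0‖ * ε ^ 2) * ‖G z‖ := by ring
        _ ≤ (1 + ‖m 0‖) * (ρ⁻¹ + M) := by
            refine mul_le_mul ?_ hGz (norm_nonneg _) (by positivity)
            have : ε ^ 2 ≤ 1 := pow_le_one₀ hε.le (hερ.trans hρ1).le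
            linarith [mul_le_mul_of_nonneg_left this hb0]
        _ ≤ ε⁻¹ := by
            rw [inv_eq_one_div ε, le_div_iff₀ hε, mul_comm]; exact hεQ.le
        _ ≤ R := by rw [hR]; linarith [show 0 ≤ (K + ‖m 0‖ * M) * ε ^ 2 by positivity]
  have hsub : G '' annulus ε ρ ⊆ antilinearPerturbation (m 0 * (ε : ℂ) ^ 2) ⁻¹' closedBall 0 R := by
    rintro _ ⟨z, hz, rfl⟩
    simpa [antilinearPerturbation] using
      norm_sub_mul_conj_le_of_forall_mem_frontier hbd hdiff hR0 hfront (subset_closure hz)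
  have hk : DifferentiableOn ℂ (fun z ↦ m z + z * deriv m z) (ball 0 1) :=
    hm.add (differentiableOn_id.mul (hm.deriv isOpen_ball))
  have h1 := le_lintegral_annulus hk hε hερ hρ1
  have hinj' : InjOn G (annulus ε ρ) := by
    refine hinj.mono fun z hz ↦ ?_
    exact ⟨by simpa using hz.2.trans hρ1, hpos z hz.1.le⟩
  rw [lintegral_norm_deriv_sq_eq_volume_image (isOpen_annulus ε ρ)
    (fun z hz ↦ hder z hz.1.le hz.2.le) hinj'] at h1
  have h2 := h1.trans (measure_mono hsub)
  rw [volume_preimage_antilinearPerturbation (by rwa [hc]) hR0, hc] at h2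
  have hden : 0 < 1 - (‖m 0‖ * ε ^ 2) ^ 2 := by
    nlinarith [show 0 ≤ ‖m 0‖ * ε ^ 2 by positivity]
  rw [ENNReal.ofReal_le_ofReal_iff (by positivity), mul_div_assoc] at h2
  simpa using le_of_mul_le_mul_left h2 Real.pi_pos

/-- **Area theorem**: the coefficient of `z` in an injective Laurent expansion
`z⁻¹ + m 0 * z + …` on the punctured unit disc has norm at most one. -/
theorem area_theorem {m : ℂ → ℂ} (hm : DifferentiableOn ℂ m (ball 0 1))
    (hinj : InjOn (fun z ↦ z⁻¹ + z * m z) (ball 0 1 \ {0})) : ‖m 0‖ ≤ 1 := by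
  have hρ : ∀ ρ ∈ Ioo (0 : ℝ) 1, ‖m 0‖ ^ 2 * ρ ^ 2 - (ρ ^ 2)⁻¹ ≤ 0 := by
    rintro ρ ⟨hρ0, hρ1⟩
    have hsub : closedBall (0 : ℂ) ρ ⊆ ball 0 1 := closedBall_subset_ball hρ1
    obtain ⟨M, hM⟩ := (isCompact_closedBall (0 : ℂ) ρ).exists_bound_of_continuousOn
      (hm.continuousOn.mono hsub)
    obtain ⟨K, hK⟩ := (isCompact_closedBall (0 : ℂ) ρ).exists_bound_of_continuousOn
      (((Complex.differentiableOn_dslope (ball_mem_nhds (0 : ℂ) one_pos)).2 hm).continuousOn.mono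
        hsub)
    have h0 : (0 : ℂ) ∈ closedBall (0 : ℂ) ρ := by simp [hρ0.le]
    have hK0 : 0 ≤ K := (norm_nonneg _).trans (hK 0 h0)
    have hM0 : 0 ≤ M := (norm_nonneg _).trans (hM 0 h0)
    have hK' : ∀ z ∈ closedBall (0 : ℂ) ρ, ‖m z - m 0‖ ≤ K * ‖z‖ := by
      intro z hz
      have := sub_smul_dslope m 0 z
      rw [← this, norm_smul, sub_zero, mul_comm]
      exact mul_le_mul_of_nonneg_right (hK z hz) (norm_nonneg _)
    set B := K + ‖m 0‖ * M
    have hcont : ∀ {f : ℝ → ℝ}, Continuous f → Tendsto f (𝓝[>] 0) (𝓝 (f 0)) :=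
      fun hf ↦ hf.continuousAt.tendsto.mono_left nhdsWithin_le_nhds
    have hQ : ∀ᶠ ε in 𝓝[>] (0 : ℝ), ε * ((1 + ‖m 0‖) * (ρ⁻¹ + M)) < 1 ∧ ‖m 0‖ * ε ^ 2 < 1 := by
      refine ((hcont (f := fun ε ↦ ε * ((1 + ‖m 0‖) * (ρ⁻¹ + M))) (by fun_prop)).eventually_lt_const
        (by simp)).and ((hcont (f := fun ε ↦ ‖m 0‖ * ε ^ 2) (by fun_prop)).eventually_lt_const
        (by simp))
    have key : ∀ᶠ ε in 𝓝[>] (0 : ℝ),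
        (‖m 0‖ ^ 2 * (ρ ^ 2 - ε ^ 2) - (ρ ^ 2)⁻¹) * (1 - (‖m 0‖ * ε ^ 2) ^ 2) - ‖m 0‖ ^ 2 * ε ^ 2
          ≤ 2 * B * ε + B ^ 2 * ε ^ 4 := by
      filter_upwards [hQ, self_mem_nhdsWithin] with ε hε hε0
      have hε0 : 0 < ε := hε0
      have := annulus_area_inequality hm hinj hρ0 hρ1 hM hK' hK0 hε0 hε.1
      have hden : 0 < 1 - (‖m 0‖ * ε ^ 2) ^ 2 := by
        nlinarith [show 0 ≤ ‖m 0‖ * ε ^ 2 by positivity]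
      rw [le_div_iff₀ hden] at this
      have e1 : (ε⁻¹ + B * ε ^ 2) ^ 2 = (ε ^ 2)⁻¹ + 2 * B * ε + B ^ 2 * ε ^ 4 := by
        field_simp
        ring
      have e2 : (ε ^ 2)⁻¹ * (1 - (‖m 0‖ * ε ^ 2) ^ 2) = (ε ^ 2)⁻¹ - ‖m 0‖ ^ 2 * ε ^ 2 := by
        field_simp
      rw [e1] at this
      linarith
    simpa using le_of_tendsto_of_tendsto (hcont (by fun_prop)) (hcont (by fun_prop)) key
  have hlim : Tendsto (fun ρ : ℝ ↦ ‖m 0‖ ^ 2 * ρ ^ 2 - (ρ ^ 2)⁻¹) (𝓝[<] 1)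
      (𝓝 (‖m 0‖ ^ 2 * 1 ^ 2 - (1 ^ 2)⁻¹)) := by
    refine Tendsto.mono_left (ContinuousAt.tendsto ?_) nhdsWithin_le_nhds
    have : ContinuousAt (fun ρ : ℝ ↦ (ρ ^ 2)⁻¹) 1 := ContinuousAt.inv₀ (by fun_prop) (by simp)
    fun_prop
  have := le_of_tendsto hlim (by
    filter_upwards [Ioo_mem_nhdsLT (zero_lt_one' ℝ)] with ρ h using hρ ρ h)
  nlinarith [norm_nonneg (m 0)]

/-- A zero-free holomorphic function on the unit disc taking the value one at the origin has a
holomorphic square root normalised in the same way. -/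
lemma exists_holomorphic_sqrt {u : ℂ → ℂ} (hu : DifferentiableOn ℂ u (ball 0 1))
    (hu0 : ∀ z ∈ ball (0 : ℂ) 1, u z ≠ 0) (h1 : u 0 = 1) :
    ∃ p : ℂ → ℂ, DifferentiableOn ℂ p (ball 0 1) ∧ p 0 = 1 ∧
      ∀ z ∈ ball (0 : ℂ) 1, p z ^ 2 = u z := by
  have h0 : (0 : ℂ) ∈ ball (0 : ℂ) 1 := mem_ball_self one_pos
  obtain ⟨L, hL⟩ := ((hu.deriv isOpen_ball).div hu hu0).isExactOn_ball
  have hud : ∀ z ∈ ball (0 : ℂ) 1, HasDerivAt u (deriv u z) z := fun z hz ↦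
    (hu.differentiableAt (isOpen_ball.mem_nhds hz)).hasDerivAt
  have hd : ∀ z ∈ ball (0 : ℂ) 1, HasDerivAt (fun z ↦ u z * Complex.exp (-(L z - L 0))) 0 z := by
    intro z hz
    convert! (hud z hz).mul ((hL z hz).sub_const (L 0)).neg.cexp using 1
    have := hu0 z hz
    simp only [Pi.div_apply]
    field_simp
    ring
  refine ⟨fun z ↦ Complex.exp ((L z - L 0) / 2), fun z hz ↦ ?_, by simp, fun z hz ↦ ?_⟩
  · exact ((hL z hz).sub_const _ |>.div_const 2).cexp.differentiableAt.differentiableWithinAt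
  · have := isOpen_ball.is_const_of_deriv_eq_zero (convex_ball (0 : ℂ) 1).isPreconnected
      (fun z hz ↦ (hd z hz).differentiableAt.differentiableWithinAt)
      (fun z hz ↦ (hd z hz).deriv) hz h0
    simp only [h1, sub_self, neg_zero, Complex.exp_zero, mul_one] at this
    rw [← Complex.exp_nat_mul, Nat.cast_ofNat, mul_div_cancel₀ _ two_ne_zero,
      ← mul_one (Complex.exp _), ← this, Complex.exp_neg, mul_left_comm,
      mul_inv_cancel₀ (Complex.exp_ne_zero _), mul_one]

/-- **Bieberbach's theorem** on the second coefficient of a normalised injective function. -/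
theorem norm_deriv_deriv_zero_le {f : ℂ → ℂ} (hf : DifferentiableOn ℂ f (ball 0 1))
    (hinj : InjOn f (ball 0 1)) (hf0 : f 0 = 0) (hf1 : deriv f 0 = 1) :
    ‖deriv (deriv f) 0‖ ≤ 4 := by
  have h0 : (0 : ℂ) ∈ ball (0 : ℂ) 1 := mem_ball_self one_pos
  have hnhds : ball (0 : ℂ) 1 ∈ 𝓝 0 := ball_mem_nhds _ one_pos
  set q := dslope f 0 with hq
  have hqd : DifferentiableOn ℂ q (ball 0 1) := (Complex.differentiableOn_dslope hnhds).2 hf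
  have hfq : ∀ z, f z = z * q z := fun z ↦ by
    have := sub_smul_dslope f 0 z
    rwa [hf0, sub_zero, sub_zero, smul_eq_mul, eq_comm] at this
  have hq1 : q 0 = 1 := by rw [hq, dslope_same, hf1]
  have hq0 : ∀ z ∈ ball (0 : ℂ) 1, q z ≠ 0 := by
    intro z hz h
    have : f z = f 0 := by rw [hfq z, h, mul_zero, hf0]
    rw [hinj hz h0 this, hq1] at h
    exact one_ne_zero h
  obtain ⟨p, hpd, hp1, hp⟩ := exists_holomorphic_sqrt (hqd.inv hq0)
    (fun z hz ↦ inv_ne_zero (hq0 z hz)) (by simp [hq1])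
  set k := dslope p 0 with hk
  have hkd : DifferentiableOn ℂ k (ball 0 1) := (Complex.differentiableOn_dslope hnhds).2 hpd
  have hpk : ∀ z, p z = 1 + z * k z := fun z ↦ by
    have := sub_smul_dslope p 0 z
    rw [hp1, sub_zero, smul_eq_mul] at this
    rw [hk, this]; ring
  have hsq : MapsTo (fun z : ℂ ↦ z ^ 2) (ball 0 1) (ball 0 1) := fun z hz ↦ by
    simp only [mem_ball, dist_zero_right, norm_pow] at hz ⊢
    exact pow_lt_one₀ (norm_nonneg _) hz two_ne_zero
  have hG : ∀ z ≠ 0, z⁻¹ + z * k (z ^ 2) = p (z ^ 2) / z := fun z hz ↦ by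
    rw [hpk]; field_simp
  have hGinj : InjOn (fun z ↦ z⁻¹ + z * k (z ^ 2)) (ball 0 1 \ {0}) := by
    rintro z ⟨hz, hz0⟩ w ⟨hw, hw0⟩ h
    have hz0 : z ≠ 0 := hz0
    have hw0 : w ≠ 0 := hw0
    simp only at h
    rw [hG z hz0, hG w hw0] at h
    have hfG : ∀ z ∈ ball (0 : ℂ) 1, z ≠ 0 → f (z ^ 2) = ((p (z ^ 2) / z) ^ 2)⁻¹ := by
      intro z hz hz0
      rw [div_pow, hp _ (hsq hz), hfq, Pi.inv_apply]
      field_simp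
    have h2 : z ^ 2 = w ^ 2 := hinj (hsq hz) (hsq hw) (by rw [hfG z hz hz0, hfG w hw hw0, h])
    have hpw : p (w ^ 2) ≠ 0 := fun h3 ↦ by
      have := hp _ (hsq hw)
      rw [h3, Pi.inv_apply, zero_pow two_ne_zero] at this
      exact inv_ne_zero (hq0 _ (hsq hw)) this.symm
    rw [h2, div_eq_div_iff hz0 hw0] at h
    exact (mul_left_cancel₀ hpw h).symm
  have harea := area_theorem (hkd.comp (by fun_prop) hsq) hGinj
  have hat : ∀ {g : ℂ → ℂ}, DifferentiableOn ℂ g (ball 0 1) → ∀ z ∈ ball (0 : ℂ) 1,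
      HasDerivAt g (deriv g z) z := fun hg z hz ↦
    (hg.differentiableAt (isOpen_ball.mem_nhds hz)).hasDerivAt
  have hderiv : deriv f =ᶠ[𝓝 0] fun z ↦ q z + z * deriv q z := by
    filter_upwards [hnhds] with z hz
    have : f = fun z ↦ z * q z := funext hfq
    rw [this]
    convert! ((hasDerivAt_id z).mul (hat hqd z hz)).deriv using 1
    simp
  have hf2 : deriv (deriv f) 0 = 2 * deriv q 0 := by
    rw [hderiv.deriv_eq]
    convert! ((hat hqd 0 h0).add
      ((hasDerivAt_id (0 : ℂ)).mul (hat (hqd.deriv isOpen_ball) 0 h0))).deriv using 1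
    simp
    ring
  have hpq : p ^ 2 * q =ᶠ[𝓝 0] fun _ ↦ 1 := by
    filter_upwards [hnhds] with z hz
    rw [Pi.mul_apply, Pi.pow_apply, hp z hz, Pi.inv_apply, inv_mul_cancel₀ (hq0 z hz)]
  have hpq' := hpq.deriv_eq
  rw [(((hat hpd 0 h0).pow 2).mul (hat hqd 0 h0)).deriv, deriv_const] at hpq'
  simp only [hp1, hq1, Pi.pow_apply] at hpq'
  have hk0 : k 0 = deriv p 0 := dslope_same p 0
  have : deriv (deriv f) 0 = -4 * k 0 := by
    rw [hf2, hk0]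
    linear_combination 2 * hpq'
  rw [this, norm_mul]
  simp only [Function.comp_apply, zero_pow two_ne_zero] at harea
  norm_num
  exact harea

/-- The disc automorphism form of Bieberbach's theorem. -/
lemma norm_one_sub_sq_mul_deriv_deriv_sub_le {f : ℂ → ℂ} (hf : DifferentiableOn ℂ f (ball 0 1))
    (hinj : InjOn f (ball 0 1)) {w : ℂ} (hw : ‖w‖ < 1) (hf' : deriv f w ≠ 0) :
    ‖(1 - ‖w‖ ^ 2 : ℝ) * deriv (deriv f) w - 2 * (starRingEnd ℂ) w * deriv f w‖
      ≤ 4 * ‖deriv f w‖ := by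
  have h0 : (0 : ℂ) ∈ ball (0 : ℂ) 1 := mem_ball_self one_pos
  have hnhds : ball (0 : ℂ) 1 ∈ 𝓝 0 := ball_mem_nhds _ one_pos
  set c := (starRingEnd ℂ) w with hc
  set δ : ℂ := ((1 - ‖w‖ ^ 2 : ℝ) : ℂ) with hδ
  have hwc : w * c = 1 - δ := by rw [hc, Complex.mul_conj', hδ]; push_cast; ring
  have hδ0 : δ ≠ 0 := by
    rw [hδ, Complex.ofReal_ne_zero]
    nlinarith [norm_nonneg w]
  set T : ℂ → ℂ := fun z ↦ (z + w) / (1 + c * z) with hT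
  have hden : ∀ z ∈ ball (0 : ℂ) 1, 1 + c * z ≠ 0 := by
    intro z hz h
    have hz : ‖z‖ < 1 := by simpa using hz
    have h1 : ‖c * z‖ < 1 := by
      rw [norm_mul, hc, Complex.norm_conj]
      nlinarith [norm_nonneg w, norm_nonneg z]
    rw [eq_neg_of_add_eq_zero_right h, norm_neg, norm_one] at h1
    exact lt_irrefl _ h1
  have hTmaps : MapsTo T (ball 0 1) (ball 0 1) := by
    intro z hz
    have hd := hden z hz
    have hz : ‖z‖ < 1 := by simpa using hz
    rw [mem_ball_zero_iff, hT, norm_div, div_lt_one (norm_pos_iff.2 hd)]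
    refine lt_of_pow_lt_pow_left₀ 2 (norm_nonneg _) ?_
    have hz2 : Complex.normSq z < 1 := by
      rw [Complex.normSq_eq_norm_sq]; nlinarith [norm_nonneg z]
    have hw2 : Complex.normSq w < 1 := by
      rw [Complex.normSq_eq_norm_sq]; nlinarith [norm_nonneg w]
    have := mul_pos (sub_pos.2 hz2) (sub_pos.2 hw2)
    simp only [← Complex.normSq_eq_norm_sq, Complex.normSq_apply, hc, Complex.add_re,
      Complex.add_im, Complex.mul_re, Complex.mul_im, Complex.conj_re, Complex.conj_im,
      Complex.one_re, Complex.one_im] at this ⊢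
    linarith
  have hTinj : InjOn T (ball 0 1) := by
    intro x hx y hy h
    have hx' := hden x hx
    have hy' := hden y hy
    simp only [hT] at h
    rw [div_eq_div_iff hx' hy'] at h
    have : δ * (x - y) = 0 := by linear_combination h + (x - y) * hwc
    exact sub_eq_zero.1 ((mul_eq_zero.1 this).resolve_left hδ0)
  have hTd : ∀ z ∈ ball (0 : ℂ) 1, HasDerivAt T (δ / (1 + c * z) ^ 2) z := by
    intro z hz
    convert! ((hasDerivAt_id z).add_const w).div
      (((hasDerivAt_id z).const_mul c).const_add 1) (hden z hz) using 1
    congr 1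
    simp only [id]
    linear_combination hwc
  have hat : ∀ {g : ℂ → ℂ}, DifferentiableOn ℂ g (ball 0 1) → ∀ z ∈ ball (0 : ℂ) 1,
      HasDerivAt g (deriv g z) z := fun hg z hz ↦
    (hg.differentiableAt (isOpen_ball.mem_nhds hz)).hasDerivAt
  have hT0 : T 0 = w := by simp [hT]
  set g : ℂ → ℂ := fun z ↦ (f (T z) - f w) / (δ * deriv f w) with hg
  have hgd : ∀ z ∈ ball (0 : ℂ) 1,
      HasDerivAt g (deriv f (T z) * (δ / (1 + c * z) ^ 2) / (δ * deriv f w)) z := fun z hz ↦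
    ((((hat hf _ (hTmaps hz)).comp z (hTd z hz)).sub_const _).div_const _)
  have hg1 : deriv g 0 = 1 := by
    rw [(hgd 0 h0).deriv, hT0]
    field_simp
    simp
  have hginj : InjOn g (ball 0 1) := by
    intro x hx y hy h
    simp only [hg] at h
    rw [div_left_inj' (mul_ne_zero hδ0 hf'), sub_left_inj] at h
    exact hTinj hx hy (hinj (hTmaps hx) (hTmaps hy) h)
  have hB := norm_deriv_deriv_zero_le
    (fun z hz ↦ (hgd z hz).differentiableAt.differentiableWithinAt) hginj (by simp [hg, hT0]) hg1
  have hderiv : deriv g =ᶠ[𝓝 0]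
      fun z ↦ deriv f (T z) * (δ / (1 + c * z) ^ 2) / (δ * deriv f w) := by
    filter_upwards [hnhds] with z hz using (hgd z hz).deriv
  have hinv : HasDerivAt (fun z : ℂ ↦ δ / (1 + c * z) ^ 2) (-2 * c * δ) 0 := by
    convert! (hasDerivAt_const (0 : ℂ) δ).div
      ((((hasDerivAt_id (0 : ℂ)).const_mul c).const_add 1).pow 2) (by simp) using 1
    simp
    ring
  have hcomp : HasDerivAt (fun z ↦ deriv f (T z)) (deriv (deriv f) w * δ) 0 := by
    have h1 := hat (hf.deriv isOpen_ball) (T 0) (hTmaps h0)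
    convert! h1.comp 0 (hTd 0 h0) using 1
    simp [hT0]
  have h2 : deriv (deriv g) 0 = (δ * deriv (deriv f) w - 2 * c * deriv f w) / deriv f w := by
    rw [hderiv.deriv_eq]
    refine HasDerivAt.deriv ?_
    convert! (hcomp.mul hinv).div_const (δ * deriv f w) using 1
    simp only [hT0, mul_zero, add_zero, one_pow, div_one]
    field_simp
    ring
  rwa [h2, norm_div, div_le_iff₀ (norm_pos_iff.2 hf')] at hB

/-- The upper bound in the **Koebe distortion theorem**. -/
theorem norm_deriv_mul_one_sub_pow_le {f : ℂ → ℂ} (hf : DifferentiableOn ℂ f (ball 0 1))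
    (hinj : InjOn f (ball 0 1)) {z : ℂ} (hz : ‖z‖ < 1) :
    ‖deriv f z‖ * (1 - ‖z‖) ^ 3 ≤ (1 + ‖z‖) * ‖deriv f 0‖ := by
  obtain ⟨u, hu, hzu⟩ : ∃ u : ℂ, ‖u‖ = 1 ∧ z = (‖z‖ : ℂ) * u := by
    rcases eq_or_ne z 0 with rfl | h
    · exact ⟨1, by simp, by simp⟩
    · have : (‖z‖ : ℂ) ≠ 0 := by simpa using h
      exact ⟨z / ‖z‖, by simp [h], by field_simp⟩
  have hnorm : ∀ r ∈ Ico (0 : ℝ) 1, ‖(r : ℂ) * u‖ = r := fun r hr ↦ by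
    simp [hu, abs_of_nonneg hr.1]
  set N : ℝ → ℝ := fun r ↦ ‖deriv f (r * u)‖ ^ 2 with hN
  set N' : ℝ → ℝ := fun r ↦ 2 * inner ℝ (deriv f (r * u)) (deriv (deriv f) (r * u) * u) with hN'
  have hNd : ∀ r ∈ Ico (0 : ℝ) 1, HasDerivAt N (N' r) r := by
    intro r hr
    have h1 : HasDerivAt (deriv f) (deriv (deriv f) (r * u)) (r * u) :=
      ((hf.deriv isOpen_ball).differentiableAt
        (isOpen_ball.mem_nhds (by rw [mem_ball_zero_iff, hnorm r hr]; exact hr.2))).hasDerivAt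
    have h2 : HasDerivAt (fun x : ℂ ↦ x * u) u (r : ℂ) := by
      simpa using (hasDerivAt_id (r : ℂ)).mul_const u
    exact (h1.comp (r : ℂ) h2).comp_ofReal.norm_sq
  have hbound : ∀ r ∈ Ico (0 : ℝ) 1, N' r * (1 - r ^ 2) ≤ N r * (8 + 4 * r) := by
    intro r hr
    simp only [hN, hN']
    by_cases h : deriv f (r * u) = 0
    · simp [h]
    have hB := norm_one_sub_sq_mul_deriv_deriv_sub_le hf hinj
      (by rw [hnorm r hr]; exact hr.2) h
    rw [hnorm r hr, map_mul, Complex.conj_ofReal] at hB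
    generalize deriv (deriv f) (r * u) = b at hB ⊢
    generalize deriv f (r * u) = a at hB ⊢
    have huu : u * (starRingEnd ℂ) u = 1 := by rw [Complex.mul_conj', hu]; simp
    have haa : (starRingEnd ℂ) a * a = ((‖a‖ ^ 2 : ℝ) : ℂ) := by
      rw [Complex.conj_mul']; push_cast; ring
    have h1 : ((starRingEnd ℂ) a * u * ((1 - r ^ 2 : ℝ) * b - 2 * (r * (starRingEnd ℂ) u) * a)).re
        ≤ ‖a‖ * (4 * ‖a‖) := by
      refine (Complex.re_le_norm _).trans ?_
      rw [norm_mul, norm_mul, Complex.norm_conj, hu, mul_one]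
      exact mul_le_mul_of_nonneg_left hB (norm_nonneg _)
    have h2 : (starRingEnd ℂ) a * u * ((1 - r ^ 2 : ℝ) * b - 2 * (r * (starRingEnd ℂ) u) * a)
        = ((1 - r ^ 2 : ℝ) : ℂ) * ((b * u) * (starRingEnd ℂ) a) - ((2 * r * ‖a‖ ^ 2 : ℝ) : ℂ) := by
      have : ((2 * r * ‖a‖ ^ 2 : ℝ) : ℂ) = 2 * r * ((starRingEnd ℂ) a * a) := by
        rw [haa]; push_cast; ring
      rw [this]
      linear_combination (-2 * r * (starRingEnd ℂ) a * a) * huu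
    rw [h2, Complex.sub_re, Complex.re_ofReal_mul, Complex.ofReal_re] at h1
    rw [Complex.inner]
    linarith
  have hD : AntitoneOn (fun r ↦ N r * ((1 - r) ^ 6 / (1 + r) ^ 2)) (Ico 0 1) := by
    have hder : ∀ r ∈ Ico (0 : ℝ) 1, HasDerivAt (fun r ↦ N r * ((1 - r) ^ 6 / (1 + r) ^ 2))
        ((N' r * (1 - r ^ 2) - N r * (8 + 4 * r)) * ((1 - r) ^ 5 / (1 + r) ^ 3)) r := by
      intro r hr
      have hr1 : 1 + r ≠ 0 := by linarith [hr.1]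
      convert! (hNd r hr).mul ((((hasDerivAt_id r).const_sub 1).pow 6).div
        (((hasDerivAt_id r).const_add 1).pow 2) (pow_ne_zero 2 hr1)) using 1
      simp
      field_simp
      ring
    refine antitoneOn_of_hasDerivWithinAt_nonpos (convex_Ico 0 1)
      (fun r hr ↦ (hder r hr).continuousAt.continuousWithinAt)
      (fun r hr ↦ (hder r (interior_subset hr)).hasDerivWithinAt) fun r hr ↦ ?_
    have hr' := interior_subset hr
    have h1 : 0 ≤ 1 - r := by linarith [hr'.2]
    have h2 : 0 ≤ 1 + r := by linarith [hr'.1]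
    exact mul_nonpos_of_nonpos_of_nonneg (sub_nonpos.2 (hbound r hr')) (by positivity)
  have hr := norm_nonneg z
  have := hD (left_mem_Ico.2 one_pos) ⟨hr, hz⟩ hr
  simp only [hN, ← hzu, Complex.ofReal_zero, zero_mul] at this
  rw [← mul_div_assoc, div_le_iff₀ (by positivity)] at this
  have h1 : 0 ≤ 1 - ‖z‖ := by linarith
  refine le_of_sq_le_sq ?_ (by positivity)
  norm_num at this
  linarith

/-- A Harnack-type bound for holomorphic functions with nonnegative real part. -/
lemma norm_mul_one_sub_le_of_re_nonneg {q : ℂ → ℂ} (hq : DifferentiableOn ℂ q (ball 0 1))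
    (hre : ∀ z ∈ ball (0 : ℂ) 1, 0 ≤ (q z).re) {a : ℝ} (h0 : q 0 = a) {z : ℂ}
    (hz : z ∈ ball (0 : ℂ) 1) : ‖q z‖ * (1 - ‖z‖) ≤ a * (1 + ‖z‖) := by
  have hz0 : (0 : ℂ) ∈ ball (0 : ℂ) 1 := mem_ball_self one_pos
  have ha : 0 ≤ a := by simpa [h0] using hre 0 hz0
  have hz1 : ‖z‖ < 1 := by simpa using hz
  have key : ∀ δ > 0, ‖q z + (δ : ℝ)‖ * (1 - ‖z‖) ≤ (a + δ) * (1 + ‖z‖) := by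
    intro δ hδ
    have hA : 0 < a + δ := by linarith
    have hne : ∀ x ∈ ball (0 : ℂ) 1, q x + (δ : ℝ) + (a + δ : ℝ) ≠ 0 := by
      intro x hx h
      have := congrArg Complex.re h
      simp only [Complex.add_re, Complex.ofReal_re, Complex.zero_re] at this
      linarith [hre x hx]
    set W : ℂ → ℂ := fun x ↦ (q x + (δ : ℝ) - (a + δ : ℝ)) / (q x + (δ : ℝ) + (a + δ : ℝ)) with hW
    have hWd : DifferentiableOn ℂ W (ball 0 1) :=
      DifferentiableOn.div (by fun_prop) (by fun_prop) hne
    have hWm : MapsTo W (ball 0 1) (closedBall 0 1) := by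
      intro x hx
      rw [mem_closedBall_zero_iff, hW, norm_div, div_le_one (norm_pos_iff.2 (hne x hx))]
      refine le_of_sq_le_sq ?_ (norm_nonneg _)
      simp only [← Complex.normSq_eq_norm_sq, Complex.normSq_apply, Complex.add_re, Complex.add_im,
        Complex.sub_re, Complex.sub_im, Complex.ofReal_re, Complex.ofReal_im]
      nlinarith [mul_nonneg (add_nonneg (hre x hx) hδ.le) hA.le]
    have hW0 : W 0 = 0 := by simp [hW, h0]
    have hWz : ‖W z‖ ≤ ‖z‖ := by
      have h1 := Complex.norm_dslope_le_div_of_mapsTo_ball hWd (by rwa [hW0]) hz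
      have h2 := sub_smul_dslope W 0 z
      rw [hW0, sub_zero, sub_zero] at h2
      rw [← h2, norm_smul]
      exact mul_le_of_le_one_right (norm_nonneg _) (by simpa using h1)
    have hid : (q z + (δ : ℝ)) * (1 - W z) = (a + δ : ℝ) * (1 + W z) := by
      have := hne z hz
      simp only [hW]
      field_simp
      ring
    have h1 : 1 - ‖z‖ ≤ ‖1 - W z‖ := by
      have := norm_sub_norm_le (1 : ℂ) (W z)
      rw [norm_one] at this
      linarith
    have h2 : ‖1 + W z‖ ≤ 1 + ‖z‖ := by
      have := norm_add_le (1 : ℂ) (W z)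
      rw [norm_one] at this
      linarith
    have h3 := congrArg norm hid
    rw [norm_mul, norm_mul, Complex.norm_real, Real.norm_of_nonneg hA.le] at h3
    calc _ ≤ ‖q z + (δ : ℝ)‖ * ‖1 - W z‖ := mul_le_mul_of_nonneg_left h1 (norm_nonneg _)
      _ = _ := h3
      _ ≤ _ := mul_le_mul_of_nonneg_left h2 hA.le
  have hcont : ∀ {f : ℝ → ℝ}, Continuous f → Tendsto f (𝓝[>] 0) (𝓝 (f 0)) :=
    fun hf ↦ hf.continuousAt.tendsto.mono_left nhdsWithin_le_nhds
  have := le_of_tendsto_of_tendsto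
    (hcont (f := fun δ ↦ ‖q z + (δ : ℝ)‖ * (1 - ‖z‖)) (by fun_prop))
    (hcont (f := fun δ ↦ (a + δ) * (1 + ‖z‖)) (by fun_prop))
    (by filter_upwards [self_mem_nhdsWithin] with δ hδ using key δ hδ)
  simpa using this

/-- A Schwarz function with derivative `a` at the origin is close to the identity. -/
lemma norm_sub_schwarz_mul_le {φ : ℂ → ℂ} (hφ : DifferentiableOn ℂ φ (ball 0 1))
    (hφle : ∀ z ∈ ball (0 : ℂ) 1, ‖φ z‖ ≤ ‖z‖) {a : ℝ} (hφ' : deriv φ 0 = a) {z : ℂ}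
    (hz : z ∈ ball (0 : ℂ) 1) :
    ‖z - φ z‖ * (1 - ‖z‖) ≤ ‖z‖ * ((1 - a) * (1 + ‖z‖)) := by
  have hφ0 : φ 0 = 0 := by simpa using hφle 0 (mem_ball_self one_pos)
  have hmaps : MapsTo φ (ball 0 1) (closedBall (φ 0) 1) := fun x hx ↦ by
    rw [hφ0, mem_closedBall_zero_iff]
    exact (hφle x hx).trans (by simpa using (mem_ball_zero_iff.1 hx).le)
  have hg : DifferentiableOn ℂ (dslope φ 0) (ball 0 1) :=
    (Complex.differentiableOn_dslope (ball_mem_nhds _ one_pos)).2 hφ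
  have h := norm_mul_one_sub_le_of_re_nonneg (q := fun z ↦ 1 - dslope φ 0 z) (a := 1 - a)
    (by fun_prop) (fun x hx ↦ by
      have h1 := Complex.norm_dslope_le_div_of_mapsTo_ball hφ hmaps hx
      have h2 := Complex.re_le_norm (dslope φ 0 x)
      rw [div_one] at h1
      rw [Complex.sub_re, Complex.one_re]
      linarith) (by simp [dslope_same, hφ']) hz
  have h1 := sub_smul_dslope φ 0 z
  rw [hφ0, sub_zero, sub_zero, smul_eq_mul] at h1
  rw [← h1, ← mul_one_sub, norm_mul, mul_assoc]
  exact mul_le_mul_of_nonneg_left h (norm_nonneg _)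

/-- For `0 ≤ s ≤ t`, `F` analytic injective on the disc with `F 0 = 0`, `F'(0) = e^t`,
and a Schwarz function `φ` with `φ'(0) = e^{s-t}`,
`|F z - F (φ z)| ≤ 8 |z| (e^t - e^s)/(1-|z|)⁴` on the unit disc. -/
theorem loewner_chain_time_estimate (s t : ℝ) (hs : 0 ≤ s) (hst : s ≤ t)
    (F φ : ℂ → ℂ)
    (hF : DifferentiableOn ℂ F (ball (0 : ℂ) 1))
    (hFinj : Set.InjOn F (ball (0 : ℂ) 1))
    (hF0 : F 0 = 0) (hF' : deriv F 0 = (Real.exp t : ℂ))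
    (hφ : DifferentiableOn ℂ φ (ball (0 : ℂ) 1))
    (hφ0 : φ 0 = 0)
    (hφle : ∀ z ∈ ball (0 : ℂ) 1, ‖φ z‖ ≤ ‖z‖)
    (hφ' : deriv φ 0 = (Real.exp (s - t) : ℂ)) :
    ∀ z ∈ ball (0 : ℂ) 1,
      ‖F z - F (φ z)‖ ≤ 8 * ‖z‖ * (Real.exp t - Real.exp s) / (1 - ‖z‖) ^ 4 := by
  intro z hz
  have hz1 : ‖z‖ < 1 := by simpa using hz
  have hz0 := norm_nonneg z
  have hpos : 0 < 1 - ‖z‖ := by linarith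
  have het := Real.exp_pos t
  have hsub : closedBall (0 : ℂ) ‖z‖ ⊆ ball 0 1 := closedBall_subset_ball hz1
  have hder : ∀ w ∈ closedBall (0 : ℂ) ‖z‖,
      ‖deriv F w‖ ≤ (1 + ‖z‖) * Real.exp t / (1 - ‖z‖) ^ 3 := by
    intro w hw
    have hwz : ‖w‖ ≤ ‖z‖ := by simpa using hw
    have h := norm_deriv_mul_one_sub_pow_le hF hFinj (hwz.trans_lt hz1)
    rw [hF', Complex.norm_real, Real.norm_of_nonneg het.le] at h
    rw [le_div_iff₀ (by positivity)]
    calc _ ≤ ‖deriv F w‖ * (1 - ‖w‖) ^ 3 := by gcongr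
      _ ≤ _ := h
      _ ≤ _ := by gcongr
  have hmvt := (convex_closedBall (0 : ℂ) ‖z‖).norm_image_sub_le_of_norm_deriv_le
    (fun w hw ↦ hF.differentiableAt (isOpen_ball.mem_nhds (hsub hw))) hder
    (x := φ z) (y := z) (by simpa using hφle z hz) (by simp)
  have hφz := norm_sub_schwarz_mul_le hφ hφle hφ' hz
  rw [← le_div_iff₀ hpos] at hφz
  have hexp : Real.exp t * (1 - Real.exp (s - t)) = Real.exp t - Real.exp s := by
    rw [mul_sub, mul_one, ← Real.exp_add, add_sub_cancel]
  have hdiff : 0 ≤ Real.exp t - Real.exp s := sub_nonneg.2 (Real.exp_le_exp.2 hst)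
  calc ‖F z - F (φ z)‖ ≤ _ := hmvt
    _ ≤ (1 + ‖z‖) * Real.exp t / (1 - ‖z‖) ^ 3 *
        (‖z‖ * ((1 - Real.exp (s - t)) * (1 + ‖z‖)) / (1 - ‖z‖)) := by gcongr
    _ = (1 + ‖z‖) ^ 2 * ‖z‖ * (Real.exp t - Real.exp s) / (1 - ‖z‖) ^ 4 := by
      rw [← hexp]; field_simp
    _ ≤ _ := by
      gcongr
      nlinarith
end
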